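/- Let s = n/2 − 1/q and suppose either n = 1 and 2 < q < ∞, or n ≥ 2 and 1 < q < ∞. Then for every α < q there is a constant C such that ‖ Σ_j λ_j |e^{itΔ}f_j|² ‖_{L^q(ℝ, L^∞(ℝⁿ))} ≤ C ‖{λ_j}‖_{ℓ^α} for all families {f_j} orthonormal in Ḣ^s(ℝⁿ) and all {λ_j} ∈ ℓ^α; moreover, for every α > q no such finite constant exists. -/

import Mathlib

noncomputable section

open MeasureTheory ENNReal Real Set

namespace OS

/-- `ℝⁿ` as a Euclidean space. -/
abbrev Rn (n : ℕ) := EuclideanSpace ℝ (Fin n)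

/-- The real dot product `x·ξ`, viewed as a complex number. -/
def dotC {n : ℕ} (x ξ : Rn n) : ℂ := ((∑ i, x i * ξ i : ℝ) : ℂ)

/-- The Fourier transform `f̂(ξ) = ∫ f(x) e^{-i x·ξ} dx`. -/
def FT {n : ℕ} (f : Rn n → ℂ) (ξ : Rn n) : ℂ :=
  ∫ x : Rn n, Complex.exp (-(Complex.I * dotC x ξ)) * f x

/-- The propagator `e^{itΔ}` composed with a Fourier multiplier `m`:
`x ↦ (2π)^{-n} ∫ e^{i(x·ξ - t|ξ|²)} m(ξ) f̂(ξ) dξ`. -/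
def prop {n : ℕ} (m : Rn n → ℂ) (f : Rn n → ℂ) (t : ℝ) (x : Rn n) : ℂ :=
  ((2 * π : ℝ) ^ (-(n : ℝ)) : ℝ) •
    ∫ ξ : Rn n, Complex.exp (Complex.I * (dotC x ξ - (t : ℂ) * ((‖ξ‖ : ℝ) : ℂ) ^ 2)) *
      (m ξ * FT f ξ)

/-- The free Schrödinger propagator `e^{itΔ} f`, as a function of `(t, x)`. -/
def schrodinger {n : ℕ} (f : Rn n → ℂ) : ℝ → Rn n → ℂ := prop (fun _ => 1) f

/-- The Fourier multiplier `|ξ|^{-s} ψ(2^{-k}|ξ|)` of `(-Δ)^{-s/2} P_k`. -/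
def LPmult {n : ℕ} (s : ℝ) (ψ : ℝ → ℝ) (k : ℤ) (ξ : Rn n) : ℂ :=
  ((‖ξ‖ ^ (-s) * ψ ((2 : ℝ) ^ (-k) * ‖ξ‖) : ℝ) : ℂ)

/-- The Littlewood–Paley projection `P_k h`. -/
def LP {n : ℕ} (ψ : ℝ → ℝ) (k : ℤ) (h : Rn n → ℂ) (x : Rn n) : ℂ :=
  ((2 * π : ℝ) ^ (-(n : ℝ)) : ℝ) •
    ∫ ξ : Rn n, Complex.exp (Complex.I * dotC x ξ) *
      (((ψ ((2 : ℝ) ^ (-k) * ‖ξ‖) : ℝ) : ℂ) * FT h ξ)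

/-- The standing hypotheses on the Littlewood–Paley bump function `ψ`:
smooth, `[0,1]`-valued, supported in `[1/2,2]`, with `∑_{k∈ℤ} ψ(2^{-k} r) = 1` for `r ≠ 0`. -/
structure IsLPF (ψ : ℝ → ℝ) : Prop where
  smooth : ContDiff ℝ (⊤ : ℕ∞) ψ
  mem_Icc : ∀ r, ψ r ∈ Icc (0 : ℝ) 1
  supp : Function.support ψ ⊆ Icc (1 / 2 : ℝ) 2
  sum_one : ∀ r : ℝ, r ≠ 0 → ∑' k : ℤ, ψ ((2 : ℝ) ^ (-k) * r) = 1

/-- Orthonormality in `L²(ℝⁿ)`. -/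
def OrthonormalL2 {n : ℕ} (f : ℕ → Rn n → ℂ) : Prop :=
  ∀ j k, (∫ x : Rn n, f j x * (starRingEnd ℂ) (f k x)) = if j = k then 1 else 0

/-- Orthonormality in the homogeneous Sobolev space `Ḣ^s(ℝⁿ)`:
`(2π)^{-n} ∫ |ξ|^{2s} f̂_j(ξ) conj(f̂_k(ξ)) dξ = δ_{jk}`. -/
def OrthonormalHs {n : ℕ} (s : ℝ) (f : ℕ → Rn n → ℂ) : Prop :=
  ∀ j k, ((2 * π : ℝ) ^ (-(n : ℝ)) : ℝ) •
    (∫ ξ : Rn n, ((‖ξ‖ ^ (2 * s) : ℝ) : ℂ) * (FT (f j) ξ * (starRingEnd ℂ) (FT (f k) ξ)))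
      = if j = k then 1 else 0

/-- The density `Σ_j λ_j |u_j(t,x)|²` of a system of space-time functions. -/
def density2 {n : ℕ} (lam : ℕ → ℝ) (u : ℕ → ℝ → Rn n → ℂ) (t : ℝ) (x : Rn n) : ℝ :=
  ∑' j, lam j * ‖u j t x‖ ^ 2

/-- The density `Σ_j λ_j |e^{itΔ}f_j(x)|²`. -/
def density {n : ℕ} (lam : ℕ → ℝ) (f : ℕ → Rn n → ℂ) : ℝ → Rn n → ℝ :=
  density2 lam fun j => schrodinger (f j)

/-- The `L^q` norm (w.r.t. `μ`) of an `ℝ≥0∞`-valued function. -/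
def eLp {α : Type*} [MeasurableSpace α] (μ : Measure α) (q : ℝ≥0∞) (F : α → ℝ≥0∞) : ℝ≥0∞ :=
  if q = ∞ then essSup F μ
  else (∫⁻ t, F t ^ q.toReal ∂μ) ^ (1 / q.toReal)

/-- The Lorentz `L^{p,r}` (quasi)norm of an `ℝ≥0∞`-valued function, via the
distribution function.  For `r = ∞` this is the weak-`L^p` quasinorm
`sup_{s>0} s μ(G > s)^{1/p} = sup_{t>0} t^{1/p} G^*(t)`. -/
def lor {α : Type*} [MeasurableSpace α] (μ : Measure α) (p r : ℝ≥0∞) (G : α → ℝ≥0∞) : ℝ≥0∞ :=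
  if p = ∞ then essSup G μ
  else if r = ∞ then
    ⨆ (s : ℝ) (_ : 0 < s), ENNReal.ofReal s * μ {x | ENNReal.ofReal s < G x} ^ (1 / p.toReal)
  else
    (∫⁻ s in Ioi (0 : ℝ),
      (ENNReal.ofReal s * μ {x | ENNReal.ofReal s < G x} ^ (1 / p.toReal)) ^ r.toReal *
        (ENNReal.ofReal s)⁻¹) ^ (1 / r.toReal)

/-- The mixed norm `‖u‖_{L^q(ℝ, L^p(ℝⁿ))}`. -/
def mixedLp {n : ℕ} {E : Type*} [NormedAddCommGroup E] (q p : ℝ≥0∞)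
    (u : ℝ → Rn n → E) : ℝ≥0∞ :=
  eLp volume q fun t => eLpNorm (u t) p volume

/-- The mixed norm `‖u‖_{L^{q,∞}(ℝ, L^p(ℝⁿ))}` (weak in time). -/
def mixedWeakLp {n : ℕ} {E : Type*} [NormedAddCommGroup E] (q p : ℝ≥0∞)
    (u : ℝ → Rn n → E) : ℝ≥0∞ :=
  lor volume q ∞ fun t => eLpNorm (u t) p volume

/-- The weak `L^{p,∞}(ℝⁿ)` quasinorm. -/
def wLp {n : ℕ} {E : Type*} [NormedAddCommGroup E] (p : ℝ≥0∞) (g : Rn n → E) : ℝ≥0∞ :=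
  lor volume p ∞ fun x => (‖g x‖₊ : ℝ≥0∞)

/-- The mixed Lorentz norm `‖u‖_{L^{q,r}(ℝ, L^{p,r̃}(ℝⁿ))}`. -/
def mixedLorentz {n : ℕ} {E : Type*} [NormedAddCommGroup E] (q r p rt : ℝ≥0∞)
    (u : ℝ → Rn n → E) : ℝ≥0∞ :=
  lor volume q r fun t => lor volume p rt fun x => (‖u t x‖₊ : ℝ≥0∞)

/-- The `ℓ^a` norm of a sequence (with `ℓ^∞` the supremum norm). -/
def seqNormE (a : ℝ≥0∞) (lam : ℕ → ℝ) : ℝ≥0∞ :=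
  if a = ∞ then ⨆ j, ENNReal.ofReal |lam j|
  else (∑' j, ENNReal.ofReal |lam j| ^ a.toReal) ^ (1 / a.toReal)

/-- The decreasing rearrangement of a sequence: `seqRearr lam j` is the
`(j+1)`-th largest value of `|lam i|`. -/
def seqRearr (lam : ℕ → ℝ) (j : ℕ) : ℝ≥0∞ :=
  sInf {s : ℝ≥0∞ | Measure.count {i : ℕ | s < ENNReal.ofReal |lam i|} ≤ (j : ℝ≥0∞)}

/-- The Lorentz sequence norm `‖lam‖_{ℓ^{q,r}} = (Σ_j (j^{1/q} λ*_j)^r / j)^{1/r}`,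
parametrized by `qinv = 1/q` and a finite second exponent `r`. -/
def seqLor (qinv r : ℝ) (lam : ℕ → ℝ) : ℝ≥0∞ :=
  (∑' j : ℕ, (((j : ℝ≥0∞) + 1) ^ qinv * seqRearr lam j) ^ r * ((j : ℝ≥0∞) + 1)⁻¹) ^ (1 / r)

/-- The interior of the triangle `OAB`, in the coordinates `(a, b) = (1/p, 1/q)`. -/
def IntOAB (n : ℕ) (a b : ℝ) : Prop :=
  a ∈ Ioo (0 : ℝ) 1 ∧ b ∈ Ioo (0 : ℝ) 1 ∧ b < (n : ℝ) / (n - 1) * a ∧ 2 * b + n * a < n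

/-- The interior of the quadrilateral `OCDA`, in the coordinates `(a, b) = (1/p, 1/q)`. -/
def IntOCDA (n : ℕ) (a b : ℝ) : Prop :=
  a ∈ Ioo (0 : ℝ) 1 ∧ b ∈ Ioo (0 : ℝ) 1 ∧ (n : ℝ) / (n - 1) * a < b ∧ 2 * b + n * a < n

def ptO : ℝ × ℝ := (0, 0)
def ptA (n : ℕ) : ℝ × ℝ := (((n : ℝ) - 1) / (n + 1), (n : ℝ) / (n + 1))
def ptB : ℝ × ℝ := (1, 0)
def ptC : ℝ × ℝ := (0, 1)
def ptD (n : ℕ) : ℝ × ℝ := (((n : ℝ) - 2) / n, 1)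

/-- The closed triangle `OAB`. -/
def OAB (n : ℕ) : Set (ℝ × ℝ) := convexHull ℝ {ptO, ptA n, ptB}

/-- The closed quadrilateral `OCDA`. -/
def OCDA (n : ℕ) : Set (ℝ × ℝ) := convexHull ℝ {ptO, ptC, ptD n, ptA n}

/-- The half-open segment `[A, D)`. -/
def segAD (n : ℕ) : Set (ℝ × ℝ) := {x | ∃ t ∈ Ico (0 : ℝ) 1, x = (1 - t) • ptA n + t • ptD n}

/-- The Lebesgue exponent with reciprocal `a` (so `expOf 0 = ∞`). -/
def expOf (a : ℝ) : ℝ≥0∞ := (ENNReal.ofReal a)⁻¹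

/-- The weighted velocity average `∫ f(x - tv, v) |v|^{-2s} dv` of the solution of
the kinetic transport equation with datum `f`. -/
def velAvg {n : ℕ} (s : ℝ) (f : Rn n × Rn n → ℂ) (t : ℝ) (x : Rn n) : ℂ :=
  ∫ v : Rn n, ((‖v‖ ^ (-(2 * s)) : ℝ) : ℂ) * f (x - t • v, v)

end OS

open OS

/-- The Schrödinger phase `e^{i(x·ξ - t|ξ|²)}`. -/
def phase {n : ℕ} (t : ℝ) (x ξ : Rn n) : ℂ :=
  Complex.exp (Complex.I * (dotC x ξ - (t : ℂ) * ((‖ξ‖ : ℝ) : ℂ) ^ 2))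

/-- The superposition `∫ e^{i(x·ξ - t|ξ|²)} φ(ξ) dξ` of plane waves with amplitude `φ`. -/
def wave {n : ℕ} (φ : Rn n → ℂ) (t : ℝ) (x : Rn n) : ℂ := ∫ ξ, phase t x ξ * φ ξ

lemma phase_eq {n : ℕ} (t : ℝ) (x ξ : Rn n) :
    phase t x ξ = Complex.exp (((∑ i, x i * ξ i - t * ‖ξ‖ ^ 2 : ℝ) : ℂ) * Complex.I) := by
  simp only [phase, dotC]
  congr 1
  push_cast
  ring

lemma norm_phase {n : ℕ} (t : ℝ) (x ξ : Rn n) : ‖phase t x ξ‖ = 1 := by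
  rw [phase_eq, Complex.norm_exp_ofReal_mul_I]

lemma phase_mul_conj {n : ℕ} (t t' : ℝ) (x x' ξ : Rn n) :
    phase t x ξ * (starRingEnd ℂ) (phase t' x' ξ) = phase (t - t') (x - x') ξ := by
  simp only [phase_eq, ← Complex.exp_conj, map_mul, Complex.conj_ofReal, Complex.conj_I,
    ← Complex.exp_add]
  congr 1
  simp only [PiLp.sub_apply, sub_mul, Finset.sum_sub_distrib]
  push_cast
  ring

lemma dotC_eq_inner {n : ℕ} (x ξ : Rn n) : dotC x ξ = ((inner ℝ x ξ : ℝ) : ℂ) := by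
  simp only [dotC, PiLp.inner_apply, RCLike.inner_apply, conj_trivial, mul_comm]

lemma norm_integral_gaussian_phase_le {n : ℕ} {τ : ℝ} (hτ : 0 < τ) (t : ℝ) (x : Rn n) :
    ‖∫ ξ, ((Real.exp (-(τ * ‖ξ‖ ^ 2)) : ℝ) : ℂ) * phase t x ξ‖
      ≤ π ^ ((n : ℝ) / 2) * max τ |t| ^ (-((n : ℝ) / 2)) := by
  set b : ℂ := τ + t * Complex.I with hb
  have hbre : b.re = τ := by simp [hb]
  have hbim : b.im = t := by simp [hb]
  have hb0 : 0 < b.re := by rw [hbre]; exact hτ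
  have key : ∫ ξ, ((Real.exp (-(τ * ‖ξ‖ ^ 2)) : ℝ) : ℂ) * phase t x ξ
      = (π / b : ℂ) ^ (n / 2 : ℂ) * Complex.exp (Complex.I ^ 2 * ‖x‖ ^ 2 / (4 * b)) := by
    have := GaussianFourier.integral_cexp_neg_mul_sq_norm_add hb0 Complex.I x
    rw [finrank_euclideanSpace_fin] at this
    rw [← this]
    congr 1
    ext ξ
    rw [phase, dotC_eq_inner, Complex.ofReal_exp, ← Complex.exp_add, hb]
    congr 1
    push_cast
    ring
  have hbn : max τ |t| ≤ ‖b‖ := by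
    apply max_le
    · exact (le_abs_self τ).trans (hbre ▸ Complex.abs_re_le_norm b)
    · exact hbim ▸ Complex.abs_im_le_norm b
  have hmax : 0 < max τ |t| := lt_max_of_lt_left hτ
  rw [key, norm_mul]
  have h1 : ‖(π / b : ℂ) ^ (n / 2 : ℂ)‖ ≤ π ^ ((n : ℝ) / 2) * max τ |t| ^ (-((n : ℝ) / 2)) := by
    have : (n / 2 : ℂ) = ((n / 2 : ℝ) : ℂ) := by push_cast; rfl
    rw [this, Complex.norm_cpow_real, norm_div, Complex.norm_real, Real.norm_eq_abs,
      abs_of_pos Real.pi_pos, Real.div_rpow Real.pi_pos.le (norm_nonneg _), Real.rpow_neg hmax.le,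
      ← div_eq_mul_inv]
    gcongr
  have h2 : ‖Complex.exp (Complex.I ^ 2 * ‖x‖ ^ 2 / (4 * b))‖ ≤ 1 := by
    rw [Complex.norm_exp, Real.exp_le_one_iff]
    have : Complex.I ^ 2 * (‖x‖ : ℂ) ^ 2 / (4 * b) = ((-(‖x‖ ^ 2 / 4) : ℝ) : ℂ) * b⁻¹ := by
      rw [Complex.I_sq]; push_cast; field_simp
    rw [this, Complex.re_ofReal_mul, Complex.inv_re]
    have : 0 ≤ b.re / Complex.normSq b := div_nonneg hb0.le (Complex.normSq_nonneg _)
    nlinarith [sq_nonneg ‖x‖]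
  calc _ ≤ _ * 1 := mul_le_mul h1 h2 (norm_nonneg _) (by positivity)
    _ = _ := mul_one _

/-- A weighted `TT*` inequality: the quadratic form of `T T*` is controlled by a bound on its
kernel. -/
lemma lintegral_weight_mul_sq_enorm_integral_le {Ω : Type*} [MeasurableSpace Ω] {μ : Measure Ω}
    [SFinite μ] {ν : Measure ℝ} [IsFiniteMeasure ν] {e : ℝ → Ω → ℂ}
    (he : Measurable (Function.uncurry e)) (he1 : ∀ t ω, ‖e t ω‖ ≤ 1) {c : ℝ → ℂ}
    (hc : Measurable c) {M : ℝ} (hM : ∀ t, ‖c t‖ ≤ M) {m : Ω → ℝ} (hm0 : ∀ ω, 0 ≤ m ω)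
    (hm : Integrable m μ) {κ : ℝ → ℝ → ℝ≥0∞}
    (hκ : ∀ t t', ‖∫ ω, (m ω : ℂ) * (e t ω * (starRingEnd ℂ) (e t' ω)) ∂μ‖ₑ ≤ κ t t') :
    ∫⁻ ω, ENNReal.ofReal (m ω) * ‖∫ t, c t * e t ω ∂ν‖ₑ ^ 2 ∂μ
      ≤ ∫⁻ t, ∫⁻ t', ‖c t‖ₑ * ‖c t'‖ₑ * κ t t' ∂ν ∂ν := by
  have hM0 : 0 ≤ M := (norm_nonneg _).trans (hM 0)
  set Φ : Ω → ℂ := fun ω => ∫ t, c t * e t ω ∂ν with hΦ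
  have hΦm : StronglyMeasurable Φ := by
    apply StronglyMeasurable.integral_prod_right (f := fun ω t => c t * e t ω)
    apply Measurable.stronglyMeasurable
    exact (hc.comp measurable_snd).mul (he.comp measurable_swap)
  have hΦb : ∀ ω, ‖Φ ω‖ ≤ M * ν.real univ := by
    intro ω
    apply norm_integral_le_of_norm_le_const
    filter_upwards with t
    rw [norm_mul]
    calc _ ≤ M * 1 := mul_le_mul (hM t) (he1 t ω) (norm_nonneg _) hM0
      _ = M := mul_one M
  let F : Ω → ℝ × ℝ → ℂ := fun ω p =>
    (m ω : ℂ) * ((c p.1 * e p.1 ω) * (starRingEnd ℂ) (c p.2 * e p.2 ω))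
  have hFm : AEStronglyMeasurable (Function.uncurry F) (μ.prod (ν.prod ν)) := by
    have h1 : AEStronglyMeasurable (fun z : Ω × ℝ × ℝ => (m z.1 : ℂ)) (μ.prod (ν.prod ν)) :=
      (Complex.continuous_ofReal.comp_aestronglyMeasurable hm.1).comp_fst
    refine h1.mul (Measurable.aestronglyMeasurable ?_)
    refine Measurable.mul ?_ (Complex.continuous_conj.measurable.comp ?_)
    · exact (hc.comp (measurable_fst.comp measurable_snd)).mul
        (he.comp ((measurable_fst.comp measurable_snd).prodMk measurable_fst))
    · exact (hc.comp (measurable_snd.comp measurable_snd)).mul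
        (he.comp ((measurable_snd.comp measurable_snd).prodMk measurable_fst))
  have hFi : Integrable (Function.uncurry F) (μ.prod (ν.prod ν)) := by
    have hd : Integrable (fun z : Ω × ℝ × ℝ => m z.1 * (M * M)) (μ.prod (ν.prod ν)) :=
      hm.mul_prod (integrable_const (M * M))
    refine hd.mono' hFm ?_
    filter_upwards with z
    simp only [F, Function.uncurry, norm_mul, Complex.norm_real, Real.norm_eq_abs,
      abs_of_nonneg (hm0 _), RCLike.norm_conj]
    have h1 : ‖c z.2.1‖ * ‖e z.2.1 z.1‖ ≤ M := by
      simpa using mul_le_mul (hM z.2.1) (he1 z.2.1 z.1) (norm_nonneg _) hM0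
    have h2 : ‖c z.2.2‖ * ‖e z.2.2 z.1‖ ≤ M := by
      simpa using mul_le_mul (hM z.2.2) (he1 z.2.2 z.1) (norm_nonneg _) hM0
    have := hm0 z.1
    gcongr
  have hsw : ∫ ω, (m ω : ℂ) * (Φ ω * (starRingEnd ℂ) (Φ ω)) ∂μ
      = ∫ t, ∫ t', c t * (starRingEnd ℂ) (c t') *
          ∫ ω, (m ω : ℂ) * (e t ω * (starRingEnd ℂ) (e t' ω)) ∂μ ∂ν ∂ν := by
    have h1 : ∀ ω, (m ω : ℂ) * (Φ ω * (starRingEnd ℂ) (Φ ω)) = ∫ p, F ω p ∂(ν.prod ν) := by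
      intro ω
      rw [integral_const_mul]
      congr 1
      rw [hΦ, ← integral_conj, ← integral_prod_mul]
    simp_rw [h1]
    rw [integral_integral_swap hFi, integral_prod]
    · congr 1; ext t; congr 1; ext t'
      rw [← integral_const_mul]
      congr 1; ext ω
      simp only [F, map_mul]
      ring
    · exact hFi.integral_prod_right
  have hL : ∫⁻ ω, ENNReal.ofReal (m ω) * ‖Φ ω‖ₑ ^ 2 ∂μ
      = ‖∫ ω, (m ω : ℂ) * (Φ ω * (starRingEnd ℂ) (Φ ω)) ∂μ‖ₑ := by
    have h1 : ∀ ω, (m ω : ℂ) * (Φ ω * (starRingEnd ℂ) (Φ ω)) = ((m ω * ‖Φ ω‖ ^ 2 : ℝ) : ℂ) := by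
      intro ω
      rw [Complex.mul_conj']
      push_cast
      ring
    simp_rw [h1]
    rw [integral_complex_ofReal, ← ofReal_norm, Complex.norm_real, Real.norm_eq_abs, abs_of_nonneg
      (integral_nonneg fun ω => mul_nonneg (hm0 ω) (sq_nonneg _)),
      ofReal_integral_eq_lintegral_ofReal]
    · congr 1; ext ω
      rw [ENNReal.ofReal_mul (hm0 ω), ENNReal.ofReal_pow (norm_nonneg _), ofReal_norm]
    · refine hm.mul_bdd (c := (M * ν.real univ) ^ 2) (hΦm.norm.pow 2).aestronglyMeasurable ?_
      filter_upwards with ω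
      rw [norm_pow, norm_norm]
      gcongr
      exact hΦb ω
    · filter_upwards with ω using mul_nonneg (hm0 ω) (sq_nonneg _)
  rw [hL, hsw]
  refine (enorm_integral_le_lintegral_enorm _).trans (lintegral_mono fun t => ?_)
  refine (enorm_integral_le_lintegral_enorm _).trans (lintegral_mono fun t' => ?_)
  rw [enorm_mul, enorm_mul, RCLike.enorm_conj]
  gcongr
  exact hκ t t'

lemma measurable_phase {n : ℕ} {α : Type*} [MeasurableSpace α] {f : α → ℝ} {g h : α → Rn n}
    (hf : Measurable f) (hg : Measurable g) (hh : Measurable h) :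
    Measurable fun a => phase (f a) (g a) (h a) := by
  unfold phase dotC
  have hg' : ∀ i, Measurable fun a => g a i := fun i =>
    ((continuous_apply i).comp (PiLp.continuous_ofLp 2 _)).measurable.comp hg
  have hh' : ∀ i, Measurable fun a => h a i := fun i =>
    ((continuous_apply i).comp (PiLp.continuous_ofLp 2 _)).measurable.comp hh
  fun_prop

/-- Superposition of `lintegral_weight_mul_sq_enorm_integral_le` over a family of weights. -/
lemma lintegral_superposition_mul_sq_enorm_integral_le {Ω S : Type*} [MeasurableSpace Ω]
    [MeasurableSpace S] {μ : Measure Ω} [SFinite μ] {ρ : Measure S} [SFinite ρ] {ν : Measure ℝ}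
    [IsFiniteMeasure ν] {e : ℝ → Ω → ℂ} (he : Measurable (Function.uncurry e))
    (he1 : ∀ t ω, ‖e t ω‖ ≤ 1) {c : ℝ → ℂ} (hc : Measurable c) {M : ℝ} (hM : ∀ t, ‖c t‖ ≤ M)
    {m : S → Ω → ℝ} (hmm : Measurable (Function.uncurry m)) (hm0 : ∀ᵐ s ∂ρ, ∀ ω, 0 ≤ m s ω)
    (hm : ∀ᵐ s ∂ρ, Integrable (m s) μ) {κ : S → ℝ → ℝ → ℝ≥0∞}
    (hκm : Measurable fun z : S × ℝ × ℝ => κ z.1 z.2.1 z.2.2)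
    (hκ : ∀ᵐ s ∂ρ, ∀ t t',
      ‖∫ ω, (m s ω : ℂ) * (e t ω * (starRingEnd ℂ) (e t' ω)) ∂μ‖ₑ ≤ κ s t t') :
    ∫⁻ ω, (∫⁻ s, ENNReal.ofReal (m s ω) ∂ρ) * ‖∫ t, c t * e t ω ∂ν‖ₑ ^ 2 ∂μ
      ≤ ∫⁻ t, ∫⁻ t', ‖c t‖ₑ * ‖c t'‖ₑ * ∫⁻ s, κ s t t' ∂ρ ∂ν ∂ν := by
  have hΦm : Measurable fun ω => ‖∫ t, c t * e t ω ∂ν‖ₑ ^ 2 := by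
    refine (Measurable.enorm ?_).pow_const 2
    refine (StronglyMeasurable.integral_prod_right (f := fun ω t => c t * e t ω) ?_).measurable
    exact ((hc.comp measurable_snd).mul (he.comp measurable_swap)).stronglyMeasurable
  have hcs : Measurable fun z : S × ℝ × ℝ => ‖c z.2.1‖ₑ * ‖c z.2.2‖ₑ * κ z.1 z.2.1 z.2.2 :=
    ((hc.comp (measurable_fst.comp measurable_snd)).enorm.mul
      (hc.comp (measurable_snd.comp measurable_snd)).enorm).mul hκm
  calc ∫⁻ ω, (∫⁻ s, ENNReal.ofReal (m s ω) ∂ρ) * ‖∫ t, c t * e t ω ∂ν‖ₑ ^ 2 ∂μ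
      = ∫⁻ ω, ∫⁻ s, ENNReal.ofReal (m s ω) * ‖∫ t, c t * e t ω ∂ν‖ₑ ^ 2 ∂ρ ∂μ := by
        congr 1; ext ω
        rw [lintegral_mul_const]
        exact (hmm.comp (measurable_id.prodMk measurable_const)).ennreal_ofReal
    _ = ∫⁻ s, ∫⁻ ω, ENNReal.ofReal (m s ω) * ‖∫ t, c t * e t ω ∂ν‖ₑ ^ 2 ∂μ ∂ρ := by
        apply lintegral_lintegral_swap
        exact ((hmm.comp measurable_swap).ennreal_ofReal.mul
          (hΦm.comp measurable_fst)).aemeasurable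
    _ ≤ ∫⁻ s, ∫⁻ t, ∫⁻ t', ‖c t‖ₑ * ‖c t'‖ₑ * κ s t t' ∂ν ∂ν ∂ρ := by
        apply lintegral_mono_ae
        filter_upwards [hm0, hm, hκ] with s h0 h1 h2
        exact lintegral_weight_mul_sq_enorm_integral_le he he1 hc hM h0 h1 h2
    _ = ∫⁻ t, ∫⁻ s, ∫⁻ t', ‖c t‖ₑ * ‖c t'‖ₑ * κ s t t' ∂ν ∂ρ ∂ν := by
        apply lintegral_lintegral_swap
        have : Measurable fun z : (S × ℝ) × ℝ => ‖c z.1.2‖ₑ * ‖c z.2‖ₑ * κ z.1.1 z.1.2 z.2 :=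
          hcs.comp ((measurable_fst.comp measurable_fst).prodMk
            ((measurable_snd.comp measurable_fst).prodMk measurable_snd))
        exact this.lintegral_prod_right'.aemeasurable
    _ = ∫⁻ t, ∫⁻ t', ‖c t‖ₑ * ‖c t'‖ₑ * ∫⁻ s, κ s t t' ∂ρ ∂ν ∂ν := by
        congr 1; ext t
        rw [lintegral_lintegral_swap]
        · congr 1; ext t'
          rw [lintegral_const_mul]
          exact hκm.comp (measurable_id.prodMk (measurable_const (a := (t, t'))))
        · exact (hcs.comp (measurable_fst.prodMk
            (measurable_const.prodMk measurable_snd))).aemeasurable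

lemma lintegral_rpow_mul_exp_neg {σ y : ℝ} (hσ : 0 < σ) (hy : 0 < y) :
    ∫⁻ τ in Ioi (0 : ℝ), ENNReal.ofReal (τ ^ (σ - 1) * Real.exp (-(τ * y)))
      = ENNReal.ofReal (Real.Gamma σ) * ENNReal.ofReal (y ^ (-σ)) := by
  have h := Real.integral_rpow_mul_exp_neg_mul_Ioi hσ hy
  have h0 : 0 ≤ᵐ[volume.restrict (Ioi (0 : ℝ))]
      fun τ : ℝ => τ ^ (σ - 1) * Real.exp (-(τ * y)) := by
    filter_upwards [ae_restrict_mem measurableSet_Ioi] with τ hτ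
    exact mul_nonneg (Real.rpow_nonneg (le_of_lt hτ) _) (Real.exp_pos _).le
  have h1 : ∫ τ in Ioi (0 : ℝ), τ ^ (σ - 1) * Real.exp (-(τ * y))
      = Real.Gamma σ * y ^ (-σ) := by
    simp_rw [mul_comm _ y]
    rw [h, one_div, Real.inv_rpow hy.le, Real.rpow_neg hy.le, mul_comm]
  have hpos : 0 < Real.Gamma σ * y ^ (-σ) :=
    mul_pos (Real.Gamma_pos_of_pos hσ) (Real.rpow_pos_of_pos hy _)
  rw [← ofReal_integral_eq_lintegral_ofReal _ h0, h1,
    ENNReal.ofReal_mul (Real.Gamma_pos_of_pos hσ).le]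
  by_contra hni
  rw [integral_undef hni] at h1
  exact hpos.ne h1

lemma lintegral_rpow_mul_max_le {σ d : ℝ} (hσ : 0 < σ) (hd : σ < d) (u : ℝ) :
    ∫⁻ τ in Ioi (0 : ℝ), ENNReal.ofReal (τ ^ (σ - 1) * max τ |u| ^ (-d))
      ≤ ENNReal.ofReal (1 / σ + 1 / (d - σ)) * ‖u‖ₑ ^ (-(d - σ)) := by
  have hdσ : 0 < d - σ := sub_pos.2 hd
  rcases eq_or_ne u 0 with rfl | hu
  · rw [enorm_zero, ENNReal.zero_rpow_of_neg (by linarith), ENNReal.mul_top]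
    · exact le_top
    · rw [ENNReal.ofReal_ne_zero_iff]; positivity
  have ha : 0 < |u| := abs_pos.2 hu
  have hr : ‖u‖ₑ ^ (-(d - σ)) = ENNReal.ofReal (|u| ^ (σ - d)) := by
    rw [← ofReal_norm, Real.norm_eq_abs, ENNReal.ofReal_rpow_of_pos ha, neg_sub]
  rw [hr, ← Ioc_union_Ioi_eq_Ioi ha.le, ENNReal.ofReal_add (by positivity) (by positivity),
    add_mul]
  refine (lintegral_union_le _ _ _).trans (add_le_add ?_ ?_)
  · have hi : IntegrableOn (fun τ : ℝ => τ ^ (σ - 1)) (Ioc 0 |u|) :=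
      (intervalIntegrable_iff_integrableOn_Ioc_of_le ha.le).1
        (intervalIntegral.intervalIntegrable_rpow' (by linarith))
    calc ∫⁻ τ in Ioc 0 |u|, ENNReal.ofReal (τ ^ (σ - 1) * max τ |u| ^ (-d))
        ≤ ∫⁻ τ in Ioc 0 |u|, ENNReal.ofReal (τ ^ (σ - 1) * |u| ^ (-d)) := by
          apply setLIntegral_mono' measurableSet_Ioc
          intro τ hτ
          rw [max_eq_right hτ.2]
      _ = ENNReal.ofReal (∫ τ in Ioc 0 |u|, τ ^ (σ - 1) * |u| ^ (-d)) := by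
          rw [ofReal_integral_eq_lintegral_ofReal (hi.mul_const _)]
          filter_upwards [ae_restrict_mem measurableSet_Ioc] with τ hτ
          exact mul_nonneg (Real.rpow_nonneg hτ.1.le _) (Real.rpow_nonneg ha.le _)
      _ = ENNReal.ofReal (1 / σ) * ENNReal.ofReal (|u| ^ (σ - d)) := by
          rw [← ENNReal.ofReal_mul (by positivity), integral_mul_const,
            ← intervalIntegral.integral_of_le ha.le, integral_rpow (by left; linarith),
            sub_add_cancel, Real.zero_rpow hσ.ne', sub_zero, sub_eq_add_neg σ d,
            Real.rpow_add ha]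
          congr 1; field_simp
      _ ≤ _ := le_rfl
  · have hi : IntegrableOn (fun τ : ℝ => τ ^ (σ - 1 - d)) (Ioi |u|) :=
      integrableOn_Ioi_rpow_of_lt (by linarith) ha
    calc ∫⁻ τ in Ioi |u|, ENNReal.ofReal (τ ^ (σ - 1) * max τ |u| ^ (-d))
        = ∫⁻ τ in Ioi |u|, ENNReal.ofReal (τ ^ (σ - 1 - d)) := by
          apply setLIntegral_congr_fun measurableSet_Ioi
          intro τ hτ
          have hτ' : |u| < τ := hτ
          simp only
          rw [max_eq_left hτ'.le, ← Real.rpow_add (ha.trans hτ'), ← sub_eq_add_neg]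
      _ = ENNReal.ofReal (∫ τ in Ioi |u|, τ ^ (σ - 1 - d)) := by
          rw [ofReal_integral_eq_lintegral_ofReal hi]
          filter_upwards [ae_restrict_mem measurableSet_Ioi] with τ hτ
          exact Real.rpow_nonneg (ha.trans hτ).le _
      _ = ENNReal.ofReal (1 / (d - σ)) * ENNReal.ofReal (|u| ^ (σ - d)) := by
          rw [← ENNReal.ofReal_mul (by positivity), integral_Ioi_rpow_of_lt (by linarith) ha]
          congr 1
          have h1 : σ - 1 - d + 1 = σ - d := by ring
          rw [h1, ← neg_sub d σ]
          field_simp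
      _ ≤ _ := le_rfl

/-- The Gaussian weights whose superposition is a multiple of `|ξ|^{-2σ}`. -/
def gaussWeight {n : ℕ} (σ τ : ℝ) (ξ : Rn n) : ℝ := τ ^ (σ - 1) * Real.exp (-(τ * ‖ξ‖ ^ 2))

lemma measurable_gaussWeight {n : ℕ} (σ : ℝ) :
    Measurable fun z : ℝ × Rn n => gaussWeight σ z.1 z.2 := by
  unfold gaussWeight
  fun_prop

lemma gaussWeight_nonneg {n : ℕ} {σ τ : ℝ} (hτ : 0 < τ) (ξ : Rn n) : 0 ≤ gaussWeight σ τ ξ := by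
  unfold gaussWeight; positivity

lemma integrable_gaussWeight {n : ℕ} (σ : ℝ) {τ : ℝ} (hτ : 0 < τ) :
    Integrable (gaussWeight (n := n) σ τ) := by
  have h := (GaussianFourier.integrable_cexp_neg_mul_sq_norm_add (V := Rn n) (b := (τ : ℂ))
    (by simpa using hτ) 0 0).norm.const_mul (τ ^ (σ - 1))
  refine h.congr (Filter.Eventually.of_forall fun ξ => ?_)
  simp only [gaussWeight, Complex.norm_exp]
  congr 2
  have : (-(τ : ℂ) * (‖ξ‖ : ℂ) ^ 2 + 0 * ((inner ℝ (0 : Rn n) ξ : ℝ) : ℂ))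
      = ((-(τ * ‖ξ‖ ^ 2) : ℝ) : ℂ) := by push_cast; ring
  rw [this, Complex.ofReal_re]

lemma norm_integral_gaussWeight_phase_le {n : ℕ} (σ : ℝ) {τ : ℝ} (hτ : 0 < τ) (t : ℝ) (x : Rn n) :
    ‖∫ ξ, (gaussWeight σ τ ξ : ℂ) * phase t x ξ‖
      ≤ π ^ ((n : ℝ) / 2) * (τ ^ (σ - 1) * max τ |t| ^ (-((n : ℝ) / 2))) := by
  have : ∀ ξ : Rn n, (gaussWeight σ τ ξ : ℂ) * phase t x ξ
      = ((τ ^ (σ - 1) : ℝ) : ℂ) * (((Real.exp (-(τ * ‖ξ‖ ^ 2)) : ℝ) : ℂ) * phase t x ξ) := by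
    intro ξ; rw [gaussWeight, Complex.ofReal_mul, mul_assoc]
  simp_rw [this]
  rw [integral_const_mul, norm_mul, Complex.norm_real, Real.norm_eq_abs,
    abs_of_pos (Real.rpow_pos_of_pos hτ _)]
  calc _ ≤ τ ^ (σ - 1) * (π ^ ((n : ℝ) / 2) * max τ |t| ^ (-((n : ℝ) / 2))) := by
        gcongr; exact norm_integral_gaussian_phase_le hτ t x
    _ = _ := by ring

lemma ofReal_rpow_le_lintegral_gaussWeight {n : ℕ} {σ : ℝ} (hσ : 0 < σ) (ξ : Rn n) :
    ENNReal.ofReal (‖ξ‖ ^ (-(2 * σ))) ≤ (ENNReal.ofReal (Real.Gamma σ))⁻¹ *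
      ∫⁻ τ in Ioi (0 : ℝ), ENNReal.ofReal (gaussWeight σ τ ξ) := by
  rcases eq_or_ne ξ 0 with rfl | hξ
  · rw [norm_zero, Real.zero_rpow (by linarith)]; simp
  · have h := norm_pos_iff.2 hξ
    unfold gaussWeight
    rw [lintegral_rpow_mul_exp_neg hσ (by positivity), ← mul_assoc, ENNReal.inv_mul_cancel, one_mul]
    · rw [← Real.rpow_natCast, ← Real.rpow_mul h.le]
      push_cast
      rw [mul_neg]
    · rw [ENNReal.ofReal_ne_zero_iff]; exact Real.Gamma_pos_of_pos hσ
    · exact ENNReal.ofReal_ne_top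

/-- The bound for the kernel of the superposed weights. -/
def kernelBound (n : ℕ) (σ τ u : ℝ) : ℝ≥0∞ :=
  ENNReal.ofReal (π ^ ((n : ℝ) / 2)) *
    ENNReal.ofReal (τ ^ (σ - 1) * max τ |u| ^ (-((n : ℝ) / 2)))

lemma measurable_kernelBound (n : ℕ) (σ : ℝ) :
    Measurable fun z : ℝ × ℝ => kernelBound n σ z.1 z.2 := by
  unfold kernelBound
  fun_prop

lemma enorm_integral_gaussWeight_phase_le {n : ℕ} (σ : ℝ) {τ : ℝ} (hτ : 0 < τ) (t : ℝ) (x : Rn n) :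
    ‖∫ ξ, (gaussWeight σ τ ξ : ℂ) * phase t x ξ‖ₑ ≤ kernelBound n σ τ t := by
  rw [← ofReal_norm, kernelBound, ← ENNReal.ofReal_mul (by positivity)]
  exact ENNReal.ofReal_le_ofReal (norm_integral_gaussWeight_phase_le σ hτ t x)

/-- The constant in `lintegral_kernelBound_le`. -/
def kernelConst (n : ℕ) (σ : ℝ) : ℝ≥0∞ :=
  ENNReal.ofReal (π ^ ((n : ℝ) / 2)) * ENNReal.ofReal (1 / σ + 1 / ((n : ℝ) / 2 - σ))

lemma lintegral_kernelBound_le {n : ℕ} {σ : ℝ} (hσ : 0 < σ) (hd : σ < (n : ℝ) / 2) (u : ℝ) :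
    ∫⁻ τ in Ioi (0 : ℝ), kernelBound n σ τ u
      ≤ kernelConst n σ * ‖u‖ₑ ^ (-((n : ℝ) / 2 - σ)) := by
  unfold kernelBound kernelConst
  rw [lintegral_const_mul' _ _ ENNReal.ofReal_ne_top, mul_assoc]
  gcongr
  exact lintegral_rpow_mul_max_le hσ hd u

set_option maxHeartbeats 400000 in
/-- The `TT*` inequality for the Schrödinger flow with weight `|ξ|^{-2σ}`. -/
lemma lintegral_rpow_mul_sq_enorm_phase_le {n : ℕ} {σ : ℝ} (hσ : 0 < σ) (hd : σ < (n : ℝ) / 2)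
    {ν : Measure ℝ} [IsFiniteMeasure ν] {x : ℝ → Rn n} (hx : Measurable x) {c : ℝ → ℂ}
    (hc : Measurable c) {M : ℝ} (hM : ∀ t, ‖c t‖ ≤ M) :
    ∫⁻ ξ, ENNReal.ofReal (‖ξ‖ ^ (-(2 * σ))) * ‖∫ t, c t * phase t (x t) ξ ∂ν‖ₑ ^ 2
      ≤ ((ENNReal.ofReal (Real.Gamma σ))⁻¹ * kernelConst n σ) *
        ∫⁻ t, ∫⁻ t', ‖c t‖ₑ * ‖c t'‖ₑ * ‖t - t'‖ₑ ^ (-((n : ℝ) / 2 - σ)) ∂ν ∂ν := by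
  have hG : (ENNReal.ofReal (Real.Gamma σ))⁻¹ ≠ ∞ := by
    rw [ENNReal.inv_ne_top, ENNReal.ofReal_ne_zero_iff]; exact Real.Gamma_pos_of_pos hσ
  have hK : kernelConst n σ ≠ ∞ := ENNReal.mul_ne_top ENNReal.ofReal_ne_top ENNReal.ofReal_ne_top
  have hmain := lintegral_superposition_mul_sq_enorm_integral_le (μ := (volume : Measure (Rn n)))
    (ρ := volume.restrict (Ioi (0 : ℝ))) (ν := ν) (e := fun t ξ => phase t (x t) ξ)
    (measurable_phase measurable_fst (hx.comp measurable_fst) measurable_snd)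
    (fun t ξ => (norm_phase _ _ _).le) hc hM (m := fun τ ξ => gaussWeight σ τ ξ)
    (measurable_gaussWeight σ)
    (by filter_upwards [ae_restrict_mem measurableSet_Ioi] with τ hτ ξ
        exact gaussWeight_nonneg hτ ξ)
    (by filter_upwards [ae_restrict_mem measurableSet_Ioi] with τ hτ
        exact integrable_gaussWeight σ hτ)
    (κ := fun τ t t' => kernelBound n σ τ (t - t'))
    ((measurable_kernelBound n σ).comp (measurable_fst.prodMk
      ((measurable_fst.comp measurable_snd).sub (measurable_snd.comp measurable_snd))))
    (by filter_upwards [ae_restrict_mem measurableSet_Ioi] with τ hτ t t'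
        simp_rw [phase_mul_conj]
        exact enorm_integral_gaussWeight_phase_le σ hτ _ _)
  calc _ ≤ ∫⁻ ξ, (ENNReal.ofReal (Real.Gamma σ))⁻¹ *
        ((∫⁻ τ in Ioi (0 : ℝ), ENNReal.ofReal (gaussWeight σ τ ξ)) *
          ‖∫ t, c t * phase t (x t) ξ ∂ν‖ₑ ^ 2) := by
        apply lintegral_mono fun ξ => ?_
        rw [← mul_assoc]
        gcongr
        exact ofReal_rpow_le_lintegral_gaussWeight hσ ξ
    _ ≤ (ENNReal.ofReal (Real.Gamma σ))⁻¹ * ∫⁻ t, ∫⁻ t', ‖c t‖ₑ * ‖c t'‖ₑ *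
          (kernelConst n σ * ‖t - t'‖ₑ ^ (-((n : ℝ) / 2 - σ))) ∂ν ∂ν := by
        rw [lintegral_const_mul' _ _ hG]
        gcongr
        refine hmain.trans ?_
        gcongr
        exact lintegral_kernelBound_le hσ hd _
    _ = _ := by
        rw [mul_assoc, ← lintegral_const_mul' _ _ hK]
        congr 2; ext t
        rw [← lintegral_const_mul' _ _ hK]
        congr 1; ext t'
        ring

/-- The `TT*` inequality for the tensor square of the Schrödinger flow. -/
lemma lintegral_rpow_mul_sq_enorm_phase_prod_le {n : ℕ} {σ : ℝ} (hσ : 0 < σ)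
    (hd : σ < (n : ℝ) / 2) {ν : Measure ℝ} [IsFiniteMeasure ν] {x : ℝ → Rn n} (hx : Measurable x) :
    ∫⁻ z : Rn n × Rn n, ENNReal.ofReal (‖z.1‖ ^ (-(2 * σ))) * ENNReal.ofReal (‖z.2‖ ^ (-(2 * σ))) *
        ‖∫ t, phase t (x t) z.1 * (starRingEnd ℂ) (phase t (x t) z.2) ∂ν‖ₑ ^ 2
      ≤ ((ENNReal.ofReal (Real.Gamma σ))⁻¹ * kernelConst n σ) ^ 2 *
        ∫⁻ t, ∫⁻ t', ‖t - t'‖ₑ ^ (-((n : ℝ) - 2 * σ)) ∂ν ∂ν := by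
  have hG : (ENNReal.ofReal (Real.Gamma σ))⁻¹ ≠ ∞ := by
    rw [ENNReal.inv_ne_top, ENNReal.ofReal_ne_zero_iff]; exact Real.Gamma_pos_of_pos hσ
  have hK : kernelConst n σ ≠ ∞ := ENNReal.mul_ne_top ENNReal.ofReal_ne_top ENNReal.ofReal_ne_top
  have hS : ∀ᵐ s : ℝ × ℝ ∂((volume.restrict (Ioi (0 : ℝ))).prod (volume.restrict (Ioi (0 : ℝ)))),
      0 < s.1 ∧ 0 < s.2 := by
    rw [Measure.prod_restrict]
    filter_upwards [ae_restrict_mem (measurableSet_Ioi.prod measurableSet_Ioi)] with s hs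
    exact hs
  have he : Measurable fun w : ℝ × Rn n × Rn n =>
      phase w.1 (x w.1) w.2.1 * (starRingEnd ℂ) (phase w.1 (x w.1) w.2.2) := by
    have h1 : Measurable fun w : ℝ × Rn n × Rn n => phase w.1 (x w.1) w.2.1 :=
      measurable_phase measurable_fst (hx.comp measurable_fst) measurable_snd.fst
    have h2 : Measurable fun w : ℝ × Rn n × Rn n => phase w.1 (x w.1) w.2.2 :=
      measurable_phase measurable_fst (hx.comp measurable_fst) measurable_snd.snd
    exact h1.mul (Complex.continuous_conj.measurable.comp h2)
  have hmm : Measurable fun w : (ℝ × ℝ) × Rn n × Rn n =>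
      gaussWeight σ w.1.1 w.2.1 * gaussWeight σ w.1.2 w.2.2 := by
    unfold gaussWeight
    fun_prop
  have hκm : Measurable fun z : (ℝ × ℝ) × ℝ × ℝ =>
      kernelBound n σ z.1.1 (z.2.1 - z.2.2) * kernelBound n σ z.1.2 (z.2.1 - z.2.2) := by
    have h1 : Measurable fun z : (ℝ × ℝ) × ℝ × ℝ => z.2.1 - z.2.2 :=
      (measurable_fst.comp measurable_snd).sub (measurable_snd.comp measurable_snd)
    exact ((measurable_kernelBound n σ).comp ((measurable_fst.comp measurable_fst).prodMk h1)).mul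
      ((measurable_kernelBound n σ).comp ((measurable_snd.comp measurable_fst).prodMk h1))
  have hκ : ∀ s : ℝ × ℝ, 0 < s.1 ∧ 0 < s.2 → ∀ t t',
      ‖∫ z : Rn n × Rn n, ((gaussWeight σ s.1 z.1 * gaussWeight σ s.2 z.2 : ℝ) : ℂ) *
          (phase t (x t) z.1 * (starRingEnd ℂ) (phase t (x t) z.2) *
            (starRingEnd ℂ) (phase t' (x t') z.1 * (starRingEnd ℂ) (phase t' (x t') z.2)))‖ₑ
        ≤ kernelBound n σ s.1 (t - t') * kernelBound n σ s.2 (t - t') := by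
    intro s hs t t'
    have h1 : ∀ z : Rn n × Rn n,
        ((gaussWeight σ s.1 z.1 * gaussWeight σ s.2 z.2 : ℝ) : ℂ) *
        (phase t (x t) z.1 * (starRingEnd ℂ) (phase t (x t) z.2) *
          (starRingEnd ℂ) (phase t' (x t') z.1 * (starRingEnd ℂ) (phase t' (x t') z.2)))
        = ((gaussWeight σ s.1 z.1 : ℂ) * phase (t - t') (x t - x t') z.1) *
          (starRingEnd ℂ) ((gaussWeight σ s.2 z.2 : ℂ) * phase (t - t') (x t - x t') z.2) := by
      intro z
      simp only [← phase_mul_conj, map_mul, Complex.conj_ofReal, Complex.conj_conj]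
      push_cast
      ring
    simp_rw [h1]
    rw [Measure.volume_eq_prod, integral_prod_mul (fun ξ : Rn n => (gaussWeight σ s.1 ξ : ℂ) *
      phase (t - t') (x t - x t') ξ) (fun ξ : Rn n => (starRingEnd ℂ) ((gaussWeight σ s.2 ξ : ℂ) *
      phase (t - t') (x t - x t') ξ)), integral_conj, enorm_mul, RCLike.enorm_conj]
    gcongr
    · exact enorm_integral_gaussWeight_phase_le σ hs.1 _ _
    · exact enorm_integral_gaussWeight_phase_le σ hs.2 _ _
  have hmain := lintegral_superposition_mul_sq_enorm_integral_le
    (μ := (volume : Measure (Rn n × Rn n)))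
    (ρ := (volume.restrict (Ioi (0 : ℝ))).prod (volume.restrict (Ioi (0 : ℝ)))) (ν := ν)
    (e := fun t z => phase t (x t) z.1 * (starRingEnd ℂ) (phase t (x t) z.2))
    he (fun t z => by rw [norm_mul, RCLike.norm_conj, norm_phase, norm_phase, mul_one])
    (c := fun _ => 1) measurable_const (M := 1) (fun _ => by simp)
    (m := fun s z => gaussWeight σ s.1 z.1 * gaussWeight σ s.2 z.2) hmm
    (by filter_upwards [hS] with s hs z
        exact mul_nonneg (gaussWeight_nonneg hs.1 _) (gaussWeight_nonneg hs.2 _))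
    (by filter_upwards [hS] with s hs
        exact (integrable_gaussWeight σ hs.1).mul_prod (integrable_gaussWeight σ hs.2))
    (κ := fun s t t' => kernelBound n σ s.1 (t - t') * kernelBound n σ s.2 (t - t')) hκm
    (by filter_upwards [hS] with s hs using hκ s hs)
  simp only [one_mul, enorm_one] at hmain
  calc _ ≤ ∫⁻ z : Rn n × Rn n, (ENNReal.ofReal (Real.Gamma σ))⁻¹ ^ 2 *
        ((∫⁻ s : ℝ × ℝ, ENNReal.ofReal (gaussWeight σ s.1 z.1 * gaussWeight σ s.2 z.2)
          ∂((volume.restrict (Ioi (0 : ℝ))).prod (volume.restrict (Ioi (0 : ℝ))))) *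
          ‖∫ t, phase t (x t) z.1 * (starRingEnd ℂ) (phase t (x t) z.2) ∂ν‖ₑ ^ 2) := by
        apply lintegral_mono fun z => ?_
        have h1 : ∫⁻ s : ℝ × ℝ, ENNReal.ofReal (gaussWeight σ s.1 z.1 * gaussWeight σ s.2 z.2)
            ∂((volume.restrict (Ioi (0 : ℝ))).prod (volume.restrict (Ioi (0 : ℝ))))
            = (∫⁻ τ in Ioi (0 : ℝ), ENNReal.ofReal (gaussWeight σ τ z.1)) *
              ∫⁻ τ in Ioi (0 : ℝ), ENNReal.ofReal (gaussWeight σ τ z.2) := by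
          have hm : ∀ ξ : Rn n, Measurable fun τ => ENNReal.ofReal (gaussWeight σ τ ξ) := by
            intro ξ; unfold gaussWeight; fun_prop
          rw [← lintegral_prod_mul (hm _).aemeasurable (hm _).aemeasurable]
          apply lintegral_congr_ae
          filter_upwards [hS] with s hs
          rw [ENNReal.ofReal_mul (gaussWeight_nonneg hs.1 _)]
        rw [h1, ← mul_assoc, sq (ENNReal.ofReal (Real.Gamma σ))⁻¹,
          mul_mul_mul_comm (ENNReal.ofReal (Real.Gamma σ))⁻¹]
        exact mul_le_mul_left (mul_le_mul' (ofReal_rpow_le_lintegral_gaussWeight hσ _)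
          (ofReal_rpow_le_lintegral_gaussWeight hσ _)) _
    _ ≤ (ENNReal.ofReal (Real.Gamma σ))⁻¹ ^ 2 * ∫⁻ t, ∫⁻ t',
          (kernelConst n σ ^ 2 * ‖t - t'‖ₑ ^ (-((n : ℝ) - 2 * σ))) ∂ν ∂ν := by
        rw [lintegral_const_mul' _ _ (ENNReal.pow_ne_top hG)]
        gcongr
        refine hmain.trans ?_
        gcongr with t t'
        have hm : Measurable fun τ => kernelBound n σ τ (t - t') := by
          unfold kernelBound; fun_prop
        rw [lintegral_prod_mul hm.aemeasurable hm.aemeasurable]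
        have h2 : ‖t - t'‖ₑ ^ (-((n : ℝ) - 2 * σ))
            = ‖t - t'‖ₑ ^ (-((n : ℝ) / 2 - σ)) * ‖t - t'‖ₑ ^ (-((n : ℝ) / 2 - σ)) := by
          rw [← sq, ← ENNReal.rpow_natCast, ← ENNReal.rpow_mul]
          congr 1; push_cast; ring
        rw [h2, sq, mul_mul_mul_comm]
        gcongr
        · exact lintegral_kernelBound_le hσ hd _
        · exact lintegral_kernelBound_le hσ hd _
    _ = _ := by
        rw [mul_pow, mul_assoc, ← lintegral_const_mul' _ _ (ENNReal.pow_ne_top hK)]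
        congr 2; ext t
        rw [← lintegral_const_mul' _ _ (ENNReal.pow_ne_top hK)]

/-- The constant in `setLIntegral_enorm_sub_rpow_neg_le`. -/
def rieszConst (γ : ℝ) : ℝ≥0∞ := 2 * ENNReal.ofReal (1 / (1 - γ)) + 1

lemma rieszConst_ne_top (γ : ℝ) : rieszConst γ ≠ ∞ := by
  unfold rieszConst
  exact ENNReal.add_ne_top.2 ⟨ENNReal.mul_ne_top (by simp) ENNReal.ofReal_ne_top, by simp⟩

lemma setLIntegral_Ioc_enorm_rpow_neg {γ r : ℝ} (h1 : γ < 1) (hr : 0 < r) :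
    ∫⁻ t in Ioc 0 r, ‖t‖ₑ ^ (-γ) = ENNReal.ofReal (1 / (1 - γ)) * ENNReal.ofReal r ^ (1 - γ) := by
  have hi : IntegrableOn (fun τ : ℝ => τ ^ (-γ)) (Ioc 0 r) :=
    (intervalIntegrable_iff_integrableOn_Ioc_of_le hr.le).1
      (intervalIntegral.intervalIntegrable_rpow' (by linarith))
  have h : ∫⁻ t in Ioc 0 r, ‖t‖ₑ ^ (-γ) = ∫⁻ t in Ioc 0 r, ENNReal.ofReal (t ^ (-γ)) := by
    apply setLIntegral_congr_fun measurableSet_Ioc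
    intro t ht
    simp only
    rw [← ofReal_norm, Real.norm_eq_abs, abs_of_pos ht.1, ENNReal.ofReal_rpow_of_pos ht.1]
  rw [h, ← ofReal_integral_eq_lintegral_ofReal hi, ← intervalIntegral.integral_of_le hr.le,
    integral_rpow (by left; linarith), Real.zero_rpow (by linarith),
    ENNReal.ofReal_rpow_of_pos hr, ← ENNReal.ofReal_mul (by
      have : 0 < 1 - γ := by linarith
      positivity)]
  · congr 1
    have : -γ + 1 = 1 - γ := by ring
    rw [this]; ring
  · filter_upwards [ae_restrict_mem measurableSet_Ioc] with τ hτ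
    exact Real.rpow_nonneg hτ.1.le _

lemma setLIntegral_Ioo_enorm_rpow_neg_le {γ r : ℝ} (h1 : γ < 1) (hr : 0 < r) :
    ∫⁻ t in Ioo (-r) r, ‖t‖ₑ ^ (-γ)
      ≤ 2 * ENNReal.ofReal (1 / (1 - γ)) * ENNReal.ofReal r ^ (1 - γ) := by
  have hneg : ∫⁻ t in Ico (-r) 0, ‖t‖ₑ ^ (-γ) = ∫⁻ t in Ioc 0 r, ‖t‖ₑ ^ (-γ) := by
    have h := (Measure.measurePreserving_neg (volume : Measure ℝ)).setLIntegral_comp_preimage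
      (s := Ioc 0 r) measurableSet_Ioc (f := fun t => ‖t‖ₑ ^ (-γ)) (by fun_prop)
    rw [← h]
    simp
  have hsub : Ioo (-r) r ⊆ Ico (-r) 0 ∪ ({0} ∪ Ioc 0 r) := by
    intro t ht
    rcases lt_trichotomy t 0 with h | h | h
    · exact Or.inl ⟨ht.1.le, h⟩
    · exact Or.inr (Or.inl h)
    · exact Or.inr (Or.inr ⟨h, ht.2.le⟩)
  calc _ ≤ ∫⁻ t in Ico (-r) 0 ∪ ({0} ∪ Ioc 0 r), ‖t‖ₑ ^ (-γ) := lintegral_mono_set hsub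
    _ ≤ (∫⁻ t in Ioc 0 r, ‖t‖ₑ ^ (-γ)) + (0 + ∫⁻ t in Ioc 0 r, ‖t‖ₑ ^ (-γ)) := by
        refine (lintegral_union_le _ _ _).trans (add_le_add hneg.le ?_)
        refine (lintegral_union_le _ _ _).trans (add_le_add ?_ le_rfl)
        simp
    _ = _ := by
        rw [zero_add, ← two_mul, setLIntegral_Ioc_enorm_rpow_neg h1 hr, mul_assoc]

lemma setLIntegral_enorm_sub_rpow_neg_le {γ : ℝ} (h0 : 0 < γ) (h1 : γ < 1) {E : Set ℝ}
    (hEf : volume E ≠ ∞) (t' : ℝ) :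
    ∫⁻ t in E, ‖t - t'‖ₑ ^ (-γ) ≤ rieszConst γ * volume E ^ (1 - γ) := by
  rcases eq_or_ne (volume E) 0 with h | h
  · rw [setLIntegral_measure_zero _ _ h]; exact zero_le
  set r := (volume E).toReal with hrdef
  have hr : 0 < r := ENNReal.toReal_pos h hEf
  have hvr : volume E = ENNReal.ofReal r := (ENNReal.ofReal_toReal hEf).symm
  have hpt : ∀ t, ‖t - t'‖ₑ ^ (-γ)
      ≤ (Ioo (-r) r).indicator (fun u : ℝ => ‖u‖ₑ ^ (-γ)) (t - t') + ENNReal.ofReal r ^ (-γ) := by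
    intro t
    by_cases ht : t - t' ∈ Ioo (-r) r
    · rw [indicator_of_mem ht]; exact le_self_add
    · rw [indicator_of_notMem ht, zero_add]
      rw [ENNReal.rpow_neg, ENNReal.rpow_neg, ENNReal.inv_le_inv]
      apply ENNReal.rpow_le_rpow _ h0.le
      rw [← ofReal_norm, Real.norm_eq_abs]
      apply ENNReal.ofReal_le_ofReal
      by_contra hlt
      exact ht (abs_lt.1 (not_le.1 hlt))
  calc _ ≤ ∫⁻ t in E, ((Ioo (-r) r).indicator (fun u : ℝ => ‖u‖ₑ ^ (-γ)) (t - t')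
            + ENNReal.ofReal r ^ (-γ)) := lintegral_mono hpt
    _ = (∫⁻ t in E, (Ioo (-r) r).indicator (fun u : ℝ => ‖u‖ₑ ^ (-γ)) (t - t'))
          + ENNReal.ofReal r ^ (-γ) * volume E := by
        rw [lintegral_add_right _ measurable_const, setLIntegral_const]
    _ ≤ 2 * ENNReal.ofReal (1 / (1 - γ)) * ENNReal.ofReal r ^ (1 - γ)
          + ENNReal.ofReal r ^ (1 - γ) := by
        gcongr
        · refine (setLIntegral_le_lintegral _ _).trans ?_
          rw [lintegral_sub_right_eq_self
            (fun u => (Ioo (-r) r).indicator (fun u : ℝ => ‖u‖ₑ ^ (-γ)) u),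
            lintegral_indicator measurableSet_Ioo]
          exact setLIntegral_Ioo_enorm_rpow_neg_le h1 hr
        · have hexp : 1 - γ = -γ + 1 := by ring
          rw [hvr, hexp, ENNReal.rpow_add _ _ (by simpa using hr) ENNReal.ofReal_ne_top,
            ENNReal.rpow_one]
    _ = _ := by rw [rieszConst, hvr, add_mul, one_mul]

/-- Integrable functions on frequency space, indexed by `J`, that are orthonormal with respect to
the weight `|ξ|^{2s}`. -/
structure WeightedON {n : ℕ} (s : ℝ) (φ : ℕ → Rn n → ℂ) (J : Finset ℕ) : Prop where
  integrable : ∀ j ∈ J, Integrable (φ j)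
  ortho : ∀ j ∈ J, ∀ k ∈ J, (∫ ξ : Rn n, ((‖ξ‖ ^ (2 * s) : ℝ) : ℂ) *
    (φ j ξ * (starRingEnd ℂ) (φ k ξ))) = if j = k then 1 else 0

namespace WeightedON

variable {n : ℕ} {s : ℝ} {φ : ℕ → Rn n → ℂ} {J : Finset ℕ}

lemma mono (h : WeightedON s φ J) {K : Finset ℕ} (hK : K ⊆ J) : WeightedON s φ K :=
  ⟨fun j hj => h.integrable j (hK hj), fun j hj k hk => h.ortho j (hK hj) k (hK hk)⟩

lemma memLp (h : WeightedON s φ J) {j : ℕ} (hj : j ∈ J) :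
    MemLp (fun ξ => ((‖ξ‖ ^ s : ℝ) : ℂ) * φ j ξ) 2 := by
  have hm : AEStronglyMeasurable (fun ξ => ((‖ξ‖ ^ s : ℝ) : ℂ) * φ j ξ) volume := by
    refine AEStronglyMeasurable.mul ?_ (h.integrable j hj).1
    exact (by fun_prop : Measurable fun ξ : Rn n => ((‖ξ‖ ^ s : ℝ) : ℂ)).aestronglyMeasurable
  rw [memLp_two_iff_integrable_sq_norm hm]
  have hi : Integrable fun ξ : Rn n => ((‖ξ‖ ^ (2 * s) : ℝ) : ℂ) *
      (φ j ξ * (starRingEnd ℂ) (φ j ξ)) := by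
    by_contra hni
    have := h.ortho j hj j hj
    rw [integral_undef hni] at this
    simp at this
  refine hi.norm.congr (Filter.Eventually.of_forall fun ξ => ?_)
  simp only [norm_mul, RCLike.norm_conj, Complex.norm_real, Real.norm_eq_abs]
  rw [abs_of_nonneg (by positivity), abs_of_nonneg (by positivity), mul_pow, ← sq, mul_comm 2 s,
    Real.rpow_mul (norm_nonneg _)]
  norm_num

lemma integral_mul_conj (h : WeightedON s φ J) {j k : ℕ} (hj : j ∈ J) (hk : k ∈ J) :
    ∫ ξ, (((‖ξ‖ ^ s : ℝ) : ℂ) * φ j ξ) * (starRingEnd ℂ) (((‖ξ‖ ^ s : ℝ) : ℂ) * φ k ξ)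
      = if j = k then 1 else 0 := by
  rw [← h.ortho j hj k hk]
  congr 1; ext ξ
  have : (‖ξ‖ ^ (2 * s) : ℝ) = ‖ξ‖ ^ s * ‖ξ‖ ^ s := by
    rw [mul_comm, Real.rpow_mul (norm_nonneg _)]; norm_num [sq]
  rw [this, map_mul, Complex.conj_ofReal]
  push_cast; ring

/-- Parseval's identity for finite linear combinations. -/
lemma lintegral_sum_sq (h : WeightedON s φ J) (a : ℕ → ℂ) :
    ∫⁻ ξ, ‖∑ j ∈ J, a j * (((‖ξ‖ ^ s : ℝ) : ℂ) * φ j ξ)‖ₑ ^ 2 = ∑ j ∈ J, ‖a j‖ₑ ^ 2 := by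
  set g : ℕ → Rn n → ℂ := fun j ξ => ((‖ξ‖ ^ s : ℝ) : ℂ) * φ j ξ with hg
  have hL : MemLp (fun ξ => ∑ j ∈ J, a j * g j ξ) 2 :=
    memLp_finsetSum J fun j hj => (h.memLp hj).const_mul (a j)
  have hi : ∀ j ∈ J, ∀ k ∈ J, Integrable fun ξ => g j ξ * (starRingEnd ℂ) (g k ξ) := by
    intro j hj k hk
    exact (h.memLp hj).integrable_mul (h.memLp hk).star
  have hexp : ∀ ξ, (((‖∑ j ∈ J, a j * g j ξ‖ ^ 2 : ℝ)) : ℂ)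
      = ∑ j ∈ J, ∑ k ∈ J, (a j * (starRingEnd ℂ) (a k)) * (g j ξ * (starRingEnd ℂ) (g k ξ)) := by
    intro ξ
    rw [Complex.ofReal_pow, ← Complex.mul_conj', map_sum, Finset.sum_mul_sum]
    refine Finset.sum_congr rfl fun j _ => Finset.sum_congr rfl fun k _ => ?_
    rw [map_mul]; ring
  have hInt : (((∫ ξ, ‖∑ j ∈ J, a j * g j ξ‖ ^ 2 : ℝ)) : ℂ) = ((∑ j ∈ J, ‖a j‖ ^ 2 : ℝ) : ℂ) := by
    rw [← integral_complex_ofReal]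
    simp_rw [hexp]
    rw [integral_finsetSum _ fun j hj => integrable_finsetSum _ fun k hk =>
      (hi j hj k hk).const_mul _]
    push_cast
    refine Finset.sum_congr rfl fun j hj => ?_
    rw [integral_finsetSum _ fun k hk => (hi j hj k hk).const_mul _]
    rw [Finset.sum_eq_single j]
    · rw [integral_const_mul, h.integral_mul_conj hj hj, if_pos rfl, mul_one, Complex.mul_conj']
    · intro k hk hkj
      rw [integral_const_mul, h.integral_mul_conj hj hk, if_neg hkj.symm, mul_zero]
    · exact fun hh => absurd hj hh
  have h1 : ∀ z : ℂ, ‖z‖ₑ ^ 2 = ENNReal.ofReal (‖z‖ ^ 2) := by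
    intro z; rw [ENNReal.ofReal_pow (norm_nonneg _), ofReal_norm]
  simp_rw [h1]
  rw [← ofReal_integral_eq_lintegral_ofReal
    ((memLp_two_iff_integrable_sq_norm hL.1).1 hL)
    (Filter.Eventually.of_forall fun _ => by positivity),
    Complex.ofReal_injective hInt, ENNReal.ofReal_sum_of_nonneg fun _ _ => by positivity]

end WeightedON

lemma aestronglyMeasurable_phase {n : ℕ} (t : ℝ) (x : Rn n) {μ : Measure (Rn n)} :
    AEStronglyMeasurable (phase t x) μ :=
  (measurable_phase measurable_const measurable_const measurable_id).aestronglyMeasurable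

lemma integrable_phase_mul {n : ℕ} {φ : Rn n → ℂ} (hφ : Integrable φ) (t : ℝ) (x : Rn n) :
    Integrable fun ξ => phase t x ξ * φ ξ :=
  hφ.bdd_mul (c := 1) (aestronglyMeasurable_phase t x)
    (Filter.Eventually.of_forall fun ξ => (norm_phase t x ξ).le)

lemma norm_wave_le {n : ℕ} (φ : Rn n → ℂ) (t : ℝ) (x : Rn n) : ‖wave φ t x‖ ≤ ∫ ξ, ‖φ ξ‖ := by
  refine (norm_integral_le_integral_norm _).trans_eq ?_
  simp_rw [norm_mul, norm_phase, one_mul]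

lemma continuous_wave {n : ℕ} {φ : Rn n → ℂ} (hφ : Integrable φ) :
    Continuous fun p : ℝ × Rn n => wave φ p.1 p.2 := by
  apply continuous_of_dominated (bound := fun ξ => ‖φ ξ‖)
  · exact fun p => (integrable_phase_mul hφ p.1 p.2).1
  · intro p
    filter_upwards with ξ
    rw [norm_mul, norm_phase, one_mul]
  · exact hφ.norm
  · filter_upwards with ξ
    unfold phase dotC
    fun_prop

lemma measurable_wave {n : ℕ} {φ : Rn n → ℂ} (hφ : Integrable φ) {x : ℝ → Rn n}
    (hx : Measurable x) : Measurable fun t => wave φ t (x t) :=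
  Continuous.measurable2 (c := wave φ) (continuous_wave hφ) measurable_id hx

/-- Schur's test for a symmetric kernel. -/
lemma lintegral_lintegral_mul_mul_le {α : Type*} [MeasurableSpace α] {ν : Measure α} [SFinite ν]
    {f : α → ℝ≥0∞} (hf : Measurable f) {k : α → α → ℝ≥0∞} (hk : Measurable (Function.uncurry k))
    (hsymm : ∀ a b, k a b = k b a) {A : ℝ≥0∞} (hA : ∀ b, ∫⁻ a, k a b ∂ν ≤ A) :
    ∫⁻ a, ∫⁻ b, f a * f b * k a b ∂ν ∂ν ≤ 2 * A * ∫⁻ a, f a ^ 2 ∂ν := by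
  have hpt : ∀ a b, f a * f b * k a b ≤ f a ^ 2 * k a b + f b ^ 2 * k a b := by
    intro a b
    rw [← add_mul]
    gcongr
    rcases le_total (f a) (f b) with h | h
    · calc f a * f b ≤ f b * f b := by gcongr
        _ ≤ _ := by rw [← sq]; exact le_add_self
    · calc f a * f b ≤ f a * f a := by gcongr
        _ ≤ _ := by rw [← sq]; exact le_self_add
  have hb : ∀ a, ∫⁻ b, k a b ∂ν ≤ A := fun a => by simp_rw [hsymm a]; exact hA a
  have hk1 : ∀ a, Measurable (k a) := fun a => hk.comp (measurable_const.prodMk measurable_id)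
  have hk2 : ∀ b, Measurable fun a => k a b :=
    fun b => hk.comp (measurable_id.prodMk measurable_const)
  have hk' : Measurable fun z : α × α => f z.2 ^ 2 * k z.1 z.2 :=
    ((hf.comp measurable_snd).pow_const 2).mul hk
  calc _ ≤ ∫⁻ a, ∫⁻ b, (f a ^ 2 * k a b + f b ^ 2 * k a b) ∂ν ∂ν :=
        lintegral_mono fun a => lintegral_mono fun b => hpt a b
    _ = ∫⁻ a, (f a ^ 2 * ∫⁻ b, k a b ∂ν) ∂ν + ∫⁻ a, ∫⁻ b, f b ^ 2 * k a b ∂ν ∂ν := by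
        rw [← lintegral_add_left]
        · congr 1; ext a
          rw [lintegral_add_left ((hk1 a).const_mul _), lintegral_const_mul _ (hk1 a)]
        · have : Measurable fun a => ∫⁻ b, k a b ∂ν := hk.lintegral_prod_right'
          exact (hf.pow_const 2).mul this
    _ = ∫⁻ a, (f a ^ 2 * ∫⁻ b, k a b ∂ν) ∂ν + ∫⁻ b, (f b ^ 2 * ∫⁻ a, k a b ∂ν) ∂ν := by
        congr 1
        rw [lintegral_lintegral_swap hk'.aemeasurable]
        congr 1; ext b
        rw [lintegral_const_mul _ (hk2 b)]
    _ ≤ ∫⁻ a, f a ^ 2 * A ∂ν + ∫⁻ b, f b ^ 2 * A ∂ν := by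
        gcongr with a b
        · exact hb a
        · exact hA b
    _ = _ := by
        rw [lintegral_mul_const _ (hf.pow_const 2)]; ring

lemma sq_lintegral_mul_le {α : Type*} [MeasurableSpace α] {μ : Measure α} {f g : α → ℝ≥0∞}
    (hf : AEMeasurable f μ) (hg : AEMeasurable g μ) :
    (∫⁻ a, f a * g a ∂μ) ^ 2 ≤ (∫⁻ a, f a ^ 2 ∂μ) * ∫⁻ a, g a ^ 2 ∂μ := by
  have h := ENNReal.lintegral_mul_le_Lp_mul_Lq μ Real.HolderConjugate.two_two hf hg
  simp only [Pi.mul_apply, ENNReal.rpow_two] at h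
  calc _ ≤ ((∫⁻ a, f a ^ 2 ∂μ) ^ (1 / 2 : ℝ) * (∫⁻ a, g a ^ 2 ∂μ) ^ (1 / 2 : ℝ)) ^ 2 := by
        gcongr
    _ = _ := by
        rw [mul_pow, ← ENNReal.rpow_two, ← ENNReal.rpow_two, ← ENNReal.rpow_mul,
          ← ENNReal.rpow_mul]
        norm_num

/-- A weighted Cauchy–Schwarz inequality on a space where the weight is a.e. positive. -/
lemma sq_lintegral_mul_le_weight {α : Type*} [MeasurableSpace α] {μ : Measure α} {f g : α → ℝ≥0∞}
    (hf : AEMeasurable f μ) (hg : AEMeasurable g μ) {w w' : α → ℝ≥0∞} (hw : Measurable w)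
    (hw' : Measurable w') (hww : ∀ᵐ a ∂μ, w a * w' a = 1) :
    (∫⁻ a, f a * g a ∂μ) ^ 2 ≤ (∫⁻ a, w a ^ 2 * f a ^ 2 ∂μ) * ∫⁻ a, w' a ^ 2 * g a ^ 2 ∂μ := by
  have h := sq_lintegral_mul_le (hw.aemeasurable.mul hf) (hw'.aemeasurable.mul hg) (μ := μ)
  simp only [Pi.mul_apply, mul_pow] at h
  refine le_trans (le_of_eq ?_) h
  congr 1
  apply lintegral_congr_ae
  filter_upwards [hww] with a ha
  rw [mul_mul_mul_comm, ha, one_mul]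

lemma ae_ne_zero {n : ℕ} (hn : 0 < n) : ∀ᵐ ξ : Rn n, ξ ≠ 0 := by
  have : Nonempty (Fin n) := ⟨⟨0, hn⟩⟩
  have : (volume : Measure (Rn n)) {0} = 0 := measure_singleton 0
  exact compl_mem_ae_iff.2 this

lemma ofReal_norm_rpow_sq {n : ℕ} (σ : ℝ) (ξ : Rn n) :
    ENNReal.ofReal (‖ξ‖ ^ σ) ^ 2 = ENNReal.ofReal (‖ξ‖ ^ (2 * σ)) := by
  rw [← ENNReal.ofReal_pow (by positivity), mul_comm 2 σ, Real.rpow_mul (norm_nonneg _)]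
  norm_num

lemma ofReal_norm_rpow_mul_neg {n : ℕ} (σ : ℝ) {ξ : Rn n} (hξ : ξ ≠ 0) :
    ENNReal.ofReal (‖ξ‖ ^ σ) * ENNReal.ofReal (‖ξ‖ ^ (-σ)) = 1 := by
  rw [← ENNReal.ofReal_mul (by positivity), ← Real.rpow_add (norm_pos_iff.2 hξ), add_neg_cancel,
    Real.rpow_zero, ENNReal.ofReal_one]

lemma le_of_sq_le_mul {I A : ℝ≥0∞} (hI : I ≠ ∞) (h : I ^ 2 ≤ A * I) : I ≤ A := by
  rcases eq_or_ne I 0 with h0 | h0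
  · rw [h0]; exact zero_le
  rw [sq] at h
  exact (ENNReal.mul_le_mul_iff_left h0 hI).1 h

/-- The constant in the single-function maximal estimate. -/
def stripConst (n : ℕ) (σ : ℝ) : ℝ≥0∞ :=
  ((ENNReal.ofReal (Real.Gamma σ))⁻¹ * kernelConst n σ) * (2 * rieszConst ((n : ℝ) / 2 - σ))

lemma setLIntegral_sq_enorm_wave_le {n : ℕ} {σ : ℝ} (hσ : 0 < σ) (hd : σ < (n : ℝ) / 2)
    (hd1 : (n : ℝ) / 2 - σ < 1) {φ : Rn n → ℂ} (hφ : Integrable φ) {x : ℝ → Rn n}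
    (hx : Measurable x) {E : Set ℝ} (hE : volume E ≠ ∞) :
    ∫⁻ t in E, ‖wave φ t (x t)‖ₑ ^ 2
      ≤ stripConst n σ * volume E ^ (1 - ((n : ℝ) / 2 - σ)) *
        ∫⁻ ξ, ENNReal.ofReal (‖ξ‖ ^ (2 * σ)) * ‖φ ξ‖ₑ ^ 2 := by
  have hn : 0 < n := by
    rcases Nat.eq_zero_or_pos n with h | h
    · simp [h] at hd; linarith
    · exact h
  have : IsFiniteMeasure (volume.restrict E) := ⟨by simpa using hE.lt_top⟩
  set ν := volume.restrict E with hν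
  set v : ℝ → ℂ := fun t => wave φ t (x t) with hv
  set M := ∫ ξ, ‖φ ξ‖ with hM
  have hvm : Measurable v := measurable_wave hφ hx
  have hvM : ∀ t, ‖v t‖ ≤ M := fun t => norm_wave_le φ t (x t)
  have hcm : Measurable fun t => (starRingEnd ℂ) (v t) :=
    Complex.continuous_conj.measurable.comp hvm
  set Φ : Rn n → ℂ := fun ξ => ∫ t, (starRingEnd ℂ) (v t) * phase t (x t) ξ ∂ν with hΦ
  have hphm : Measurable fun z : ℝ × Rn n => phase z.1 (x z.1) z.2 :=
    measurable_phase measurable_fst (hx.comp measurable_fst) measurable_snd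
  have hker : Measurable fun z : ℝ × Rn n => (starRingEnd ℂ) (v z.1) * phase z.1 (x z.1) z.2 :=
    (hcm.comp measurable_fst).mul hphm
  have hΦm : Measurable Φ := by
    have : StronglyMeasurable fun z : Rn n × ℝ => (starRingEnd ℂ) (v z.2) * phase z.2 (x z.2) z.1 :=
      (hker.comp measurable_swap).stronglyMeasurable
    exact (StronglyMeasurable.integral_prod_right this).measurable
  set I := ∫⁻ t, ‖v t‖ₑ ^ 2 ∂ν with hI
  have hIle : I ≤ ∫⁻ t, ENNReal.ofReal (M ^ 2) ∂ν := by
    apply lintegral_mono fun t => ?_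
    simp only
    rw [← ofReal_norm, ← ENNReal.ofReal_pow (norm_nonneg _)]
    exact ENNReal.ofReal_le_ofReal (pow_le_pow_left₀ (norm_nonneg _) (hvM t) 2)
  have hIfin : I ≠ ∞ := by
    refine ne_top_of_le_ne_top ?_ hIle
    rw [lintegral_const]
    exact ENNReal.mul_ne_top ENNReal.ofReal_ne_top (measure_ne_top _ _)
  have hInt : Integrable (Function.uncurry fun (t : ℝ) (ξ : Rn n) =>
      (starRingEnd ℂ) (v t) * (phase t (x t) ξ * φ ξ)) (ν.prod volume) := by
    have h1 : Integrable (fun z : ℝ × Rn n => (1 : ℂ) * φ z.2) (ν.prod volume) :=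
      (integrable_const (1 : ℂ)).mul_prod hφ
    have h2 := h1.bdd_mul (c := M) hker.aestronglyMeasurable (Filter.Eventually.of_forall
      fun z => by rw [norm_mul, norm_phase, RCLike.norm_conj, mul_one]; exact hvM _)
    refine h2.congr (Filter.Eventually.of_forall fun z => ?_)
    simp only [Function.uncurry, one_mul, mul_assoc]
  have hdual : ((∫ t, ‖v t‖ ^ 2 ∂ν : ℝ) : ℂ) = ∫ ξ, φ ξ * Φ ξ := by
    calc _ = ∫ t, (∫ ξ, (starRingEnd ℂ) (v t) * (phase t (x t) ξ * φ ξ)) ∂ν := by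
          rw [← integral_complex_ofReal]
          congr 1; ext t
          rw [integral_const_mul, Complex.ofReal_pow, ← Complex.conj_mul']
          rfl
      _ = ∫ ξ, ∫ t, (starRingEnd ℂ) (v t) * (phase t (x t) ξ * φ ξ) ∂ν :=
          integral_integral_swap hInt
      _ = _ := by
          congr 1; ext ξ
          rw [hΦ, mul_comm, ← integral_mul_const]
          simp only [mul_assoc]
  have hI1 : I ≤ ∫⁻ ξ, ‖φ ξ‖ₑ * ‖Φ ξ‖ₑ := by
    have h1 : I = ‖∫ ξ, φ ξ * Φ ξ‖ₑ := by
      rw [← hdual, ← ofReal_norm, Complex.norm_real, Real.norm_eq_abs,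
        abs_of_nonneg (integral_nonneg fun t => by positivity),
        ofReal_integral_eq_lintegral_ofReal]
      · refine lintegral_congr fun t => ?_
        rw [ENNReal.ofReal_pow (norm_nonneg _), ofReal_norm]
      · refine (integrable_const (M ^ 2)).mono' (by fun_prop) ?_
        filter_upwards with t
        rw [Real.norm_eq_abs, abs_of_nonneg (by positivity)]
        exact pow_le_pow_left₀ (norm_nonneg _) (hvM t) 2
      · filter_upwards with t using by positivity
    rw [h1]
    refine (enorm_integral_le_lintegral_enorm _).trans_eq ?_
    simp_rw [enorm_mul]
  have hI2 : I ^ 2 ≤ (∫⁻ ξ, ENNReal.ofReal (‖ξ‖ ^ (2 * σ)) * ‖φ ξ‖ₑ ^ 2) *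
      ∫⁻ ξ, ENNReal.ofReal (‖ξ‖ ^ (-(2 * σ))) * ‖Φ ξ‖ₑ ^ 2 := by
    have h := sq_lintegral_mul_le_weight (μ := volume) (f := fun ξ => ‖φ ξ‖ₑ)
      (g := fun ξ => ‖Φ ξ‖ₑ) hφ.1.enorm hΦm.enorm.aemeasurable
      (w := fun ξ => ENNReal.ofReal (‖ξ‖ ^ σ)) (w' := fun ξ => ENNReal.ofReal (‖ξ‖ ^ (-σ)))
      (by fun_prop) (by fun_prop)
      (by filter_upwards [ae_ne_zero hn] with ξ hξ using ofReal_norm_rpow_mul_neg σ hξ)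
    simp only [ofReal_norm_rpow_sq, mul_neg] at h
    exact (pow_le_pow_left' hI1 2).trans h
  have hI3 : ∫⁻ ξ, ENNReal.ofReal (‖ξ‖ ^ (-(2 * σ))) * ‖Φ ξ‖ₑ ^ 2
      ≤ stripConst n σ * volume E ^ (1 - ((n : ℝ) / 2 - σ)) * I := by
    refine (lintegral_rpow_mul_sq_enorm_phase_le hσ hd hx hcm
      (fun t => by rw [RCLike.norm_conj]; exact hvM t)).trans ?_
    simp only [RCLike.enorm_conj]
    have hs := lintegral_lintegral_mul_mul_le (ν := ν) (f := fun t => ‖v t‖ₑ) hvm.enorm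
      (k := fun t t' => ‖t - t'‖ₑ ^ (-((n : ℝ) / 2 - σ))) (by unfold Function.uncurry; fun_prop)
      (fun a b => by rw [enorm_sub_rev])
      (fun b => setLIntegral_enorm_sub_rpow_neg_le (by linarith) hd1 hE b)
    calc _ ≤ _ := mul_le_mul_right hs _
      _ = _ := by rw [stripConst]; ring
  refine le_of_sq_le_mul hIfin (hI2.trans ?_)
  calc _ ≤ _ := mul_le_mul_right hI3 _
    _ = _ := by ring

lemma integrable_sum_mul_conj {n : ℕ} {J : Finset ℕ} {ψ : ℕ → Rn n → ℂ}
    (hψ : ∀ j ∈ J, Integrable (ψ j)) :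
    Integrable fun z : Rn n × Rn n => ∑ j ∈ J, ψ j z.1 * (starRingEnd ℂ) (ψ j z.2) := by
  refine integrable_finsetSum _ fun j hj => ?_
  have h : Integrable fun ξ => (starRingEnd ℂ) (ψ j ξ) :=
    Complex.conjLIE.toContinuousLinearEquiv.toContinuousLinearMap.integrable_comp (hψ j hj)
  exact (hψ j hj).mul_prod h

/-- The duality step for the density of a finite system. -/
lemma setLIntegral_sum_sq_enorm_wave_le_dual {n : ℕ} {J : Finset ℕ} {ψ : ℕ → Rn n → ℂ}
    (hψ : ∀ j ∈ J, Integrable (ψ j)) {x : ℝ → Rn n} (hx : Measurable x)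
    {ν : Measure ℝ} [IsFiniteMeasure ν] :
    ∫⁻ t, ∑ j ∈ J, ‖wave (ψ j) t (x t)‖ₑ ^ 2 ∂ν
      ≤ ∫⁻ z : Rn n × Rn n, ‖∑ j ∈ J, ψ j z.1 * (starRingEnd ℂ) (ψ j z.2)‖ₑ *
        ‖∫ t, phase t (x t) z.1 * (starRingEnd ℂ) (phase t (x t) z.2) ∂ν‖ₑ := by
  set G : Rn n × Rn n → ℂ := fun z => ∑ j ∈ J, ψ j z.1 * (starRingEnd ℂ) (ψ j z.2) with hG
  have hGi : Integrable G := integrable_sum_mul_conj hψ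
  set e : ℝ → Rn n × Rn n → ℂ :=
    fun t z => phase t (x t) z.1 * (starRingEnd ℂ) (phase t (x t) z.2) with he
  have he1 : ∀ t z, ‖e t z‖ = 1 := fun t z => by
    simp only [he, norm_mul, RCLike.norm_conj, norm_phase, mul_one]
  have hem : Measurable fun w : ℝ × Rn n × Rn n => e w.1 w.2 := by
    have h1 : Measurable fun w : ℝ × Rn n × Rn n => phase w.1 (x w.1) w.2.1 :=
      measurable_phase measurable_fst (hx.comp measurable_fst) measurable_snd.fst
    have h2 : Measurable fun w : ℝ × Rn n × Rn n => phase w.1 (x w.1) w.2.2 :=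
      measurable_phase measurable_fst (hx.comp measurable_fst) measurable_snd.snd
    exact h1.mul (Complex.continuous_conj.measurable.comp h2)
  have hInt : Integrable (Function.uncurry fun (t : ℝ) (z : Rn n × Rn n) => e t z * G z)
      (ν.prod volume) := by
    have h1 : Integrable (fun w : ℝ × Rn n × Rn n => (1 : ℂ) * G w.2) (ν.prod volume) :=
      (integrable_const (1 : ℂ)).mul_prod hGi
    have h2 := h1.bdd_mul (c := 1) hem.aestronglyMeasurable (Filter.Eventually.of_forall
      fun w => (he1 w.1 w.2).le)
    refine h2.congr (Filter.Eventually.of_forall fun w => ?_)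
    simp only [Function.uncurry, one_mul]
  have hdens : ∀ t, ((∑ j ∈ J, ‖wave (ψ j) t (x t)‖ ^ 2 : ℝ) : ℂ) = ∫ z, e t z * G z := by
    intro t
    have hterm : ∀ j ∈ J, Integrable fun z : Rn n × Rn n =>
        (phase t (x t) z.1 * ψ j z.1) * (starRingEnd ℂ) (phase t (x t) z.2 * ψ j z.2) := by
      intro j hj
      have h1 := integrable_phase_mul (hψ j hj) t (x t)
      have h : Integrable fun ξ => (starRingEnd ℂ) (phase t (x t) ξ * ψ j ξ) :=
        Complex.conjLIE.toContinuousLinearEquiv.toContinuousLinearMap.integrable_comp h1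
      exact h1.mul_prod h
    have hz : ∀ z, e t z * G z = ∑ j ∈ J,
        (phase t (x t) z.1 * ψ j z.1) * (starRingEnd ℂ) (phase t (x t) z.2 * ψ j z.2) := by
      intro z
      simp only [he, hG, Finset.mul_sum, map_mul]
      exact Finset.sum_congr rfl fun j _ => by ring
    simp_rw [hz]
    rw [integral_finsetSum _ hterm]
    push_cast
    refine Finset.sum_congr rfl fun j _ => ?_
    rw [Measure.volume_eq_prod, integral_prod_mul (fun ξ => phase t (x t) ξ * ψ j ξ)
      (fun ξ => (starRingEnd ℂ) (phase t (x t) ξ * ψ j ξ)), integral_conj, ← Complex.mul_conj']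
    rfl
  set M : ℝ := ∑ j ∈ J, (∫ ξ, ‖ψ j ξ‖) ^ 2 with hM
  have hMb : ∀ t, ∑ j ∈ J, ‖wave (ψ j) t (x t)‖ ^ 2 ≤ M := fun t =>
    Finset.sum_le_sum fun j _ => pow_le_pow_left₀ (norm_nonneg _) (norm_wave_le _ _ _) 2
  have hmeas : Measurable fun t => ∑ j ∈ J, ‖wave (ψ j) t (x t)‖ ^ 2 :=
    Finset.measurable_fun_sum _ fun j hj => ((measurable_wave (hψ j hj) hx).norm.pow_const 2)
  have h1 : ∫⁻ t, ∑ j ∈ J, ‖wave (ψ j) t (x t)‖ₑ ^ 2 ∂ν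
      = ‖∫ z, (∫ t, e t z ∂ν) * G z‖ₑ := by
    have hswap : ∫ z, (∫ t, e t z ∂ν) * G z
        = ((∫ t, ∑ j ∈ J, ‖wave (ψ j) t (x t)‖ ^ 2 ∂ν : ℝ) : ℂ) := by
      rw [← integral_complex_ofReal]
      simp_rw [hdens]
      rw [integral_integral_swap hInt]
      congr 1; ext z
      rw [integral_mul_const]
    rw [hswap, ← ofReal_norm, Complex.norm_real, Real.norm_eq_abs,
      abs_of_nonneg (integral_nonneg fun t => by positivity), ofReal_integral_eq_lintegral_ofReal]
    · refine lintegral_congr fun t => ?_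
      rw [ENNReal.ofReal_sum_of_nonneg fun _ _ => by positivity]
      refine Finset.sum_congr rfl fun j _ => ?_
      rw [ENNReal.ofReal_pow (norm_nonneg _), ofReal_norm]
    · refine (integrable_const M).mono' hmeas.aestronglyMeasurable ?_
      filter_upwards with t
      rw [Real.norm_eq_abs, abs_of_nonneg (by positivity)]
      exact hMb t
    · filter_upwards with t using by positivity
  rw [h1]
  refine (enorm_integral_le_lintegral_enorm _).trans_eq ?_
  refine lintegral_congr fun z => ?_
  rw [enorm_mul, mul_comm]

namespace WeightedON

variable {n : ℕ} {s : ℝ} {φ : ℕ → Rn n → ℂ} {J : Finset ℕ}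

lemma lintegral_weight_mul_kernel_le (h : WeightedON s φ J) (hn : 0 < n) (σ : ℝ)
    {A : Set (Rn n)} (hA : MeasurableSet A) :
    ∫⁻ z : Rn n × Rn n, ENNReal.ofReal (‖z.1‖ ^ (2 * σ)) * ENNReal.ofReal (‖z.2‖ ^ (2 * σ)) *
      ‖∑ j ∈ J, A.indicator (φ j) z.1 * (starRingEnd ℂ) (A.indicator (φ j) z.2)‖ₑ ^ 2
      ≤ 2 * ∑ j ∈ J, ∫⁻ ξ in A, ENNReal.ofReal (‖ξ‖ ^ (4 * σ - 2 * s)) * ‖φ j ξ‖ₑ ^ 2 := by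
  set g : ℕ → Rn n → ℂ := fun j ξ => ((‖ξ‖ ^ s : ℝ) : ℂ) * φ j ξ with hg
  have hgm : ∀ j ∈ J, AEStronglyMeasurable (g j) volume := fun j hj => (h.memLp hj).1
  set w : Rn n → ℝ≥0∞ := A.indicator fun ξ => ENNReal.ofReal (‖ξ‖ ^ (2 * σ - 2 * s)) with hw
  have hwm : Measurable w := Measurable.indicator (by fun_prop) hA
  set P : Rn n × Rn n → ℂ := fun z => ∑ j ∈ J, g j z.1 * (starRingEnd ℂ) (g j z.2) with hP
  have hPm : AEStronglyMeasurable P (volume.prod volume) :=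
    Finset.aestronglyMeasurable_fun_sum _ fun j hj => (hgm j hj).comp_fst.mul
      (Complex.continuous_conj.comp_aestronglyMeasurable (hgm j hj).comp_snd)
  have hne : ∀ᵐ z : Rn n × Rn n, z.1 ≠ 0 ∧ z.2 ≠ 0 := by
    rw [Measure.volume_eq_prod]
    exact (Measure.quasiMeasurePreserving_fst.ae (ae_ne_zero hn)).and
      (Measure.quasiMeasurePreserving_snd.ae (ae_ne_zero hn))
  have hpt : ∀ z : Rn n × Rn n, z.1 ≠ 0 → z.2 ≠ 0 →
      ENNReal.ofReal (‖z.1‖ ^ (2 * σ)) * ENNReal.ofReal (‖z.2‖ ^ (2 * σ)) *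
        ‖∑ j ∈ J, A.indicator (φ j) z.1 * (starRingEnd ℂ) (A.indicator (φ j) z.2)‖ₑ ^ 2
      ≤ w z.1 ^ 2 * ‖P z‖ₑ ^ 2 + w z.2 ^ 2 * ‖P z‖ₑ ^ 2 := by
    intro z h1 h2
    by_cases hz : z.1 ∈ A ∧ z.2 ∈ A
    · have hPz : P z = ((‖z.1‖ ^ s : ℝ) : ℂ) * ((‖z.2‖ ^ s : ℝ) : ℂ) *
          ∑ j ∈ J, A.indicator (φ j) z.1 * (starRingEnd ℂ) (A.indicator (φ j) z.2) := by
        simp only [hP, hg, Finset.mul_sum, indicator_of_mem hz.1, indicator_of_mem hz.2, map_mul,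
          Complex.conj_ofReal]
        exact Finset.sum_congr rfl fun j _ => by ring
      have hr : ∀ ξ : Rn n, ξ ≠ 0 → ENNReal.ofReal (‖ξ‖ ^ (2 * σ))
          = ENNReal.ofReal (‖ξ‖ ^ (2 * σ - 2 * s)) * ‖((‖ξ‖ ^ s : ℝ) : ℂ)‖ₑ ^ 2 := by
        intro ξ hξ
        rw [← ofReal_norm, Complex.norm_real, Real.norm_eq_abs, abs_of_nonneg (by positivity),
          ofReal_norm_rpow_sq, ← ENNReal.ofReal_mul (by positivity),
          ← Real.rpow_add (norm_pos_iff.2 hξ), sub_add_cancel]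
      have hle : w z.1 * w z.2 ≤ w z.1 ^ 2 + w z.2 ^ 2 := by
        rcases le_total (w z.1) (w z.2) with hh | hh
        · calc w z.1 * w z.2 ≤ w z.2 * w z.2 := by gcongr
            _ ≤ _ := by rw [← sq]; exact le_add_self
        · calc w z.1 * w z.2 ≤ w z.1 * w z.1 := by gcongr
            _ ≤ _ := by rw [← sq]; exact le_self_add
      rw [← add_mul]
      refine le_trans (le_of_eq ?_) (mul_le_mul_left hle _)
      rw [hPz, enorm_mul, enorm_mul, hr _ h1, hr _ h2, hw, indicator_of_mem hz.1,
        indicator_of_mem hz.2]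
      ring
    · have : ∑ j ∈ J, A.indicator (φ j) z.1 * (starRingEnd ℂ) (A.indicator (φ j) z.2) = 0 := by
        refine Finset.sum_eq_zero fun j _ => ?_
        by_cases hz1 : z.1 ∈ A
        · have hz2 : z.2 ∉ A := fun hz2 => hz ⟨hz1, hz2⟩
          rw [indicator_of_notMem hz2, map_zero, mul_zero]
        · rw [indicator_of_notMem hz1, zero_mul]
      rw [this]; simp
  have hpars : ∀ ξ, ∫⁻ η, ‖∑ j ∈ J, g j ξ * (starRingEnd ℂ) (g j η)‖ₑ ^ 2
      = ∑ j ∈ J, ‖g j ξ‖ₑ ^ 2 := by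
    intro ξ
    have := h.lintegral_sum_sq fun j => (starRingEnd ℂ) (g j ξ)
    simp only [RCLike.enorm_conj] at this
    rw [← this]
    refine lintegral_congr fun η => ?_
    rw [← RCLike.enorm_conj (∑ j ∈ J, g j ξ * (starRingEnd ℂ) (g j η)), map_sum]
    simp only [map_mul, Complex.conj_conj, hg]
  have hpars' : ∀ η, ∫⁻ ξ, ‖∑ j ∈ J, g j ξ * (starRingEnd ℂ) (g j η)‖ₑ ^ 2
      = ∑ j ∈ J, ‖g j η‖ₑ ^ 2 := by
    intro η
    have := h.lintegral_sum_sq fun j => (starRingEnd ℂ) (g j η)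
    simp only [RCLike.enorm_conj] at this
    rw [← this]
    simp only [mul_comm, hg]
  have hT : ∫⁻ ξ, w ξ ^ 2 * ∑ j ∈ J, ‖g j ξ‖ₑ ^ 2
      ≤ ∑ j ∈ J, ∫⁻ ξ in A, ENNReal.ofReal (‖ξ‖ ^ (4 * σ - 2 * s)) * ‖φ j ξ‖ₑ ^ 2 := by
    have hm : ∀ j ∈ J, AEMeasurable
        (fun ξ => ENNReal.ofReal (‖ξ‖ ^ (4 * σ - 2 * s)) * ‖φ j ξ‖ₑ ^ 2) (volume.restrict A) :=
      fun j hj => ((by fun_prop : Measurable fun ξ : Rn n =>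
        ENNReal.ofReal (‖ξ‖ ^ (4 * σ - 2 * s))).aemeasurable.mul
          ((h.integrable j hj).1.restrict.enorm.pow_const 2))
    rw [← lintegral_finsetSum' _ hm, ← lintegral_indicator hA]
    apply lintegral_mono_ae
    filter_upwards [ae_ne_zero hn] with ξ hξ
    by_cases hξA : ξ ∈ A
    · rw [hw, indicator_of_mem hξA, indicator_of_mem hξA, Finset.mul_sum]
      refine Finset.sum_le_sum fun j _ => le_of_eq ?_
      rw [hg, enorm_mul, ← ofReal_norm ((‖ξ‖ ^ s : ℝ) : ℂ), Complex.norm_real, Real.norm_eq_abs,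
        abs_of_nonneg (by positivity), mul_pow, ofReal_norm_rpow_sq, ofReal_norm_rpow_sq,
        ← mul_assoc, ← ENNReal.ofReal_mul (by positivity), ← Real.rpow_add (norm_pos_iff.2 hξ)]
      congr 3; ring
    · rw [hw, indicator_of_notMem hξA]; simp
  have hm1 : AEMeasurable (fun z : Rn n × Rn n => w z.1 ^ 2 * ‖P z‖ₑ ^ 2) (volume.prod volume) :=
    ((hwm.comp measurable_fst).pow_const 2).aemeasurable.mul (hPm.enorm.pow_const 2)
  have hm2 : AEMeasurable (fun z : Rn n × Rn n => w z.2 ^ 2 * ‖P z‖ₑ ^ 2) (volume.prod volume) :=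
    ((hwm.comp measurable_snd).pow_const 2).aemeasurable.mul (hPm.enorm.pow_const 2)
  have hw2 : ∀ ξ, w ξ ^ 2 ≠ ∞ := by
    intro ξ
    refine ENNReal.pow_ne_top ?_
    by_cases hξA : ξ ∈ A
    · rw [hw, indicator_of_mem hξA]; exact ENNReal.ofReal_ne_top
    · rw [hw, indicator_of_notMem hξA]; simp
  calc _ ≤ ∫⁻ z, (w z.1 ^ 2 * ‖P z‖ₑ ^ 2 + w z.2 ^ 2 * ‖P z‖ₑ ^ 2) := by
        apply lintegral_mono_ae
        filter_upwards [hne] with z hz using hpt z hz.1 hz.2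
    _ = (∫⁻ ξ, w ξ ^ 2 * ∑ j ∈ J, ‖g j ξ‖ₑ ^ 2) + ∫⁻ ξ, w ξ ^ 2 * ∑ j ∈ J, ‖g j ξ‖ₑ ^ 2 := by
        rw [Measure.volume_eq_prod, lintegral_add_left' hm1, lintegral_prod _ hm1,
          lintegral_prod_symm _ hm2]
        congr 1
        · refine lintegral_congr fun ξ => ?_
          rw [lintegral_const_mul' _ _ (hw2 ξ), hpars ξ]
        · refine lintegral_congr fun η => ?_
          rw [lintegral_const_mul' _ _ (hw2 η), hpars' η]
    _ ≤ _ := by rw [← two_mul]; gcongr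

end WeightedON

lemma inv_ofReal_Gamma_ne_top {σ : ℝ} (hσ : 0 < σ) : (ENNReal.ofReal (Real.Gamma σ))⁻¹ ≠ ∞ := by
  rw [ENNReal.inv_ne_top, ENNReal.ofReal_ne_zero_iff]
  exact Real.Gamma_pos_of_pos hσ

lemma kernelConst_ne_top (n : ℕ) (σ : ℝ) : kernelConst n σ ≠ ∞ :=
  ENNReal.mul_ne_top ENNReal.ofReal_ne_top ENNReal.ofReal_ne_top

lemma stripConst_ne_top (n : ℕ) {σ : ℝ} (hσ : 0 < σ) : stripConst n σ ≠ ∞ :=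
  ENNReal.mul_ne_top (ENNReal.mul_ne_top (inv_ofReal_Gamma_ne_top hσ) (kernelConst_ne_top n σ))
    (ENNReal.mul_ne_top (by simp) (rieszConst_ne_top _))

lemma pos_of_lt_half {n : ℕ} {σ : ℝ} (hσ : 0 < σ) (hd : σ < (n : ℝ) / 2) : 0 < n := by
  rcases Nat.eq_zero_or_pos n with h | h
  · simp [h] at hd; linarith
  · exact h

lemma enorm_indicator_sq_le_indicator {n : ℕ} (A : Set (Rn n)) (φ : Rn n → ℂ) (u : Rn n → ℝ≥0∞) :
    (fun ξ => u ξ * ‖A.indicator φ ξ‖ₑ ^ 2) = A.indicator fun ξ => u ξ * ‖φ ξ‖ₑ ^ 2 := by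
  ext ξ
  by_cases hξ : ξ ∈ A <;> simp [hξ]

namespace WeightedON

variable {n : ℕ} {s σ : ℝ} {φ : ℕ → Rn n → ℂ} {J : Finset ℕ}

lemma setLIntegral_sum_sq_enorm_wave_le_one (h : WeightedON s φ J) (hσ : 0 < σ)
    (hd : σ < (n : ℝ) / 2) (hd1 : (n : ℝ) / 2 - σ < 1) {A : Set (Rn n)} (hA : MeasurableSet A)
    {x : ℝ → Rn n} (hx : Measurable x) {E : Set ℝ} (hE : volume E ≠ ∞) :
    ∫⁻ t in E, ∑ j ∈ J, ‖wave (A.indicator (φ j)) t (x t)‖ₑ ^ 2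
      ≤ stripConst n σ * volume E ^ (1 - ((n : ℝ) / 2 - σ)) *
        ∑ j ∈ J, ∫⁻ ξ in A, ENNReal.ofReal (‖ξ‖ ^ (2 * σ)) * ‖φ j ξ‖ₑ ^ 2 := by
  have hi : ∀ j ∈ J, Integrable (A.indicator (φ j)) := fun j hj => (h.integrable j hj).indicator hA
  rw [lintegral_finsetSum' _ fun j hj =>
    ((measurable_wave (hi j hj) hx).enorm.pow_const 2).aemeasurable, Finset.mul_sum]
  refine Finset.sum_le_sum fun j hj => ?_
  refine (setLIntegral_sq_enorm_wave_le hσ hd hd1 (hi j hj) hx hE).trans_eq ?_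
  rw [enorm_indicator_sq_le_indicator, lintegral_indicator hA]

lemma sq_setLIntegral_sum_sq_enorm_wave_le_two (h : WeightedON s φ J) (hσ : 0 < σ)
    (hd : σ < (n : ℝ) / 2) (hd1 : (n : ℝ) - 2 * σ < 1) {A : Set (Rn n)} (hA : MeasurableSet A)
    {x : ℝ → Rn n} (hx : Measurable x) {E : Set ℝ} (hE : volume E ≠ ∞) :
    (∫⁻ t in E, ∑ j ∈ J, ‖wave (A.indicator (φ j)) t (x t)‖ₑ ^ 2) ^ 2
      ≤ (2 * ((ENNReal.ofReal (Real.Gamma σ))⁻¹ * kernelConst n σ) ^ 2 *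
          rieszConst ((n : ℝ) - 2 * σ)) * volume E ^ (1 - ((n : ℝ) - 2 * σ) + 1) *
        ∑ j ∈ J, ∫⁻ ξ in A, ENNReal.ofReal (‖ξ‖ ^ (4 * σ - 2 * s)) * ‖φ j ξ‖ₑ ^ 2 := by
  have hn := pos_of_lt_half hσ hd
  have hi : ∀ j ∈ J, Integrable (A.indicator (φ j)) := fun j hj => (h.integrable j hj).indicator hA
  have : IsFiniteMeasure (volume.restrict E) := ⟨by simpa using hE.lt_top⟩
  have hΨm : Measurable fun z : Rn n × Rn n =>
      ∫ t in E, phase t (x t) z.1 * (starRingEnd ℂ) (phase t (x t) z.2) := by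
    have h1 : Measurable fun w : (Rn n × Rn n) × ℝ => phase w.2 (x w.2) w.1.1 :=
      measurable_phase measurable_snd (hx.comp measurable_snd) measurable_fst.fst
    have h2 : Measurable fun w : (Rn n × Rn n) × ℝ => phase w.2 (x w.2) w.1.2 :=
      measurable_phase measurable_snd (hx.comp measurable_snd) measurable_fst.snd
    have h3 : StronglyMeasurable fun w : (Rn n × Rn n) × ℝ =>
        phase w.2 (x w.2) w.1.1 * (starRingEnd ℂ) (phase w.2 (x w.2) w.1.2) :=
      (h1.mul (Complex.continuous_conj.measurable.comp h2)).stronglyMeasurable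
    exact (StronglyMeasurable.integral_prod_right h3).measurable
  have hne : ∀ᵐ z : Rn n × Rn n, z.1 ≠ 0 ∧ z.2 ≠ 0 := by
    rw [Measure.volume_eq_prod]
    exact (Measure.quasiMeasurePreserving_fst.ae (ae_ne_zero hn)).and
      (Measure.quasiMeasurePreserving_snd.ae (ae_ne_zero hn))
  have hcs := sq_lintegral_mul_le_weight (μ := (volume : Measure (Rn n × Rn n)))
    (integrable_sum_mul_conj hi).1.enorm hΨm.enorm.aemeasurable
    (w := fun z => ENNReal.ofReal (‖z.1‖ ^ σ) * ENNReal.ofReal (‖z.2‖ ^ σ))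
    (w' := fun z => ENNReal.ofReal (‖z.1‖ ^ (-σ)) * ENNReal.ofReal (‖z.2‖ ^ (-σ)))
    (by fun_prop) (by fun_prop) (by
      filter_upwards [hne] with z hz
      rw [mul_mul_mul_comm, ofReal_norm_rpow_mul_neg σ hz.1, ofReal_norm_rpow_mul_neg σ hz.2,
        one_mul])
  simp only [mul_pow, ofReal_norm_rpow_sq, mul_neg] at hcs
  have hA2 := lintegral_rpow_mul_sq_enorm_phase_prod_le hσ hd hx (ν := volume.restrict E)
  have hR : ∫⁻ t in E, ∫⁻ t' in E, ‖t - t'‖ₑ ^ (-((n : ℝ) - 2 * σ))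
      ≤ rieszConst ((n : ℝ) - 2 * σ) * volume E ^ (1 - ((n : ℝ) - 2 * σ) + 1) := by
    rcases eq_or_ne (volume E) 0 with h0 | h0
    · rw [setLIntegral_measure_zero _ _ h0]; exact zero_le
    calc _ ≤ ∫⁻ t in E, rieszConst ((n : ℝ) - 2 * σ) * volume E ^ (1 - ((n : ℝ) - 2 * σ)) := by
          refine lintegral_mono fun t => ?_
          simp only [enorm_sub_rev t]
          exact setLIntegral_enorm_sub_rpow_neg_le (by linarith) hd1 hE t
      _ = _ := by
          rw [setLIntegral_const, mul_assoc, ENNReal.rpow_add _ _ h0 hE, ENNReal.rpow_one]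
  calc _ ≤ _ := pow_le_pow_left' (setLIntegral_sum_sq_enorm_wave_le_dual hi hx) 2
    _ ≤ _ := hcs
    _ ≤ _ := mul_le_mul' (h.lintegral_weight_mul_kernel_le hn σ hA)
      (hA2.trans (mul_le_mul_right hR _))
    _ = _ := by ring

/-- The linearised maximal estimate over a set of times, with exponent `a = 1` or `a = 2`. -/
lemma exists_setLIntegral_rpow_le {a : ℝ} (hσ : 0 < σ)
    (hd : σ < (n : ℝ) / 2) (ha : a = 1 ∨ a = 2) (hb : a * ((n : ℝ) / 2 - σ) < 1) :
    ∃ K : ℝ≥0∞, K ≠ ∞ ∧ ∀ (φ : ℕ → Rn n → ℂ) (J : Finset ℕ), WeightedON s φ J →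
      ∀ A : Set (Rn n), MeasurableSet A → ∀ x : ℝ → Rn n, Measurable x → ∀ E : Set ℝ,
      volume E ≠ ∞ → (∫⁻ t in E, ∑ j ∈ J, ‖wave (A.indicator (φ j)) t (x t)‖ₑ ^ 2) ^ a
        ≤ K * volume E ^ (a * (1 - ((n : ℝ) / 2 - σ))) *
          ∑ j ∈ J, ∫⁻ ξ in A, ENNReal.ofReal (‖ξ‖ ^ (2 * s - 2 * a * (s - σ))) * ‖φ j ξ‖ₑ ^ 2 := by
  rcases ha with rfl | rfl
  · refine ⟨stripConst n σ, stripConst_ne_top n hσ, fun φ J h A hA x hx E hE => ?_⟩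
    have := h.setLIntegral_sum_sq_enorm_wave_le_one hσ hd (by linarith) hA hx hE
    rw [ENNReal.rpow_one, one_mul]
    have he : 2 * s - 2 * 1 * (s - σ) = 2 * σ := by ring
    rwa [he]
  · refine ⟨2 * ((ENNReal.ofReal (Real.Gamma σ))⁻¹ * kernelConst n σ) ^ 2 *
          rieszConst ((n : ℝ) - 2 * σ), ?_, fun φ J h A hA x hx E hE => ?_⟩
    · exact ENNReal.mul_ne_top (ENNReal.mul_ne_top (by simp) (ENNReal.pow_ne_top
        (ENNReal.mul_ne_top (inv_ofReal_Gamma_ne_top hσ) (kernelConst_ne_top n σ))))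
        (rieszConst_ne_top _)
    have := h.sq_setLIntegral_sum_sq_enorm_wave_le_two hσ hd (by linarith) hA hx hE
    rw [ENNReal.rpow_two]
    have he : 2 * s - 2 * 2 * (s - σ) = 4 * σ - 2 * s := by ring
    have he' : 2 * (1 - ((n : ℝ) / 2 - σ)) = 1 - ((n : ℝ) - 2 * σ) + 1 := by ring
    rwa [he, he']

end WeightedON

/-- A measurable choice of points at which a continuous function exceeds a given level. -/
lemma exists_measurable_selector {n : ℕ} {ρ : ℝ → Rn n → ℝ}
    (hρ : Continuous fun p : ℝ × Rn n => ρ p.1 p.2) (l : ℝ) :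
    MeasurableSet {t | ∃ x, l < ρ t x} ∧
      ∃ x : ℝ → Rn n, Measurable x ∧ ∀ t ∈ {t | ∃ x, l < ρ t x}, l < ρ t (x t) := by
  classical
  have hfix : ∀ y, Continuous fun t => ρ t y := fun y =>
    hρ.comp (continuous_id.prodMk continuous_const)
  have hopen : IsOpen {t | ∃ x, l < ρ t x} := by
    have : {t | ∃ x, l < ρ t x} = ⋃ x, {t | l < ρ t x} := by ext; simp
    rw [this]
    exact isOpen_iUnion fun y => isOpen_lt continuous_const (hfix y)
  refine ⟨hopen.measurableSet, ?_⟩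
  set S := {t | ∃ x, l < ρ t x} with hS
  let d : ℕ → Rn n := TopologicalSpace.denseSeq (Rn n)
  have hex : ∀ t, ∃ k, l < ρ t (d k) ∨ t ∉ S := by
    intro t
    by_cases ht : t ∈ S
    · obtain ⟨y, hy⟩ := ht
      have ho : IsOpen {y | l < ρ t y} :=
        isOpen_lt continuous_const (hρ.comp (continuous_const.prodMk continuous_id))
      obtain ⟨k, hk⟩ := (TopologicalSpace.denseRange_denseSeq (Rn n)).exists_mem_open ho ⟨y, hy⟩
      exact ⟨k, Or.inl hk⟩
    · exact ⟨0, Or.inr ht⟩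
  refine ⟨fun t => d (Nat.find (hex t)), ?_, fun t ht => ?_⟩
  · refine (measurable_from_nat (f := d)).comp (measurable_find hex fun k => ?_)
    exact (isOpen_lt continuous_const (hfix (d k))).measurableSet.union hopen.measurableSet.compl
  · exact (Nat.find_spec (hex t)).resolve_right fun h => h ht

lemma le_rpow_of_mul_rpow_le {L V D : ℝ≥0∞} {a b : ℝ} (ha : 0 < a) (hb : 0 < b) (hL0 : L ≠ 0)
    (hL : L ≠ ∞) (hV : V ≠ ∞) (h : (L * V) ^ a ≤ D * V ^ (a * (1 - b))) :
    V ≤ (D * L ^ (-a)) ^ (1 / (a * b)) := by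
  rcases eq_or_ne V 0 with h0 | h0
  · rw [h0]; exact zero_le
  rw [one_div, ENNReal.le_rpow_inv_iff (by positivity)]
  have h1 : L ^ a * V ^ (a * b) * V ^ (a * (1 - b)) ≤ D * V ^ (a * (1 - b)) := by
    refine le_trans (le_of_eq ?_) h
    rw [ENNReal.mul_rpow_of_nonneg _ _ ha.le, mul_assoc, ← ENNReal.rpow_add _ _ h0 hV]
    congr 2; ring
  have h2 : L ^ a * V ^ (a * b) ≤ D := by
    refine (ENNReal.mul_le_mul_iff_left ?_ ?_).1 h1
    · exact (ENNReal.rpow_pos (pos_iff_ne_zero.2 h0) hV).ne'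
    · exact ENNReal.rpow_ne_top_of_ne_zero h0 hV
  calc V ^ (a * b) = (L ^ a * V ^ (a * b)) * L ^ (-a) := by
        rw [mul_right_comm, ← ENNReal.rpow_add _ _ hL0 hL, add_neg_cancel, ENNReal.rpow_zero,
          one_mul]
    _ ≤ D * L ^ (-a) := by gcongr

namespace WeightedON

variable {n : ℕ} {s σ : ℝ} {φ : ℕ → Rn n → ℂ} {J : Finset ℕ}

lemma exists_volume_level_le {a : ℝ} (hσ : 0 < σ) (hd : σ < (n : ℝ) / 2) (ha : a = 1 ∨ a = 2)
    (hb : a * ((n : ℝ) / 2 - σ) < 1) :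
    ∃ K : ℝ≥0∞, K ≠ ∞ ∧ ∀ (φ : ℕ → Rn n → ℂ) (J : Finset ℕ), WeightedON s φ J →
      ∀ A : Set (Rn n), MeasurableSet A → ∀ l : ℝ, 0 < l →
      volume {t | ∃ x, l < ∑ j ∈ J, ‖wave (A.indicator (φ j)) t x‖ ^ 2} ≤
        (K * (∑ j ∈ J, ∫⁻ ξ in A, ENNReal.ofReal (‖ξ‖ ^ (2 * s - 2 * a * (s - σ))) * ‖φ j ξ‖ₑ ^ 2) *
          ENNReal.ofReal l ^ (-a)) ^ (1 / (a * ((n : ℝ) / 2 - σ))) := by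
  obtain ⟨K, hK, hmain⟩ := exists_setLIntegral_rpow_le (s := s) hσ hd ha hb
  have ha0 : 0 < a := by rcases ha with rfl | rfl <;> norm_num
  refine ⟨K, hK, fun φ J h A hA l hl => ?_⟩
  have hi : ∀ j ∈ J, Integrable (A.indicator (φ j)) := fun j hj => (h.integrable j hj).indicator hA
  have hcont : Continuous fun p : ℝ × Rn n =>
      ∑ j ∈ J, ‖wave (A.indicator (φ j)) p.1 p.2‖ ^ 2 :=
    continuous_finsetSum _ fun j hj => (continuous_wave (hi j hj)).norm.pow 2
  obtain ⟨hSm, x, hx, hxS⟩ := exists_measurable_selector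
    (ρ := fun t x => ∑ j ∈ J, ‖wave (A.indicator (φ j)) t x‖ ^ 2) hcont l
  set S := {t | ∃ x, l < ∑ j ∈ J, ‖wave (A.indicator (φ j)) t x‖ ^ 2} with hS
  have hmono : Monotone fun m : ℕ => S ∩ Ioo (-(m : ℝ)) m := by
    intro m m' hmm
    have : (m : ℝ) ≤ m' := by exact_mod_cast hmm
    exact inter_subset_inter_right _ (Ioo_subset_Ioo (by linarith) this)
  have hun : S = ⋃ m : ℕ, S ∩ Ioo (-(m : ℝ)) m := by
    rw [← inter_iUnion]
    symm
    rw [inter_eq_left]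
    intro t _
    obtain ⟨m, hm⟩ := exists_nat_gt |t|
    exact mem_iUnion.2 ⟨m, abs_lt.1 hm⟩
  rw [hun, hmono.measure_iUnion]
  refine iSup_le fun m => ?_
  set E := S ∩ Ioo (-(m : ℝ)) m with hE
  have hEf : volume E ≠ ∞ := ne_top_of_le_ne_top (by simp) (measure_mono inter_subset_right)
  have hEm : MeasurableSet E := hSm.inter measurableSet_Ioo
  apply le_rpow_of_mul_rpow_le ha0 (sub_pos.2 hd) (by simpa using hl) ENNReal.ofReal_ne_top hEf
  refine le_trans ?_ ((hmain φ J h A hA x hx E hEf).trans_eq (by ring))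
  gcongr
  rw [← setLIntegral_const]
  refine setLIntegral_mono' hEm fun t ht => ?_
  have h1 : ∑ j ∈ J, ‖wave (A.indicator (φ j)) t (x t)‖ₑ ^ 2
      = ENNReal.ofReal (∑ j ∈ J, ‖wave (A.indicator (φ j)) t (x t)‖ ^ 2) := by
    rw [ENNReal.ofReal_sum_of_nonneg fun _ _ => by positivity]
    refine Finset.sum_congr rfl fun j _ => ?_
    rw [ENNReal.ofReal_pow (norm_nonneg _), ofReal_norm]
  rw [h1]
  exact ENNReal.ofReal_le_ofReal (hxS t ht.1).le

end WeightedON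

/-- The constant in `setLIntegral_norm_rpow_neg_le`. -/
def ballConst (n : ℕ) (s : ℝ) : ℝ :=
  n * ((volume : Measure (Rn n)).real (Metric.ball 0 1)) / (n - 2 * s)

lemma setLIntegral_norm_rpow_neg {n : ℕ} (hn : 0 < n) {s R : ℝ} (hs : s < (n : ℝ) / 2)
    (hR : 0 < R) :
    ∫⁻ ξ in {ξ : Rn n | ‖ξ‖ ≤ R}, ENNReal.ofReal (‖ξ‖ ^ (-(2 * s)))
      = ENNReal.ofReal (ballConst n s * R ^ ((n : ℝ) - 2 * s)) := by
  have : Nonempty (Fin n) := ⟨⟨0, hn⟩⟩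
  have hA : MeasurableSet {ξ : Rn n | ‖ξ‖ ≤ R} := measurableSet_le measurable_norm measurable_const
  set f : ℝ → ℝ := (Iic R).indicator fun y => y ^ (-(2 * s)) with hf
  have hrad : ∀ ξ : Rn n, {ξ : Rn n | ‖ξ‖ ≤ R}.indicator (fun ξ => ENNReal.ofReal
      (‖ξ‖ ^ (-(2 * s)))) ξ = ENNReal.ofReal (f ‖ξ‖) := by
    intro ξ
    by_cases hξ : ‖ξ‖ ≤ R
    · rw [indicator_of_mem (show ξ ∈ {ξ : Rn n | ‖ξ‖ ≤ R} from hξ), hf,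
        indicator_of_mem (show ‖ξ‖ ∈ Iic R from hξ)]
    · rw [indicator_of_notMem (show ξ ∉ {ξ : Rn n | ‖ξ‖ ≤ R} from hξ), hf,
        indicator_of_notMem (show ‖ξ‖ ∉ Iic R from hξ), ENNReal.ofReal_zero]
  have h1d : ∀ y ∈ Ioi (0 : ℝ), y ^ (n - 1) • f y
      = (Ioc 0 R).indicator (fun y => y ^ ((n : ℝ) - 2 * s - 1)) y := by
    intro y hy
    have hy' : 0 < y := hy
    by_cases hyR : y ≤ R
    · rw [indicator_of_mem (show y ∈ Ioc 0 R from ⟨hy, hyR⟩), hf,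
        indicator_of_mem (show y ∈ Iic R from hyR), smul_eq_mul, ← Real.rpow_natCast,
        ← Real.rpow_add hy', Nat.cast_sub hn]
      congr 1; push_cast; ring
    · rw [indicator_of_notMem (show y ∉ Ioc 0 R from fun h => hyR h.2), hf,
        indicator_of_notMem (show y ∉ Iic R from hyR), smul_zero]
  have hInt : IntegrableOn (fun y : ℝ => y ^ ((n : ℝ) - 2 * s - 1)) (Ioc 0 R) :=
    (intervalIntegrable_iff_integrableOn_Ioc_of_le hR.le).1
      (intervalIntegral.intervalIntegrable_rpow' (by linarith))
  have hfi : Integrable fun ξ : Rn n => f ‖ξ‖ := by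
    rw [integrable_fun_norm_addHaar, finrank_euclideanSpace_fin,
      integrableOn_congr_fun h1d measurableSet_Ioi]
    exact (hInt.integrable_indicator measurableSet_Ioc).integrableOn
  have hf0 : ∀ ξ : Rn n, 0 ≤ f ‖ξ‖ := by
    intro ξ
    rw [hf]
    by_cases hξ : ‖ξ‖ ∈ Iic R
    · rw [indicator_of_mem hξ]; positivity
    · rw [indicator_of_notMem hξ]
  rw [← lintegral_indicator hA]
  simp_rw [hrad]
  rw [← ofReal_integral_eq_lintegral_ofReal hfi (Filter.Eventually.of_forall hf0),
    integral_fun_norm_addHaar, finrank_euclideanSpace_fin,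
    setIntegral_congr_fun measurableSet_Ioi h1d, setIntegral_indicator measurableSet_Ioc,
    inter_eq_right.2 (Ioc_subset_Ioi_self), ← intervalIntegral.integral_of_le hR.le,
    integral_rpow (by left; linarith), Real.zero_rpow (by linarith), sub_zero, sub_add_cancel]
  congr 1
  rw [ballConst, smul_eq_mul, nsmul_eq_mul]
  ring

lemma ballConst_pos {n : ℕ} (hn : 0 < n) {s : ℝ} (hs : s < (n : ℝ) / 2) : 0 < ballConst n s := by
  have h1 : 0 < (volume : Measure (Rn n)).real (Metric.ball 0 1) :=
    ENNReal.toReal_pos (Metric.measure_ball_pos _ _ one_pos).ne' measure_ball_lt_top.ne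
  have h2 : (0 : ℝ) < n := by exact_mod_cast hn
  have h3 : 0 < (n : ℝ) - 2 * s := by linarith
  unfold ballConst
  positivity

lemma WeightedON.sum_sq_enorm_wave_le {n : ℕ} {s : ℝ} {φ : ℕ → Rn n → ℂ} {J : Finset ℕ}
    (h : WeightedON s φ J) (hn : 0 < n) {A : Set (Rn n)} (hA : MeasurableSet A) (t : ℝ)
    (x : Rn n) :
    ∑ j ∈ J, ‖wave (A.indicator (φ j)) t x‖ₑ ^ 2
      ≤ ∫⁻ ξ in A, ENNReal.ofReal (‖ξ‖ ^ (-(2 * s))) := by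
  have hi : ∀ j ∈ J, Integrable (A.indicator (φ j)) := fun j hj => (h.integrable j hj).indicator hA
  set v : ℕ → ℂ := fun j => wave (A.indicator (φ j)) t x with hv
  set T := ∑ j ∈ J, ‖v j‖ₑ ^ 2 with hT
  have hTfin : T ≠ ∞ := ENNReal.sum_ne_top.2 fun j _ => ENNReal.pow_ne_top enorm_ne_top
  set F : Rn n → ℂ := fun ξ => ∑ j ∈ J, (starRingEnd ℂ) (v j) * φ j ξ with hF
  have hFm : AEStronglyMeasurable F volume :=
    Finset.aestronglyMeasurable_fun_sum _ fun j hj => (h.integrable j hj).1.const_mul _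
  have hdual : ((∑ j ∈ J, ‖v j‖ ^ 2 : ℝ) : ℂ) = ∫ ξ, phase t x ξ * A.indicator F ξ := by
    have hz : ∀ ξ, phase t x ξ * A.indicator F ξ
        = ∑ j ∈ J, (starRingEnd ℂ) (v j) * (phase t x ξ * A.indicator (φ j) ξ) := by
      intro ξ
      by_cases hξ : ξ ∈ A
      · simp only [indicator_of_mem hξ, hF, Finset.mul_sum]
        exact Finset.sum_congr rfl fun j _ => by ring
      · simp [indicator_of_notMem hξ]
    simp_rw [hz]
    rw [integral_finsetSum _ fun j hj => (integrable_phase_mul (hi j hj) t x).const_mul _]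
    push_cast
    refine Finset.sum_congr rfl fun j _ => ?_
    rw [integral_const_mul, ← Complex.conj_mul']
    rfl
  have h1 : T ≤ ∫⁻ ξ in A, ‖F ξ‖ₑ * 1 := by
    have : T = ‖((∑ j ∈ J, ‖v j‖ ^ 2 : ℝ) : ℂ)‖ₑ := by
      rw [← ofReal_norm, Complex.norm_real, Real.norm_eq_abs,
        abs_of_nonneg (Finset.sum_nonneg fun _ _ => by positivity),
        ENNReal.ofReal_sum_of_nonneg fun _ _ => by positivity]
      refine Finset.sum_congr rfl fun j _ => ?_
      rw [ENNReal.ofReal_pow (norm_nonneg _), ofReal_norm]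
    rw [this, hdual]
    refine (enorm_integral_le_lintegral_enorm _).trans_eq ?_
    rw [← lintegral_indicator hA]
    refine lintegral_congr fun ξ => ?_
    have hp : ‖phase t x ξ‖ₑ = 1 := by rw [← ofReal_norm, norm_phase, ENNReal.ofReal_one]
    rw [enorm_mul, hp, one_mul]
    by_cases hξ : ξ ∈ A <;> simp [hξ]
  have h2 := sq_lintegral_mul_le_weight (μ := volume.restrict A) (f := fun ξ => ‖F ξ‖ₑ)
    (g := fun _ => 1) hFm.restrict.enorm aemeasurable_const
    (w := fun ξ => ENNReal.ofReal (‖ξ‖ ^ s)) (w' := fun ξ => ENNReal.ofReal (‖ξ‖ ^ (-s)))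
    (by fun_prop) (by fun_prop) (by
      filter_upwards [ae_restrict_of_ae (ae_ne_zero hn)] with ξ hξ
        using ofReal_norm_rpow_mul_neg s hξ)
  simp only [ofReal_norm_rpow_sq, mul_neg, one_pow, mul_one] at h2
  have h3 : ∫⁻ ξ in A, ENNReal.ofReal (‖ξ‖ ^ (2 * s)) * ‖F ξ‖ₑ ^ 2 ≤ T := by
    refine (setLIntegral_le_lintegral _ _).trans_eq ?_
    have := h.lintegral_sum_sq fun j => (starRingEnd ℂ) (v j)
    simp only [RCLike.enorm_conj] at this
    rw [hT, ← this]
    refine lintegral_congr fun ξ => ?_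
    have : ∑ j ∈ J, (starRingEnd ℂ) (v j) * (((‖ξ‖ ^ s : ℝ) : ℂ) * φ j ξ)
        = ((‖ξ‖ ^ s : ℝ) : ℂ) * F ξ := by
      rw [hF, Finset.mul_sum]
      exact Finset.sum_congr rfl fun j _ => by ring
    rw [this, enorm_mul, mul_pow, ← ofReal_norm ((‖ξ‖ ^ s : ℝ) : ℂ), Complex.norm_real,
      Real.norm_eq_abs, abs_of_nonneg (by positivity), ofReal_norm_rpow_sq]
  simp only [mul_one] at h1
  refine le_of_sq_le_mul hTfin ((pow_le_pow_left' h1 2).trans (h2.trans ?_))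
  rw [mul_comm]
  gcongr

lemma setLIntegral_Ioo_rpow {κ z : ℝ} (hκ : 0 < κ) (hz : 0 ≤ z) :
    ∫⁻ l in Ioo 0 z, ENNReal.ofReal (l ^ (κ - 1)) = ENNReal.ofReal (z ^ κ / κ) := by
  have hInt : IntegrableOn (fun y : ℝ => y ^ (κ - 1)) (Ioc 0 z) :=
    (intervalIntegrable_iff_integrableOn_Ioc_of_le hz).1
      (intervalIntegral.intervalIntegrable_rpow' (by linarith))
  rw [setLIntegral_congr Ioo_ae_eq_Ioc, ← ofReal_integral_eq_lintegral_ofReal hInt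
    ((ae_restrict_iff' measurableSet_Ioc).2 (Filter.Eventually.of_forall fun y hy =>
      Real.rpow_nonneg hy.1.le _)), ← intervalIntegral.integral_of_le hz,
    integral_rpow (by left; linarith), sub_add_cancel, Real.zero_rpow hκ.ne', sub_zero]

/-- A distributional bound with a cutoff moving with the level, integrated over all levels. -/
lemma lintegral_rpow_le_of_level_le {Ω Ξ : Type*} [MeasurableSpace Ω] [MeasurableSpace Ξ]
    {μ : Measure Ω} {ν : Measure Ξ} [SFinite ν] {U : Ω → ℝ} (hU : Measurable U) (hU0 : ∀ t, 0 ≤ U t)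
    {z : Ξ → ℝ} (hz : Measurable z) {W : Ξ → ℝ≥0∞} (hW : AEMeasurable W ν)
    {q κ : ℝ} (hq : 0 < q) (hκ : 0 < κ) {M : ℝ≥0∞}
    (h : ∀ l, 0 < l → μ {t | l < U t} ≤ M * ENNReal.ofReal (l ^ (κ - q)) *
      ∫⁻ ξ in {ξ | l < z ξ}, ENNReal.ofReal (z ξ ^ (-κ)) * W ξ ∂ν) :
    ∫⁻ t, ENNReal.ofReal (U t ^ q) ∂μ ≤ ENNReal.ofReal (q / κ) * M * ∫⁻ ξ, W ξ ∂ν := by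
  have hset : MeasurableSet {p : ℝ × Ξ | p.1 < z p.2} :=
    measurableSet_lt measurable_fst (hz.comp measurable_snd)
  set G : ℝ → Ξ → ℝ≥0∞ := fun l ξ => M * ENNReal.ofReal (l ^ (κ - 1)) *
    {ξ | l < z ξ}.indicator (fun ξ => ENNReal.ofReal (z ξ ^ (-κ)) * W ξ) ξ with hG
  have hlev : ∀ l, MeasurableSet {ξ | l < z ξ} := fun l => measurableSet_lt measurable_const hz
  have hzW : AEMeasurable (fun ξ => ENNReal.ofReal (z ξ ^ (-κ)) * W ξ) ν :=
    (by fun_prop : Measurable fun ξ => ENNReal.ofReal (z ξ ^ (-κ))).aemeasurable.mul hW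
  have hGm : AEMeasurable (Function.uncurry G) ((volume.restrict (Ioi 0)).prod ν) := by
    refine AEMeasurable.mul (by fun_prop) ?_
    have : (fun p : ℝ × Ξ => {ξ | p.1 < z ξ}.indicator (fun ξ => ENNReal.ofReal (z ξ ^ (-κ)) * W ξ)
        p.2) = {p : ℝ × Ξ | p.1 < z p.2}.indicator
          fun p => ENNReal.ofReal (z p.2 ^ (-κ)) * W p.2 := by
      ext p
      simp only [indicator, mem_ofPred_eq]
    rw [this]
    exact (hzW.comp_quasiMeasurePreserving Measure.quasiMeasurePreserving_snd).indicator hset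
  rw [lintegral_rpow_eq_lintegral_meas_lt_mul μ (Filter.Eventually.of_forall hU0) hU.aemeasurable
    hq]
  have h1 : ∫⁻ l in Ioi (0 : ℝ), μ {t | l < U t} * ENNReal.ofReal (l ^ (q - 1))
      ≤ ∫⁻ l in Ioi (0 : ℝ), ∫⁻ ξ, G l ξ ∂ν := by
    refine setLIntegral_mono' measurableSet_Ioi fun l hl => ?_
    have hl' : 0 < l := hl
    refine (mul_le_mul_left (h l hl') _).trans_eq ?_
    rw [hG, lintegral_const_mul'' _ (hzW.indicator (hlev l)), lintegral_indicator (hlev l),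
      show κ - 1 = (κ - q) + (q - 1) by ring, Real.rpow_add hl',
      ENNReal.ofReal_mul (Real.rpow_nonneg hl'.le _)]
    ring
  have h2 : ∀ ξ, ∫⁻ l in Ioi (0 : ℝ), G l ξ ≤ M * ENNReal.ofReal (1 / κ) * W ξ := by
    intro ξ
    have hz' : ∀ l, G l ξ = (Iio (z ξ)).indicator
        (fun l => M * (ENNReal.ofReal (z ξ ^ (-κ)) * W ξ) *
        ENNReal.ofReal (l ^ (κ - 1))) l := by
      intro l
      simp only [hG, indicator, mem_ofPred_eq, mem_Iio]
      split_ifs <;> ring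
    simp_rw [hz']
    rw [setLIntegral_indicator measurableSet_Iio, inter_comm, Ioi_inter_Iio,
      lintegral_const_mul _ (by fun_prop)]
    rcases le_or_gt (z ξ) 0 with hz0 | hz0
    · rw [Ioo_eq_empty (by simpa using hz0)]
      simp
    · rw [setLIntegral_Ioo_rpow hκ hz0.le]
      have : ENNReal.ofReal (z ξ ^ (-κ)) * ENNReal.ofReal (z ξ ^ κ / κ) =
          ENNReal.ofReal (1 / κ) := by
        rw [← ENNReal.ofReal_mul (Real.rpow_nonneg hz0.le _), ← mul_div_assoc,
          ← Real.rpow_add hz0, neg_add_cancel, Real.rpow_zero]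
      rw [← this]
      exact le_of_eq (by ring)
  calc _ ≤ ENNReal.ofReal q * ∫⁻ l in Ioi (0 : ℝ), ∫⁻ ξ, G l ξ ∂ν := by gcongr
    _ = ENNReal.ofReal q * ∫⁻ ξ, (∫⁻ l in Ioi (0 : ℝ), G l ξ) ∂ν := by
        rw [lintegral_lintegral_swap hGm]
    _ ≤ ENNReal.ofReal q * ∫⁻ ξ, M * ENNReal.ofReal (1 / κ) * W ξ ∂ν := by
        gcongr with ξ; exact h2 ξ
    _ = _ := by
        rw [lintegral_const_mul'' _ hW, div_eq_mul_one_div q, ENNReal.ofReal_mul hq.le]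
        ring

namespace WeightedON

variable {n : ℕ} {s σ : ℝ} {φ : ℕ → Rn n → ℂ} {J : Finset ℕ}

lemma aemeasurable_weight (h : WeightedON s φ J) {j : ℕ} (hj : j ∈ J) :
    AEMeasurable fun ξ => ENNReal.ofReal (‖ξ‖ ^ (2 * s)) * ‖φ j ξ‖ₑ ^ 2 :=
  (by fun_prop : Measurable fun ξ : Rn n => ENNReal.ofReal (‖ξ‖ ^ (2 * s))).aemeasurable.mul
    ((h.integrable j hj).1.enorm.pow_const 2)

lemma lintegral_weight (h : WeightedON s φ J) :
    ∫⁻ ξ, ∑ j ∈ J, ENNReal.ofReal (‖ξ‖ ^ (2 * s)) * ‖φ j ξ‖ₑ ^ 2 = (J.card : ℝ≥0∞) := by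
  rw [lintegral_finsetSum' _ fun j hj => h.aemeasurable_weight hj, Finset.card_eq_sum_ones,
    Nat.cast_sum, Nat.cast_one]
  refine Finset.sum_congr rfl fun j hj => ?_
  have h1 := (h.mono (Finset.singleton_subset_iff.2 hj)).lintegral_sum_sq fun _ => 1
  simp only [Finset.sum_singleton, one_mul, enorm_one, one_pow] at h1
  rw [← h1]
  refine lintegral_congr fun ξ => ?_
  rw [enorm_mul, mul_pow, ← ofReal_norm_rpow_sq, ← ofReal_norm (((‖ξ‖ ^ s : ℝ) : ℂ)),
    Complex.norm_real, Real.norm_of_nonneg (by positivity)]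

lemma sum_sq_norm_wave_low_le (h : WeightedON s φ J) (hn : 0 < n) {q l : ℝ} (hq : 0 < q)
    (hs : s = (n : ℝ) / 2 - 1 / q) (hl : 0 < l) (t : ℝ) (x : Rn n) :
    ∑ j ∈ J, ‖wave ({ξ : Rn n | 4 * ballConst n s * ‖ξ‖ ^ (2 / q) ≤ l}.indicator (φ j)) t x‖ ^ 2
      ≤ l / 4 := by
  have hs' : s < (n : ℝ) / 2 := by rw [hs]; linarith [one_div_pos.2 hq]
  have hB := ballConst_pos hn hs'
  set B := ballConst n s
  have hR : 0 < (l / (4 * B)) ^ (q / 2) := by positivity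
  have hset : {ξ : Rn n | 4 * B * ‖ξ‖ ^ (2 / q) ≤ l} = {ξ | ‖ξ‖ ≤ (l / (4 * B)) ^ (q / 2)} := by
    ext ξ
    simp only [mem_ofPred_eq]
    rw [show q / 2 = (2 / q)⁻¹ by rw [inv_div], Real.le_rpow_inv_iff_of_pos (norm_nonneg _)
      (by positivity) (by positivity), le_div_iff₀' (by positivity)]
  rw [hset]
  have hA : MeasurableSet {ξ : Rn n | ‖ξ‖ ≤ (l / (4 * B)) ^ (q / 2)} :=
    measurableSet_le measurable_norm measurable_const
  have h1 := h.sum_sq_enorm_wave_le hn hA t x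
  rw [setLIntegral_norm_rpow_neg hn hs' hR, show (n : ℝ) - 2 * s = 2 / q by rw [hs]; ring,
    ← Real.rpow_mul (by positivity), show q / 2 * (2 / q) = 1 by field_simp, Real.rpow_one,
    show ballConst n s * (l / (4 * B)) = l / 4 by field_simp; rfl] at h1
  rw [← ENNReal.ofReal_le_ofReal_iff (by positivity), ENNReal.ofReal_sum_of_nonneg fun j _ => by
    positivity]
  refine le_of_eq_of_le (Finset.sum_congr rfl fun j _ => ?_) h1
  rw [ENNReal.ofReal_pow (norm_nonneg _), ofReal_norm]

lemma level_subset (h : WeightedON s φ J) (hn : 0 < n) {q l : ℝ} (hq : 0 < q)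
    (hs : s = (n : ℝ) / 2 - 1 / q) (hl : 0 < l) :
    {t | ∃ x, l < ∑ j ∈ J, ‖wave (φ j) t x‖ ^ 2} ⊆
      {t | ∃ x, l / 4 < ∑ j ∈ J,
        ‖wave ({ξ : Rn n | l < 4 * ballConst n s * ‖ξ‖ ^ (2 / q)}.indicator (φ j)) t x‖ ^ 2} := by
  rintro t ⟨x, hx⟩
  refine ⟨x, ?_⟩
  have hlow := h.sum_sq_norm_wave_low_le hn hq hs hl t x
  set A := {ξ : Rn n | l < 4 * ballConst n s * ‖ξ‖ ^ (2 / q)} with hA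
  have hAm : MeasurableSet A := measurableSet_lt measurable_const (by fun_prop)
  have hAc : {ξ : Rn n | 4 * ballConst n s * ‖ξ‖ ^ (2 / q) ≤ l} = Aᶜ := by
    ext ξ; simp [hA]
  rw [hAc] at hlow
  have hsplit : ∑ j ∈ J, ‖wave (φ j) t x‖ ^ 2 ≤
      2 * ∑ j ∈ J, ‖wave (Aᶜ.indicator (φ j)) t x‖ ^ 2 +
        2 * ∑ j ∈ J, ‖wave (A.indicator (φ j)) t x‖ ^ 2 := by
    rw [Finset.mul_sum, Finset.mul_sum, ← Finset.sum_add_distrib]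
    refine Finset.sum_le_sum fun j hj => ?_
    have hw : wave (φ j) t x = wave (Aᶜ.indicator (φ j)) t x + wave (A.indicator (φ j)) t x := by
      unfold wave
      rw [← integral_add (integrable_phase_mul ((h.integrable j hj).indicator hAm.compl) t x)
        (integrable_phase_mul ((h.integrable j hj).indicator hAm) t x)]
      refine integral_congr_ae (Filter.Eventually.of_forall fun ξ => ?_)
      simp only
      rw [← mul_add, indicator_compl_add_self_apply]
    rw [hw]
    have := norm_add_le (wave (Aᶜ.indicator (φ j)) t x) (wave (A.indicator (φ j)) t x)
    have h0 := norm_nonneg (wave (Aᶜ.indicator (φ j)) t x + wave (A.indicator (φ j)) t x)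
    nlinarith [sq_nonneg (‖wave (Aᶜ.indicator (φ j)) t x‖ - ‖wave (A.indicator (φ j)) t x‖)]
  change l / 4 < ∑ j ∈ J, ‖wave (A.indicator (φ j)) t x‖ ^ 2
  linarith

end WeightedON

namespace WeightedON

variable {n : ℕ} {s σ : ℝ}

/-- The estimate for a finite system with equal weights. -/
lemma exists_lintegral_iSup_rpow_le {q a : ℝ} (hn : 0 < n) (hq : 0 < q)
    (hs : s = (n : ℝ) / 2 - 1 / q) (hσ : 0 < σ) (hσs : σ < s) (ha : a = 1 ∨ a = 2)
    (hb : a * ((n : ℝ) / 2 - σ) < 1) :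
    ∃ K : ℝ≥0∞, K ≠ ∞ ∧ ∀ (φ : ℕ → Rn n → ℂ) (J : Finset ℕ), WeightedON s φ J →
      ∫⁻ t, (⨆ x, ENNReal.ofReal (∑ j ∈ J, ‖wave (φ j) t x‖ ^ 2)) ^ q ≤
        K * (J.card : ℝ≥0∞) ^ (1 / (a * ((n : ℝ) / 2 - σ))) := by
  have hs' : s < (n : ℝ) / 2 := by rw [hs]; linarith [one_div_pos.2 hq]
  obtain ⟨K, hK, hlev⟩ := exists_volume_level_le (s := s) hσ (hσs.trans hs') ha hb
  have ha0 : 0 < a := by rcases ha with rfl | rfl <;> norm_num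
  have hB := ballConst_pos hn hs'
  set β := (n : ℝ) / 2 - σ with hβ
  have hβ0 : 0 < β := by linarith
  set e := 1 / (a * β) with he
  have he1 : 1 < e := by rw [he, lt_div_iff₀ (by positivity)]; linarith
  set κ := a * q * (s - σ) with hκ
  have hκ0 : 0 < κ := by have := sub_pos.2 hσs; positivity
  have hexp : -a * e - κ * (e - 1) = κ - q := by
    have h1 : s - σ = β - 1 / q := by rw [hs, hβ]; ring
    rw [hκ, h1, he]; field_simp; ring
  set b := 4 * ballConst n s with hb4
  have hb0 : 0 < b := by positivity
  set L := K * ENNReal.ofReal (b ^ κ) * ENNReal.ofReal ((1 / 4) ^ (-a)) with hL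
  have hLfin : L ≠ ∞ := by finiteness
  refine ⟨ENNReal.ofReal (q / κ) * L ^ e, ENNReal.mul_ne_top ENNReal.ofReal_ne_top
    (ENNReal.rpow_ne_top_of_nonneg (by linarith) hLfin), fun φ J h => ?_⟩
  set N : ℝ≥0∞ := (J.card : ℝ≥0∞) with hN
  set ρ : ℝ → Rn n → ℝ := fun t x => ∑ j ∈ J, ‖wave (φ j) t x‖ ^ 2 with hρ
  have hcont : Continuous fun p : ℝ × Rn n => ρ p.1 p.2 :=
    continuous_finsetSum _ fun j hj => (continuous_wave (h.integrable j hj)).norm.pow 2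
  have hbdd : ∀ t, BddAbove (range (ρ t)) := by
    refine fun t => ⟨∑ j ∈ J, (∫ ξ, ‖φ j ξ‖) ^ 2, ?_⟩
    rintro _ ⟨x, rfl⟩
    exact Finset.sum_le_sum fun j _ => by gcongr; exact norm_wave_le _ _ _
  set U : ℝ → ℝ := fun t => ⨆ x, ρ t x with hU
  have hUlt : ∀ l, {t | l < U t} = {t | ∃ x, l < ρ t x} := fun l => by
    ext t; exact lt_ciSup_iff (hbdd t)
  have hUm : Measurable U := measurable_of_Ioi fun l => by
    change MeasurableSet {t | l < U t}
    rw [hUlt]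
    exact (exists_measurable_selector hcont l).1
  have hU0 : ∀ t, 0 ≤ U t := fun t =>
    Real.iSup_nonneg fun x => Finset.sum_nonneg fun j _ => by positivity
  set z : Rn n → ℝ := fun ξ => b * ‖ξ‖ ^ (2 / q) with hz
  have hzm : Measurable z := by fun_prop
  set W : Rn n → ℝ≥0∞ := fun ξ => ∑ j ∈ J, ENNReal.ofReal (‖ξ‖ ^ (2 * s)) * ‖φ j ξ‖ₑ ^ 2 with hW
  have hWm : AEMeasurable W := Finset.aemeasurable_fun_sum _ fun j hj => h.aemeasurable_weight hj
  have hmain := lintegral_rpow_le_of_level_le (μ := volume) (ν := volume) hUm hU0 hzm hWm hq hκ0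
    (M := L ^ e * N ^ (e - 1)) ?_
  · refine le_trans (lintegral_mono fun t => ?_) (hmain.trans_eq ?_)
    · rw [← ENNReal.ofReal_rpow_of_nonneg (hU0 t) hq.le]
      gcongr
      exact iSup_le fun x => ENNReal.ofReal_le_ofReal (le_ciSup (hbdd t) x)
    · rw [h.lintegral_weight]
      have : N ^ (e - 1) * N = N ^ e := by
        conv_lhs => rw [← ENNReal.rpow_one N, ← ENNReal.rpow_mul, one_mul,
          ← ENNReal.rpow_add_of_nonneg _ _ (by linarith) zero_le_one, sub_add_cancel]
      rw [← this]; ring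
  intro l hl
  set A := {ξ : Rn n | l < z ξ} with hA
  have hAm : MeasurableSet A := measurableSet_lt measurable_const hzm
  set D := ∫⁻ ξ in A, ENNReal.ofReal (z ξ ^ (-κ)) * W ξ with hD
  have hDle : D ≤ ENNReal.ofReal (l ^ (-κ)) * N := by
    rw [hN, ← h.lintegral_weight, ← lintegral_const_mul'' _ hWm]
    refine (setLIntegral_mono' hAm fun ξ hξ => ?_).trans (setLIntegral_le_lintegral _ _)
    have : l < z ξ := hξ
    gcongr ENNReal.ofReal ?_ * _
    exact Real.rpow_le_rpow_of_nonpos hl this.le (by linarith)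
  have hD' : ∑ j ∈ J, ∫⁻ ξ in A, ENNReal.ofReal (‖ξ‖ ^ (2 * s - 2 * a * (s - σ))) * ‖φ j ξ‖ₑ ^ 2
      = ENNReal.ofReal (b ^ κ) * D := by
    have hm : ∀ c : ℝ, Measurable fun ξ : Rn n => ENNReal.ofReal (‖ξ‖ ^ c) := fun c => by fun_prop
    have hzW : AEMeasurable (fun ξ => ENNReal.ofReal (z ξ ^ (-κ)) * W ξ) (volume.restrict A) :=
      (by fun_prop : Measurable fun ξ => ENNReal.ofReal (z ξ ^ (-κ))).aemeasurable.mul hWm.restrict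
    have hφm : ∀ j ∈ J, AEMeasurable (fun ξ =>
        ENNReal.ofReal (‖ξ‖ ^ (2 * s - 2 * a * (s - σ))) * ‖φ j ξ‖ₑ ^ 2) (volume.restrict A) :=
      fun j hj => (hm _).aemeasurable.mul ((h.integrable j hj).1.enorm.pow_const 2).restrict
    rw [hD, ← lintegral_const_mul'' _ hzW, ← lintegral_finsetSum' _ hφm]
    refine setLIntegral_congr_fun hAm fun ξ hξ => ?_
    have hzl : l < b * ‖ξ‖ ^ (2 / q) := hξ
    have hξ0 : 0 < ‖ξ‖ := by
      rcases (norm_nonneg ξ).eq_or_lt with h0 | h0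
      · rw [← h0, Real.zero_rpow (by positivity)] at hzl; linarith
      · exact h0
    simp only [hW]
    rw [Finset.mul_sum, Finset.mul_sum]
    refine Finset.sum_congr rfl fun j _ => ?_
    rw [← mul_assoc, ← mul_assoc]
    congr 1
    rw [← ENNReal.ofReal_mul (by positivity), ← ENNReal.ofReal_mul (by positivity)]
    congr 1
    rw [hz, Real.mul_rpow hb0.le (by positivity), ← Real.rpow_mul hξ0.le, ← mul_assoc,
      ← Real.rpow_add hb0, add_neg_cancel, Real.rpow_zero, one_mul, ← Real.rpow_add hξ0, hκ]
    congr 1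
    field_simp
    ring
  rw [hUlt]
  refine (measure_mono (h.level_subset hn hq hs hl)).trans
    ((hlev φ J h A hAm (l / 4) (by positivity)).trans ?_)
  rw [hD']
  calc (K * (ENNReal.ofReal (b ^ κ) * D) * ENNReal.ofReal (l / 4) ^ (-a)) ^ e
      = (L * ENNReal.ofReal (l ^ (-a)) * D) ^ e := by
        rw [ENNReal.ofReal_rpow_of_pos (by positivity), show l / 4 = 1 / 4 * l by ring,
          Real.mul_rpow (by norm_num) hl.le, ENNReal.ofReal_mul (by positivity), hL]
        congr 1; ring
    _ = L ^ e * ENNReal.ofReal (l ^ (-a * e)) * (D ^ (e - 1) * D) := by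
        have : D ^ (e - 1) * D = D ^ e := by
          conv_lhs => rw [← ENNReal.rpow_one D, ← ENNReal.rpow_mul, one_mul,
            ← ENNReal.rpow_add_of_nonneg _ _ (by linarith) zero_le_one, sub_add_cancel]
        rw [this, ENNReal.mul_rpow_of_nonneg _ _ (by linarith),
          ENNReal.mul_rpow_of_nonneg _ _ (by linarith),
          ENNReal.ofReal_rpow_of_nonneg (by positivity) (by linarith), ← Real.rpow_mul hl.le]
    _ ≤ L ^ e * ENNReal.ofReal (l ^ (-a * e)) *
          ((ENNReal.ofReal (l ^ (-κ)) * N) ^ (e - 1) * D) := by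
        gcongr
    _ = L ^ e * N ^ (e - 1) * ENNReal.ofReal (l ^ (κ - q)) * D := by
        rw [ENNReal.mul_rpow_of_nonneg (ENNReal.ofReal (l ^ (-κ))) N (by linarith),
          ENNReal.ofReal_rpow_of_nonneg (by positivity) (by linarith), ← Real.rpow_mul hl.le,
          ← hexp, sub_eq_add_neg (-a * e), ← neg_mul κ, Real.rpow_add hl,
          ENNReal.ofReal_mul (by positivity)]
        ring

end WeightedON

lemma tsum_pow_mul_rpow_le (r : ℝ≥0∞) (y : ℕ → ℝ≥0∞) {q : ℝ} (hq : 0 < q) :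
    (∑' m, r ^ m * y m) ^ q ≤ (∑' m, r ^ m) ^ q * ∑' m, y m ^ q := by
  have h1 : ∑' m, r ^ m * y m ≤ (∑' m, r ^ m) * (∑' m, y m ^ q) ^ (1 / q) := by
    rw [← ENNReal.tsum_mul_right]
    refine ENNReal.tsum_le_tsum fun m => ?_
    gcongr
    rw [one_div, ENNReal.le_rpow_inv_iff hq]
    exact ENNReal.le_tsum (f := fun m => y m ^ q) m
  refine (ENNReal.rpow_le_rpow h1 hq.le).trans_eq ?_
  rw [ENNReal.mul_rpow_of_nonneg _ _ hq.le, ← ENNReal.rpow_mul, one_div, inv_mul_cancel₀ hq.ne',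
    ENNReal.rpow_one]

lemma tsum_two_rpow_pow_ne_top {η : ℝ} (hη : η < 0) : ∑' m : ℕ, ((2 : ℝ≥0∞) ^ η) ^ m ≠ ∞ := by
  rw [ENNReal.tsum_geometric]
  refine ENNReal.inv_ne_top.2 (tsub_pos_of_lt ?_).ne'
  exact ENNReal.rpow_lt_one_of_one_lt_of_neg (by norm_num) hη

/-- Dyadic decomposition of the coefficients: a bound for finite sums with equal coefficients, of
order `card ^ (e / q)`, gives a bound for sums with `ℓ^α` coefficients whenever `α * e < q`. -/
lemma exists_lintegral_iSup_tsum_rpow_le {q α e : ℝ} (hq : 0 < q) (hα : 0 < α) (he : 0 ≤ e)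
    (hlt : α * e < q) :
    ∃ C : ℝ≥0∞, C ≠ ∞ ∧ ∀ {Ω X : Type} [MeasurableSpace Ω] (μ : Measure Ω) (g : ℕ → Ω → X → ℝ≥0∞)
      (G : Set ℕ) (K : ℝ≥0∞),
      (∀ J : Finset ℕ, ↑J ⊆ G → Measurable fun t => ⨆ x, ∑ j ∈ J, g j t x) →
      (∀ J : Finset ℕ, ↑J ⊆ G →
        ∫⁻ t, (⨆ x, ∑ j ∈ J, g j t x) ^ q ∂μ ≤ K * (J.card : ℝ≥0∞) ^ e) →
      (∀ j ∉ G, ∀ t x, g j t x = 0) →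
      ∀ (c : ℕ → ℝ≥0∞) (L : ℝ≥0∞), L ≠ 0 → L ≠ ∞ → ∑' j, c j ^ α ≤ L ^ α →
        ∫⁻ t, (⨆ x, ∑' j, c j * g j t x) ^ q ∂μ ≤ C * K * L ^ q := by
  classical
  set η := (q - α * e) / (2 * q) with hη
  have hη0 : 0 < η := div_pos (by linarith) (by positivity)
  set r : ℝ≥0∞ := 2 ^ (-η) with hr
  set d : ℝ≥0∞ := 2 ^ (η - 1) with hd
  have h20 : (2 : ℝ≥0∞) ≠ 0 := two_ne_zero
  have h2t : (2 : ℝ≥0∞) ≠ ∞ := ENNReal.ofNat_ne_top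
  have hrd : r * d = 2⁻¹ := by
    rw [hr, hd, ← ENNReal.rpow_add _ _ h20 h2t,
      show -η + (η - 1) = -1 by ring, ENNReal.rpow_neg_one]
  set S := ∑' m : ℕ, r ^ m with hS
  have hSt : S ≠ ∞ := tsum_two_rpow_pow_ne_top (by linarith)
  set T := ∑' m : ℕ, ((2 : ℝ≥0∞) ^ (-(q - α * e) / 2)) ^ m with hT
  have hTt : T ≠ ∞ := tsum_two_rpow_pow_ne_top (by linarith)
  refine ⟨S ^ q * 2 ^ (α * e) * T, by finiteness, ?_⟩
  intro Ω X _ μ g G K hmeas hK hg c L hL0 hLt hc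
  have hε : ∀ m : ℕ, ((2⁻¹ : ℝ≥0∞) ^ (m + 1) * L) ^ α ≠ 0 := fun m =>
    (ENNReal.rpow_pos (pos_iff_ne_zero.2 (mul_ne_zero (by simp) hL0)) (by finiteness)).ne'
  have hLα : L ^ α ≠ ∞ := by finiteness
  choose hf hcard using fun m => ENNReal.finset_card_const_le_le_of_tsum_le hLα hc (hε m)
  set J : ℕ → Finset ℕ := fun m => (hf m).toFinset.filter (· ∈ G) with hJ
  have hJG : ∀ m, (J m : Set ℕ) ⊆ G := fun m j hj => (Finset.mem_filter.1 hj).2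
  have hJc : ∀ m, ((J m).card : ℝ≥0∞) ^ e ≤ ((2 : ℝ≥0∞) ^ (α * e)) ^ (m + 1) := by
    intro m
    have h1 : ((J m).card : ℝ≥0∞) ≤ L ^ α / ((2⁻¹ : ℝ≥0∞) ^ (m + 1) * L) ^ α :=
      le_trans (by exact_mod_cast Finset.card_filter_le _ _) (hcard m)
    have h2 : L ^ α / ((2⁻¹ : ℝ≥0∞) ^ (m + 1) * L) ^ α = ((2 : ℝ≥0∞) ^ (m + 1)) ^ α := by
      rw [← ENNReal.div_rpow_of_nonneg _ _ hα.le]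
      congr 1
      rw [ENNReal.div_eq_inv_mul, ENNReal.mul_inv (by simp) (by simp), mul_assoc,
        ENNReal.inv_mul_cancel hL0 hLt, mul_one, ENNReal.inv_pow, inv_inv]
    rw [h2] at h1
    refine (ENNReal.rpow_le_rpow h1 he).trans_eq ?_
    rw [← ENNReal.rpow_natCast, ← ENNReal.rpow_natCast, ← ENNReal.rpow_mul, ← ENNReal.rpow_mul,
      ← ENNReal.rpow_mul]
    congr 1; ring
  have hcover : ∀ j, c j ≠ 0 → ∃ m, c j ≤ 2⁻¹ ^ m * L ∧
      ((2⁻¹ : ℝ≥0∞) ^ (m + 1) * L) ^ α ≤ c j ^ α := by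
    intro j hj
    have hex : ∃ m : ℕ, (2⁻¹ : ℝ≥0∞) ^ (m + 1) * L ≤ c j := by
      obtain ⟨m, hm⟩ := ENNReal.exists_inv_two_pow_lt
        (ENNReal.div_pos hj hLt).ne'
      refine ⟨m, (ENNReal.le_div_iff_mul_le (Or.inl hL0) (Or.inl hLt)).1 (le_trans ?_ hm.le)⟩
      exact pow_le_pow_right_of_le_one' (by simp) (Nat.le_succ m)
    refine ⟨Nat.find hex, ?_, ENNReal.rpow_le_rpow (Nat.find_spec hex) hα.le⟩
    rcases h0 : Nat.find hex with _ | m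
    · rw [pow_zero, one_mul, ← ENNReal.rpow_le_rpow_iff hα]
      exact (ENNReal.le_tsum (f := fun j => c j ^ α) j).trans hc
    · exact (not_le.1 (Nat.find_min hex (h0 ▸ Nat.lt_succ_self m))).le
  set F : ℕ → Ω → ℝ≥0∞ := fun m t => ⨆ x, ∑ j ∈ J m, g j t x with hF
  have hpt : ∀ t, ⨆ x, ∑' j, c j * g j t x ≤ ∑' m, r ^ m * (d ^ m * L * F m t) := by
    refine fun t => iSup_le fun x => ?_
    calc ∑' j, c j * g j t x ≤ ∑' j, ∑' m, if j ∈ J m then 2⁻¹ ^ m * L * g j t x else 0 := by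
          refine ENNReal.tsum_le_tsum fun j => ?_
          by_cases hj : j ∈ G
          · rcases eq_or_ne (c j) 0 with h0 | h0
            · simp [h0]
            obtain ⟨m, hm1, hm2⟩ := hcover j h0
            refine le_trans ?_ (ENNReal.le_tsum m)
            rw [if_pos (Finset.mem_filter.2 ⟨(hf m).mem_toFinset.2 hm2, hj⟩)]
            gcongr
          · simp [hg j hj]
      _ = ∑' m, 2⁻¹ ^ m * L * ∑ j ∈ J m, g j t x := by
          rw [ENNReal.tsum_comm]
          refine tsum_congr fun m => ?_
          rw [Finset.mul_sum, tsum_eq_sum (s := J m) fun j hj => if_neg hj]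
          exact Finset.sum_congr rfl fun j hj => if_pos hj
      _ ≤ _ := by
          refine ENNReal.tsum_le_tsum fun m => ?_
          rw [← hrd, mul_pow, mul_assoc (r ^ m), mul_assoc (r ^ m)]
          gcongr
          exact le_iSup (fun x => ∑ j ∈ J m, g j t x) x
  calc ∫⁻ t, (⨆ x, ∑' j, c j * g j t x) ^ q ∂μ
      ≤ ∫⁻ t, S ^ q * ∑' m, (d ^ m * L * F m t) ^ q ∂μ :=
        lintegral_mono fun t =>
          (ENNReal.rpow_le_rpow (hpt t) hq.le).trans (tsum_pow_mul_rpow_le r _ hq)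
    _ = S ^ q * ∑' m, (d ^ m * L) ^ q * ∫⁻ t, F m t ^ q ∂μ := by
        have hFm : ∀ m, Measurable (F m) := fun m => hmeas (J m) (hJG m)
        rw [lintegral_const_mul _ (Measurable.tsum fun m => ((hFm m).const_mul _).pow_const _),
          lintegral_tsum fun m => (((hFm m).const_mul _).pow_const _).aemeasurable]
        congr 1
        refine tsum_congr fun m => ?_
        simp_rw [ENNReal.mul_rpow_of_nonneg _ (F m _) hq.le]
        rw [lintegral_const_mul _ ((hFm m).pow_const q)]
    _ ≤ S ^ q * ∑' m : ℕ, 2 ^ (α * e) * K * L ^ q * ((2 : ℝ≥0∞) ^ (-(q - α * e) / 2)) ^ m := by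
        refine mul_le_mul_right (ENNReal.tsum_le_tsum fun m => ?_) _
        calc (d ^ m * L) ^ q * ∫⁻ t, F m t ^ q ∂μ
            ≤ (d ^ m * L) ^ q * (K * ((2 : ℝ≥0∞) ^ (α * e)) ^ (m + 1)) := by
              gcongr
              exact (hK (J m) (hJG m)).trans (by gcongr; exact hJc m)
          _ = 2 ^ (α * e) * K * L ^ q * ((d ^ m) ^ q * ((2 : ℝ≥0∞) ^ (α * e)) ^ m) := by
              rw [ENNReal.mul_rpow_of_nonneg _ _ hq.le, pow_succ]; ring
          _ = _ := by
              congr 1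
              rw [hd, ← ENNReal.rpow_natCast, ← ENNReal.rpow_natCast, ← ENNReal.rpow_natCast,
                ← ENNReal.rpow_mul, ← ENNReal.rpow_mul, ← ENNReal.rpow_mul, ← ENNReal.rpow_mul,
                ← ENNReal.rpow_add _ _ h20 h2t]
              congr 1
              rw [hη]; field_simp; ring
    _ = _ := by
        rw [ENNReal.tsum_mul_left]; ring

lemma eLp_ofReal {α : Type*} [MeasurableSpace α] (μ : Measure α) {q : ℝ} (hq : 0 < q)
    (F : α → ℝ≥0∞) : eLp μ (ENNReal.ofReal q) F = (∫⁻ t, F t ^ q ∂μ) ^ (1 / q) := by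
  rw [eLp, if_neg ENNReal.ofReal_ne_top, ENNReal.toReal_ofReal hq.le]

lemma seqNormE_ofReal {α : ℝ} (hα : 0 < α) (lam : ℕ → ℝ) :
    seqNormE (ENNReal.ofReal α) lam = (∑' j, ENNReal.ofReal |lam j| ^ α) ^ (1 / α) := by
  rw [seqNormE, if_neg ENNReal.ofReal_ne_top, ENNReal.toReal_ofReal hα.le]

/-- The Fourier transform, normalised so that orthonormality in `Ḣ^s` becomes `WeightedON`. -/
def unitFT {n : ℕ} (f : Rn n → ℂ) (ξ : Rn n) : ℂ := (((2 * π) ^ (-(n : ℝ) / 2) : ℝ) : ℂ) * FT f ξ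

lemma schrodinger_eq {n : ℕ} (f : Rn n → ℂ) (t : ℝ) (x : Rn n) :
    schrodinger f t x = ((2 * π : ℝ) ^ (-(n : ℝ)) : ℝ) • wave (FT f) t x := by
  simp only [schrodinger, prop, wave, phase, one_mul]

lemma two_pi_rpow_half_mul_self (n : ℕ) :
    (2 * π) ^ (-(n : ℝ) / 2) * (2 * π) ^ (-(n : ℝ) / 2) = (2 * π : ℝ) ^ (-(n : ℝ)) := by
  rw [← Real.rpow_add (by positivity), add_halves]

lemma wave_unitFT {n : ℕ} (f : Rn n → ℂ) (t : ℝ) (x : Rn n) :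
    wave (unitFT f) t x = (((2 * π) ^ (-(n : ℝ) / 2) : ℝ) : ℂ) * wave (FT f) t x := by
  unfold wave unitFT
  rw [← integral_const_mul]
  exact integral_congr_ae (Filter.Eventually.of_forall fun ξ => by simp only; ring)

lemma sq_enorm_schrodinger_le {n : ℕ} (f : Rn n → ℂ) (t : ℝ) (x : Rn n) :
    ‖schrodinger f t x‖ₑ ^ 2 ≤ ENNReal.ofReal (‖wave (unitFT f) t x‖ ^ 2) := by
  rw [← ofReal_norm, ← ENNReal.ofReal_pow (norm_nonneg _)]
  refine ENNReal.ofReal_le_ofReal (pow_le_pow_left₀ (norm_nonneg _) ?_ 2)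
  set c : ℝ := (2 * π) ^ (-(n : ℝ) / 2) with hc
  have hc0 : 0 ≤ c := by positivity
  have hc1 : c ≤ 1 := Real.rpow_le_one_of_one_le_of_nonpos (by linarith [Real.pi_gt_three])
    (by have : (0 : ℝ) ≤ n := n.cast_nonneg
        linarith)
  rw [schrodinger_eq, wave_unitFT, norm_smul, norm_mul, Complex.norm_real,
    ← two_pi_rpow_half_mul_self, norm_mul, Real.norm_of_nonneg hc0, mul_assoc]
  exact mul_le_of_le_one_left (by positivity) hc1

lemma wave_of_not_integrable {n : ℕ} {φ : Rn n → ℂ} (h : ¬ Integrable φ) (t : ℝ) (x : Rn n) :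
    wave φ t x = 0 := by
  refine integral_undef fun hi => h ?_
  refine (hi.bdd_mul (c := 1) (aestronglyMeasurable_phase t x).star
    (Filter.Eventually.of_forall fun ξ => ?_)).congr (Filter.Eventually.of_forall fun ξ => ?_)
  · rw [Pi.star_apply, norm_star, norm_phase]
  · have h1 : star (phase t x ξ) * phase t x ξ = 1 := by
      rw [← starRingEnd_apply, Complex.conj_mul', norm_phase]; norm_num
    simp only [Pi.star_apply]
    rw [← mul_assoc, h1, one_mul]

lemma weightedON_unitFT {n : ℕ} {s : ℝ} {f : ℕ → Rn n → ℂ} (h : OrthonormalHs s f)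
    {J : Finset ℕ} (hJ : ∀ j ∈ J, Integrable (unitFT (f j))) :
    WeightedON s (fun j => unitFT (f j)) J := by
  refine ⟨hJ, fun j _ k _ => ?_⟩
  rw [← h j k, ← integral_smul]
  refine integral_congr_ae (Filter.Eventually.of_forall fun ξ => ?_)
  simp only [unitFT, map_mul, Complex.conj_ofReal, Complex.real_smul]
  rw [← two_pi_rpow_half_mul_self]
  push_cast
  ring

lemma eLpNorm_density_le {n : ℕ} (lam : ℕ → ℝ) (f : ℕ → Rn n → ℂ) (t : ℝ) :
    eLpNorm (density lam f t) ∞ volume ≤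
      ⨆ x, ∑' j, ENNReal.ofReal |lam j| * ENNReal.ofReal (‖wave (unitFT (f j)) t x‖ ^ 2) := by
  rw [eLpNorm_exponent_top]
  refine eLpNormEssSup_le_of_ae_enorm_bound (Filter.Eventually.of_forall fun x => ?_)
  refine le_trans ?_ (le_iSup (fun x => ∑' j, ENNReal.ofReal |lam j| *
    ENNReal.ofReal (‖wave (unitFT (f j)) t x‖ ^ 2)) x)
  refine enorm_tsum_le_tsum_enorm.trans (ENNReal.tsum_le_tsum fun j => ?_)
  rw [enorm_mul, enorm_pow, Real.enorm_eq_ofReal_abs, enorm_norm]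
  gcongr
  exact sq_enorm_schrodinger_le _ _ _

lemma exists_mixedLp_density_le {n : ℕ} {q s α : ℝ} (hq : (n = 1 ∧ 2 < q) ∨ (2 ≤ n ∧ 1 < q))
    (hs : s = (n : ℝ) / 2 - 1 / q) (hα : 0 < α) (hαq : α < q) :
    ∃ C : ℝ, 0 < C ∧ ∀ (f : ℕ → Rn n → ℂ) (lam : ℕ → ℝ),
      OrthonormalHs s f → seqNormE (ENNReal.ofReal α) lam ≠ ∞ →
      mixedLp (ENNReal.ofReal q) ∞ (density lam f)
        ≤ ENNReal.ofReal C * seqNormE (ENNReal.ofReal α) lam := by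
  have hq0 : 0 < q := hα.trans hαq
  have hn : 0 < n := by omega
  obtain ⟨a, ha, haq, han⟩ : ∃ a : ℝ, (a = 1 ∨ a = 2) ∧ a < q ∧ 1 / a ≤ (n : ℝ) / 2 := by
    rcases hq with ⟨rfl, h⟩ | ⟨h2, h⟩
    · exact ⟨2, Or.inr rfl, h, by norm_num⟩
    · refine ⟨1, Or.inl rfl, h, ?_⟩
      have : (2 : ℝ) ≤ n := by exact_mod_cast h2
      linarith
  have ha0 : 0 < a := by rcases ha with rfl | rfl <;> norm_num
  obtain ⟨β, hβ1, hβ2⟩ : ∃ β, max (1 / q) (α / (q * a)) < β ∧ β < 1 / a := by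
    refine exists_between (max_lt (one_div_lt_one_div_of_lt ha0 haq) ?_)
    rw [div_lt_div_iff₀ (by positivity) ha0]
    nlinarith
  obtain ⟨hβq, hβα⟩ := max_lt_iff.1 hβ1
  have hβ0 : 0 < β := (one_div_pos.2 hq0).trans hβq
  have hσβ : (n : ℝ) / 2 - ((n : ℝ) / 2 - β) = β := by ring
  obtain ⟨K, hK, hKmain⟩ := WeightedON.exists_lintegral_iSup_rpow_le
    (σ := (n : ℝ) / 2 - β) hn hq0 hs
    (by linarith) (by rw [hs]; linarith) ha (by rw [hσβ]; rwa [lt_div_iff₀' ha0] at hβ2)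
  rw [hσβ] at hKmain
  obtain ⟨C, hC, hCmain⟩ := exists_lintegral_iSup_tsum_rpow_le (e := 1 / (a * β)) hq0 hα
    (by positivity) (by
      rw [mul_one_div, div_lt_iff₀ (by positivity)]
      rw [div_lt_iff₀ (by positivity)] at hβα
      linarith)
  have hCK : (C * K) ^ (1 / q) ≠ ∞ := by finiteness
  refine ⟨((C * K) ^ (1 / q)).toReal + 1, by positivity, fun f lam hf hlam => ?_⟩
  set L := seqNormE (ENNReal.ofReal α) lam with hL
  set c : ℕ → ℝ≥0∞ := fun j => ENNReal.ofReal |lam j| with hc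
  have hLα : L = (∑' j, c j ^ α) ^ (1 / α) := seqNormE_ofReal hα lam
  have hLsum : ∑' j, c j ^ α = L ^ α := by
    rw [hLα, ← ENNReal.rpow_mul, one_div_mul_cancel hα.ne', ENNReal.rpow_one]
  set g : ℕ → ℝ → Rn n → ℝ≥0∞ := fun j t x => ENNReal.ofReal (‖wave (unitFT (f j)) t x‖ ^ 2) with hg
  have hlhs : mixedLp (ENNReal.ofReal q) ∞ (density lam f)
      ≤ (∫⁻ t, (⨆ x, ∑' j, c j * g j t x) ^ q) ^ (1 / q) := by
    rw [mixedLp, eLp_ofReal _ hq0]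
    gcongr with t
    exact eLpNorm_density_le lam f t
  refine hlhs.trans ?_
  rcases eq_or_ne L 0 with h0 | h0
  · have hc0 : ∀ j, c j = 0 := by
      rw [h0, ENNReal.zero_rpow_of_pos hα, ENNReal.tsum_eq_zero] at hLsum
      exact fun j => (ENNReal.rpow_eq_zero_iff_of_pos hα).1 (hLsum j)
    simp [hc0, hq0, h0]
  have hsum : ∀ (J : Finset ℕ) t x, ∑ j ∈ J, g j t x
      = ENNReal.ofReal (∑ j ∈ J, ‖wave (unitFT (f j)) t x‖ ^ 2) := fun J t x => by
    rw [ENNReal.ofReal_sum_of_nonneg fun j _ => by positivity]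
  have hmain := hCmain volume g {j | Integrable (unitFT (f j))} K ?_ ?_ ?_ c L h0 hlam hLsum.le
  · calc _ ≤ (C * K * L ^ q) ^ (1 / q) := by gcongr
      _ = (C * K) ^ (1 / q) * L := by
          rw [ENNReal.mul_rpow_of_nonneg _ _ (by positivity), ← ENNReal.rpow_mul,
            mul_one_div_cancel hq0.ne', ENNReal.rpow_one]
      _ ≤ _ := by
          gcongr
          refine (ENNReal.le_ofReal_iff_toReal_le hCK (by positivity)).2 (by linarith)
  · intro J hJ
    refine LowerSemicontinuous.measurable (lowerSemicontinuous_iSup fun x => ?_)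
    refine Continuous.lowerSemicontinuous ?_
    simp_rw [hsum]
    refine ENNReal.continuous_ofReal.comp (continuous_finsetSum _ fun j hj => ?_)
    exact ((continuous_wave (hJ hj)).comp (continuous_id.prodMk continuous_const)).norm.pow 2
  · intro J hJ
    simp_rw [hsum]
    exact hKmain (fun j => unitFT (f j)) J (weightedON_unitFT hf fun j hj => hJ hj)
  · intro j hj t x
    simp only [hg]
    rw [wave_of_not_integrable hj]
    simp

lemma exists_FT_eq {n : ℕ} {h : Rn n → ℂ} (hc : HasCompactSupport h)
    (hd : ContDiff ℝ (⊤ : ℕ∞) h) : ∃ f : Rn n → ℂ, FT f = h := by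
  have h2π : (2 * π : ℝ) ≠ 0 := by positivity
  have hc' : HasCompactSupport fun η => h ((2 * π) • η) := hc.comp_smul h2π
  have hd' : ContDiff ℝ (⊤ : ℕ∞) fun η => h ((2 * π) • η) := hd.comp (contDiff_const_smul _)
  set H : SchwartzMap (Rn n) ℂ := hc'.toSchwartzMap hd' with hH
  set f : SchwartzMap (Rn n) ℂ := FourierTransformInv.fourierInv H with hf
  have hF : FourierTransform.fourier f = H := FourierTransform.fourier_fourierInv_eq H
  refine ⟨f, funext fun ξ => ?_⟩
  have h1 : FourierTransform.fourier (f : Rn n → ℂ) ((2 * π)⁻¹ • ξ) = h ξ := by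
    rw [← SchwartzMap.fourier_coe, hF]
    change h ((2 * π) • (2 * π)⁻¹ • ξ) = h ξ
    rw [smul_inv_smul₀ h2π]
  rw [← h1, Real.fourier_eq', FT]
  refine integral_congr_ae (Filter.Eventually.of_forall fun x => ?_)
  simp only [smul_eq_mul]
  congr 2
  rw [dotC_eq_inner, inner_smul_right]
  have : (2 * (π : ℂ)) ≠ 0 := by exact_mod_cast h2π
  push_cast
  field_simp

/-- The `Ḣ^s`-normalised dilate of a profile `g` to frequency scale `r`. -/
def dilate {n : ℕ} (s r : ℝ) (g : Rn n → ℝ) (ξ : Rn n) : ℝ :=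
  r ^ (-(s + n / 2)) * g (r⁻¹ • ξ)

lemma integral_dilate_sq {n : ℕ} (s : ℝ) {r : ℝ} (hr : 0 < r) (g : Rn n → ℝ) :
    ∫ ξ : Rn n, ‖ξ‖ ^ (2 * s) * (dilate s r g ξ * dilate s r g ξ) =
      ∫ ξ : Rn n, ‖ξ‖ ^ (2 * s) * (g ξ * g ξ) := by
  have h1 : ∀ ξ : Rn n, ‖ξ‖ ^ (2 * s) * (dilate s r g ξ * dilate s r g ξ) =
      r ^ (-(n : ℝ)) * (fun η => ‖η‖ ^ (2 * s) * (g η * g η)) (r⁻¹ • ξ) := by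
    intro ξ
    have h2 : ‖ξ‖ = r * ‖r⁻¹ • ξ‖ := by
      rw [norm_smul, Real.norm_of_nonneg (by positivity), mul_inv_cancel_left₀ hr.ne']
    have h3 : r ^ (-(n : ℝ)) = r ^ (2 * s) * (r ^ (-(s + n / 2)) * r ^ (-(s + n / 2))) := by
      rw [← Real.rpow_add hr, ← Real.rpow_add hr]
      ring_nf
    rw [h3, h2, Real.mul_rpow hr.le (norm_nonneg _), dilate]
    ring
  rw [integral_congr_ae (Filter.Eventually.of_forall h1), integral_const_mul,
    Measure.integral_comp_smul volume (fun η : Rn n => ‖η‖ ^ (2 * s) * (g η * g η)),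
    finrank_euclideanSpace_fin, abs_of_pos (by positivity), smul_eq_mul, ← mul_assoc,
    Real.rpow_neg hr.le,
    Real.rpow_natCast, inv_pow, inv_inv, inv_mul_cancel₀ (by positivity), one_mul]

lemma wave_dilate_zero {n : ℕ} (s : ℝ) {r : ℝ} (hr : 0 < r) (g : Rn n → ℝ) (t : ℝ) :
    wave (fun ξ => (dilate s r g ξ : ℂ)) t 0 =
      ((r ^ ((n : ℝ) / 2 - s) : ℝ) : ℂ) * wave (fun ξ => (g ξ : ℂ)) (r ^ 2 * t) 0 := by
  have h1 : ∀ ξ : Rn n, phase t 0 ξ * (dilate s r g ξ : ℂ) =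
      ((r ^ (-(s + n / 2)) : ℝ) : ℂ) *
        (fun η : Rn n => phase (r ^ 2 * t) 0 η * (g η : ℂ)) (r⁻¹ • ξ) := by
    intro ξ
    have h2 : ‖ξ‖ = r * ‖r⁻¹ • ξ‖ := by
      rw [norm_smul, Real.norm_of_nonneg (by positivity), mul_inv_cancel_left₀ hr.ne']
    have h3 : phase t 0 ξ = phase (r ^ 2 * t) 0 (r⁻¹ • ξ) := by
      simp only [phase, dotC_eq_inner, inner_zero_left]
      rw [h2]
      push_cast
      ring_nf
    rw [h3, dilate]
    push_cast
    ring
  unfold wave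
  rw [integral_congr_ae (Filter.Eventually.of_forall h1), integral_const_mul,
    Measure.integral_comp_smul volume (fun η : Rn n => phase (r ^ 2 * t) 0 η * (g η : ℂ)),
    finrank_euclideanSpace_fin, abs_of_pos (by positivity), inv_pow, inv_inv, Complex.real_smul,
    ← mul_assoc, ← Complex.ofReal_mul, ← Real.rpow_natCast r n, ← Real.rpow_add hr]
  ring_nf

lemma exists_contDiff_annulus_bump {n : ℕ} (hn : 1 ≤ n) :
    ∃ g : Rn n → ℝ, ContDiff ℝ (⊤ : ℕ∞) g ∧ HasCompactSupport g ∧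
      (∀ ξ, g ξ ≠ 0 → 1 < ‖ξ‖ ∧ ‖ξ‖ < 2) ∧ 0 < ∫ ξ, g ξ := by
  set c : Rn n := EuclideanSpace.single ⟨0, hn⟩ (3 / 2 : ℝ) with hc
  have hcn : ‖c‖ = 3 / 2 := by
    rw [hc, PiLp.norm_single, Real.norm_of_nonneg (by norm_num)]
  let b : ContDiffBump c := ⟨1 / 4, 1 / 2, by norm_num, by norm_num⟩
  refine ⟨b, b.contDiff, b.hasCompactSupport, fun ξ hξ => ?_, b.integral_pos⟩
  have h1 : ξ ∈ Metric.ball c (1 / 2) := by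
    rw [show (1 / 2 : ℝ) = b.rOut from rfl, ← b.support_eq]
    exact hξ
  rw [Metric.mem_ball, dist_eq_norm] at h1
  have h2 := norm_sub_norm_le c ξ
  have h3 := norm_sub_norm_le ξ c
  rw [norm_sub_rev] at h2
  constructor <;> linarith

lemma integral_norm_rpow_mul_self_pos {n : ℕ} (s : ℝ) {g : Rn n → ℝ} (hg : Continuous g)
    (hgc : HasCompactSupport g) (hsupp : ∀ ξ, g ξ ≠ 0 → 1 < ‖ξ‖ ∧ ‖ξ‖ < 2)
    (hpos : 0 < ∫ ξ, g ξ) : 0 < ∫ ξ : Rn n, ‖ξ‖ ^ (2 * s) * (g ξ * g ξ) := by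
  have hi : Integrable fun ξ : Rn n => ‖ξ‖ ^ (2 * s) * (g ξ * g ξ) := by
    have h1 : Integrable fun ξ : Rn n => (2 : ℝ) ^ |2 * s| * (g ξ * g ξ) :=
      ((hg.mul hg).integrable_of_hasCompactSupport hgc.mul_left).const_mul _
    refine h1.mono' ?_ (Filter.Eventually.of_forall fun ξ => ?_)
    · exact ((measurable_norm.pow_const _).mul (hg.mul hg).measurable).aestronglyMeasurable
    · rw [Real.norm_of_nonneg (mul_nonneg (by positivity) (mul_self_nonneg _))]
      rcases eq_or_ne (g ξ) 0 with h0 | h0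
      · simp [h0]
      · refine mul_le_mul_of_nonneg_right ?_ (mul_self_nonneg _)
        obtain ⟨h2, h3⟩ := hsupp ξ h0
        exact (Real.rpow_le_rpow_of_exponent_le h2.le (le_abs_self _)).trans
          (Real.rpow_le_rpow (norm_nonneg _) h3.le (abs_nonneg _))
  rw [integral_pos_iff_support_of_nonneg
    (fun ξ => mul_nonneg (by positivity) (mul_self_nonneg _)) hi]
  have hsub : Function.support g ⊆
      Function.support fun ξ : Rn n => ‖ξ‖ ^ (2 * s) * (g ξ * g ξ) := by
    intro ξ hξ
    have h2 := (hsupp ξ hξ).1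
    exact mul_ne_zero (by positivity) (mul_self_ne_zero.2 hξ)
  refine lt_of_lt_of_le ?_ (measure_mono hsub)
  refine hg.isOpen_support.measure_pos _ (Function.support_nonempty_iff.2 ?_)
  rintro rfl
  simp at hpos

lemma dilate_mul_dilate_eq_zero {n : ℕ} (s : ℝ) {g : Rn n → ℝ}
    (hsupp : ∀ ξ, g ξ ≠ 0 → 1 < ‖ξ‖ ∧ ‖ξ‖ < 2) {j k : ℕ} (hjk : j ≠ k) (ξ : Rn n) :
    dilate s (2 ^ j) g ξ * dilate s (2 ^ k) g ξ = 0 := by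
  by_contra h
  have key : ∀ i : ℕ, dilate s (2 ^ i) g ξ ≠ 0 → (2 : ℝ) ^ i < ‖ξ‖ ∧ ‖ξ‖ < 2 ^ (i + 1) := by
    intro i hi
    have h2 := hsupp _ (right_ne_zero_of_mul hi)
    rw [norm_smul, Real.norm_of_nonneg (by positivity), inv_mul_eq_div, one_lt_div (by positivity),
      div_lt_iff₀ (by positivity)] at h2
    rwa [pow_succ']
  obtain ⟨h1, h2⟩ := key j (left_ne_zero_of_mul h)
  obtain ⟨h3, h4⟩ := key k (right_ne_zero_of_mul h)
  have h5 := (pow_lt_pow_iff_right₀ (one_lt_two (α := ℝ))).1 (h1.trans h4)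
  have h6 := (pow_lt_pow_iff_right₀ (one_lt_two (α := ℝ))).1 (h3.trans h2)
  omega

lemma exists_orthonormalHs_concentrating {n : ℕ} (hn : 1 ≤ n) (s : ℝ) :
    ∃ f : ℕ → Rn n → ℂ, OrthonormalHs s f ∧ (∀ j t, Continuous (schrodinger (f j) t)) ∧
      ∃ c : ℝ, 0 < c ∧ ∃ T : ℝ, 0 < T ∧ ∀ (k : ℕ) (t : ℝ), 4 ^ k * |t| ≤ T →
        c * ((4 : ℝ) ^ k) ^ ((n : ℝ) / 2 - s) ≤ ‖schrodinger (f k) t 0‖ ^ 2 := by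
  obtain ⟨g, hgd, hgc, hsupp, hpos⟩ := exists_contDiff_annulus_bump hn
  have hI := integral_norm_rpow_mul_self_pos s hgd.continuous hgc hsupp hpos
  set I : ℝ := ∫ ξ : Rn n, ‖ξ‖ ^ (2 * s) * (g ξ * g ξ) with hIdef
  set d : ℝ := (2 * π : ℝ) ^ (-(n : ℝ)) with hd
  have hd0 : 0 < d := by positivity
  set a : ℝ := (√(d * I))⁻¹ with ha
  have ha0 : 0 < a := by positivity
  have haa : d * (a * a * I) = 1 := by
    rw [ha, ← mul_inv, Real.mul_self_sqrt (by positivity)]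
    field_simp
  have hdil : ∀ k : ℕ, HasCompactSupport (dilate s (2 ^ k) g) ∧
      ContDiff ℝ (⊤ : ℕ∞) (dilate s (2 ^ k) g) := fun k =>
    ⟨(hgc.comp_smul (by positivity)).mul_left,
      contDiff_const.mul (hgd.comp (contDiff_const_smul _))⟩
  have hsm : ∀ k : ℕ, HasCompactSupport (fun ξ => (a : ℂ) * (dilate s (2 ^ k) g ξ : ℂ)) ∧
      ContDiff ℝ (⊤ : ℕ∞) (fun ξ => (a : ℂ) * (dilate s (2 ^ k) g ξ : ℂ)) := fun k =>
    ⟨((hdil k).1.comp_left (g := fun x : ℝ => (x : ℂ)) Complex.ofReal_zero).mul_left,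
      contDiff_const.mul (Complex.ofRealCLM.contDiff.comp (hdil k).2)⟩
  choose f hf using fun k => exists_FT_eq (hsm k).1 (hsm k).2
  have hInt : ∀ k, Integrable (FT (f k)) := fun k => by
    rw [hf]
    exact (hsm k).2.continuous.integrable_of_hasCompactSupport (hsm k).1
  refine ⟨f, fun j k => ?_, fun j t => ?_, ?_⟩
  · have h1 : ∀ ξ : Rn n, ((‖ξ‖ ^ (2 * s) : ℝ) : ℂ) *
        (FT (f j) ξ * (starRingEnd ℂ) (FT (f k) ξ)) = ((a * a * (‖ξ‖ ^ (2 * s) *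
          (dilate s (2 ^ j) g ξ * dilate s (2 ^ k) g ξ)) : ℝ) : ℂ) := by
      intro ξ
      simp only [hf, map_mul, Complex.conj_ofReal]
      push_cast
      ring
    rw [integral_congr_ae (Filter.Eventually.of_forall h1), integral_complex_ofReal,
      integral_const_mul, Complex.real_smul, ← Complex.ofReal_mul]
    split_ifs with hjk
    · rw [← hjk, integral_dilate_sq s (by positivity), ← hIdef, haa, Complex.ofReal_one]
    · simp [dilate_mul_dilate_eq_zero s hsupp hjk]
  · have h1 : schrodinger (f j) t = fun x => d • wave (FT (f j)) t x :=
      funext fun x => schrodinger_eq _ _ _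
    rw [h1]
    exact ((continuous_wave (hInt j)).comp (Continuous.prodMk_right t)).const_smul d
  · set v : ℝ → ℂ := fun τ => wave (fun ξ : Rn n => (g ξ : ℂ)) τ 0 with hv
    have hgi : Integrable fun ξ : Rn n => (g ξ : ℂ) :=
      (hgd.continuous.integrable_of_hasCompactSupport hgc).ofReal
    have hvc : Continuous v := by
      have h1 := (continuous_wave hgi).comp (Continuous.prodMk_left (X := ℝ) (0 : Rn n))
      simpa only [Function.comp_def] using h1
    set G : ℝ := ∫ ξ, g ξ with hG
    have hv0 : v 0 = G := by
      simp [hv, wave, phase, dotC_eq_inner, integral_complex_ofReal, hG]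
    have hev : ∀ᶠ τ in nhds (0 : ℝ), G / 2 < ‖v τ‖ := by
      refine hvc.norm.continuousAt.eventually_const_lt ?_
      beta_reduce
      rw [hv0, Complex.norm_real, Real.norm_of_nonneg hpos.le]
      exact half_lt_self hpos
    obtain ⟨ε, hε, hball⟩ := Metric.eventually_nhds_iff.1 hev
    refine ⟨(d * a * (G / 2)) ^ 2, by positivity, ε / 2, by positivity, fun k t ht => ?_⟩
    have h4 : ((2 : ℝ) ^ k) ^ 2 = 4 ^ k := by
      rw [← pow_mul, mul_comm, pow_mul]; norm_num
    have h1 : schrodinger (f k) t 0 =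
        ((d * a * (2 ^ k : ℝ) ^ ((n : ℝ) / 2 - s) : ℝ) : ℂ) * v (4 ^ k * t) := by
      have h2 : wave (FT (f k)) t 0 =
          (a : ℂ) * wave (fun ξ => (dilate s (2 ^ k) g ξ : ℂ)) t 0 := by
        unfold wave
        rw [← integral_const_mul, hf]
        exact integral_congr_ae (Filter.Eventually.of_forall fun ξ => by simp only; ring)
      rw [schrodinger_eq, h2, wave_dilate_zero s (by positivity), h4, Complex.real_smul]
      push_cast
      ring
    have h2 : G / 2 < ‖v (4 ^ k * t)‖ := by
      apply hball
      rw [dist_zero_right, Real.norm_eq_abs, abs_mul, abs_of_pos (by positivity)]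
      linarith
    have h3 : ((4 : ℝ) ^ k) ^ ((n : ℝ) / 2 - s) = ((2 ^ k : ℝ) ^ ((n : ℝ) / 2 - s)) ^ 2 := by
      rw [← h4, ← Real.rpow_natCast _ 2, ← Real.rpow_natCast _ 2, ← Real.rpow_mul (by positivity),
        ← Real.rpow_mul (by positivity), mul_comm]
    rw [h1, norm_mul, Complex.norm_real, Real.norm_of_nonneg (by positivity), h3, ← mul_pow]
    refine pow_le_pow_left₀ (by positivity) ?_ 2
    rw [mul_right_comm]
    gcongr

lemma enorm_le_eLpNorm_top {X E : Type*} [TopologicalSpace X] [MeasurableSpace X]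
    [NormedAddCommGroup E] {μ : Measure X} [μ.IsOpenPosMeasure] {F : X → E} (hF : Continuous F)
    (x : X) : ‖F x‖ₑ ≤ eLpNorm F ∞ μ := by
  rw [eLpNorm_exponent_top]
  have hd : Dense {y | ‖F y‖ₑ ≤ eLpNormEssSup F μ} :=
    Measure.dense_of_ae (enorm_ae_le_eLpNormEssSup F μ)
  have hc : IsClosed {y | ‖F y‖ₑ ≤ eLpNormEssSup F μ} :=
    isClosed_le hF.enorm continuous_const
  exact (hc.closure_eq ▸ hd x :)

lemma mul_le_lintegral_of_forall_le {F : ℝ → ℝ≥0∞} {B T : ℝ} (hT : 0 < T) {N : ℕ}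
    (hF : ∀ k < N, ∀ t, 0 < t → 4 ^ k * t ≤ T → ENNReal.ofReal (B * 4 ^ k) ≤ F t) :
    (N : ℝ≥0∞) * ENNReal.ofReal (B * (3 / 4 * T)) ≤ ∫⁻ t, F t := by
  set A : ℕ → Set ℝ := fun k => Ioc (T / 4 ^ (k + 1)) (T / 4 ^ k) with hA
  have hanti : Antitone fun k : ℕ => T / (4 : ℝ) ^ k := by
    intro j k hjk
    simp only
    gcongr
    norm_num
  have hdisj : (Finset.range N : Set ℕ).PairwiseDisjoint A :=
    fun j _ k _ hjk => hanti.pairwise_disjoint_on_Ioc_succ hjk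
  calc (N : ℝ≥0∞) * ENNReal.ofReal (B * (3 / 4 * T))
      = ∑ k ∈ Finset.range N, ENNReal.ofReal (B * (3 / 4 * T)) := by simp
    _ ≤ ∑ k ∈ Finset.range N, ∫⁻ t in A k, F t := by
      refine Finset.sum_le_sum fun k hk => ?_
      have h1 : ENNReal.ofReal (B * (3 / 4 * T)) =
          ∫⁻ _ in A k, ENNReal.ofReal (B * 4 ^ k) := by
        rw [setLIntegral_const, hA, Real.volume_Ioc, ← ENNReal.ofReal_mul']
        · congr 1
          rw [pow_succ]
          field_simp
          ring
        · exact sub_nonneg.2 (hanti k.le_succ)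
      rw [h1]
      refine setLIntegral_mono' measurableSet_Ioc fun t ht => ?_
      refine hF k (Finset.mem_range.1 hk) t (lt_trans (by positivity) ht.1) ?_
      have h2 := ht.2
      rwa [le_div_iff₀ (by positivity), mul_comm] at h2
    _ = ∫⁻ t in ⋃ k ∈ Finset.range N, A k, F t :=
      (lintegral_biUnion_finset hdisj (fun _ _ => measurableSet_Ioc) _).symm
    _ ≤ ∫⁻ t, F t := setLIntegral_le_lintegral _ _

lemma natCast_mul_le_mixedLp_density_indicator {n : ℕ} {q s : ℝ} (hn : 1 ≤ n) (hq : 0 < q)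
    (hs : s = (n : ℝ) / 2 - 1 / q) :
    ∃ f : ℕ → Rn n → ℂ, OrthonormalHs s f ∧ ∃ A : ℝ, 0 < A ∧ ∀ N : ℕ,
      ((N : ℝ≥0∞) * ENNReal.ofReal A) ^ (1 / q) ≤ mixedLp (ENNReal.ofReal q) ∞
        (density (fun j => if j < N then 1 else 0) f) := by
  obtain ⟨f, hf, hcont, c, hc, T, hT, hlow⟩ := exists_orthonormalHs_concentrating hn s
  refine ⟨f, hf, c ^ q * (3 / 4 * T), by positivity, fun N => ?_⟩
  have hden : ∀ t, density (fun j => if j < N then 1 else 0) f t =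
      fun x => ∑ j ∈ Finset.range N, ‖schrodinger (f j) t x‖ ^ 2 := by
    intro t
    funext x
    rw [density, density2, tsum_eq_sum (s := Finset.range N)]
    · exact Finset.sum_congr rfl fun j hj => by rw [if_pos (Finset.mem_range.1 hj), one_mul]
    · intro j hj
      rw [if_neg (fun h => hj (Finset.mem_range.2 h)), zero_mul]
  rw [mixedLp, eLp_ofReal _ hq]
  refine ENNReal.rpow_le_rpow ?_ (by positivity)
  refine mul_le_lintegral_of_forall_le hT fun k hk t ht hkt => ?_
  have h1 : ENNReal.ofReal (c * ((4 : ℝ) ^ k) ^ (1 / q)) ≤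
      eLpNorm (density (fun j => if j < N then 1 else 0) f t) ∞ volume := by
    have hc' : Continuous fun x => ∑ j ∈ Finset.range N, ‖schrodinger (f j) t x‖ ^ 2 :=
      continuous_finsetSum _ fun j _ => (hcont j t).norm.pow 2
    rw [hden]
    refine le_trans ?_ (enorm_le_eLpNorm_top hc' 0)
    rw [← ofReal_norm, Real.norm_of_nonneg (Finset.sum_nonneg fun _ _ => sq_nonneg _)]
    refine ENNReal.ofReal_le_ofReal ?_
    have h2 := hlow k t (by rwa [abs_of_pos ht])
    rw [show (n : ℝ) / 2 - s = 1 / q by rw [hs]; ring] at h2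
    exact h2.trans (Finset.single_le_sum (f := fun j => ‖schrodinger (f j) t 0‖ ^ 2)
      (fun _ _ => sq_nonneg _) (Finset.mem_range.2 hk))
  refine le_trans (le_of_eq ?_) (ENNReal.rpow_le_rpow h1 hq.le)
  rw [ENNReal.ofReal_rpow_of_nonneg (by positivity) hq.le, Real.mul_rpow hc.le (by positivity),
    ← Real.rpow_mul (by positivity), one_div_mul_cancel hq.ne', Real.rpow_one]

lemma not_exists_mixedLp_density_le {n : ℕ} {q s α : ℝ} (hn : 1 ≤ n) (hq : 0 < q)
    (hs : s = (n : ℝ) / 2 - 1 / q) (hqα : q < α) :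
    ¬ ∃ C : ℝ, 0 < C ∧ ∀ (f : ℕ → Rn n → ℂ) (lam : ℕ → ℝ),
      OrthonormalHs s f → seqNormE (ENNReal.ofReal α) lam ≠ ∞ →
      mixedLp (ENNReal.ofReal q) ∞ (density lam f)
        ≤ ENNReal.ofReal C * seqNormE (ENNReal.ofReal α) lam := by
  rintro ⟨C, hC, h⟩
  have hα : 0 < α := hq.trans hqα
  obtain ⟨f, hf, A, hA, hlow⟩ := natCast_mul_le_mixedLp_density_indicator hn hq hs
  have hnorm : ∀ N : ℕ, seqNormE (ENNReal.ofReal α) (fun j => if j < N then 1 else 0) =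
      ENNReal.ofReal ((N : ℝ) ^ (1 / α)) := by
    intro N
    rw [seqNormE_ofReal hα, tsum_eq_sum (s := Finset.range N)]
    · rw [Finset.sum_congr rfl (g := fun _ => (1 : ℝ≥0∞))
        fun j hj => by simp [Finset.mem_range.1 hj]]
      rw [Finset.sum_const, Finset.card_range, nsmul_one,
        ← ENNReal.ofReal_rpow_of_nonneg (by positivity) (by positivity), ENNReal.ofReal_natCast]
    · intro j hj
      simp [Finset.mem_range.not.1 hj, hα]
  have key : ∀ N : ℕ, ((N : ℝ) * A) ^ (1 / q) ≤ C * (N : ℝ) ^ (1 / α) := by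
    intro N
    have h1 := (hlow N).trans (h f _ hf (by rw [hnorm]; exact ENNReal.ofReal_ne_top))
    rw [hnorm, ← ENNReal.ofReal_natCast, ← ENNReal.ofReal_mul (by positivity),
      ENNReal.ofReal_rpow_of_nonneg (by positivity) (by positivity), ← ENNReal.ofReal_mul hC.le,
      ENNReal.ofReal_le_ofReal_iff (by positivity)] at h1
    exact h1
  have hexp : 0 < 1 / q - 1 / α := sub_pos.2 (one_div_lt_one_div_of_lt hq hqα)
  have htend := (tendsto_rpow_atTop hexp).comp (tendsto_natCast_atTop_atTop (R := ℝ))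
  obtain ⟨N, hN, hN1⟩ := ((htend.eventually_gt_atTop (C / A ^ (1 / q))).and
    (Filter.eventually_ge_atTop 1)).exists
  have hN0 : (0 : ℝ) < N := by exact_mod_cast hN1
  have h1 := key N
  simp only [Function.comp_apply] at hN
  rw [div_lt_iff₀ (by positivity)] at hN
  have h2 : ((N : ℝ) * A) ^ (1 / q) =
      (N : ℝ) ^ (1 / q - 1 / α) * A ^ (1 / q) * (N : ℝ) ^ (1 / α) := by
    rw [Real.mul_rpow hN0.le hA.le, mul_right_comm, ← Real.rpow_add hN0, sub_add_cancel]
  rw [h2] at h1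
  exact absurd h1 (not_le.2 (mul_lt_mul_of_pos_right hN (by positivity)))

/-- (Bez–Kinoshita–Shiraki.)  Boundary case `p = ∞`: for
`s = n/2 - 1/q`, with `n = 1, 2 < q < ∞` or `n ≥ 2, 1 < q < ∞`, the estimate
`‖Σ λ_j |e^{itΔ}f_j|²‖_{L^q(ℝ, L^∞(ℝⁿ))} ≲ ‖λ‖_{ℓ^α}` holds over systems orthonormal
in `Ḣ^s(ℝⁿ)` for every `α < q`, and fails for every `α > q`. -/
theorem boundary_p_infty (n : ℕ) (q s : ℝ)
    (hq : (n = 1 ∧ 2 < q) ∨ (2 ≤ n ∧ 1 < q))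
    (hs : s = (n : ℝ) / 2 - 1 / q) :
    (∀ α : ℝ, 1 ≤ α → α < q →
      ∃ C : ℝ, 0 < C ∧ ∀ (f : ℕ → Rn n → ℂ) (lam : ℕ → ℝ),
        OrthonormalHs s f → seqNormE (ENNReal.ofReal α) lam ≠ ∞ →
        mixedLp (ENNReal.ofReal q) ∞ (density lam f)
          ≤ ENNReal.ofReal C * seqNormE (ENNReal.ofReal α) lam) ∧
    ∀ α : ℝ, q < α →
      ¬ ∃ C : ℝ, 0 < C ∧ ∀ (f : ℕ → Rn n → ℂ) (lam : ℕ → ℝ),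
        OrthonormalHs s f → seqNormE (ENNReal.ofReal α) lam ≠ ∞ →
        mixedLp (ENNReal.ofReal q) ∞ (density lam f)
          ≤ ENNReal.ofReal C * seqNormE (ENNReal.ofReal α) lam := by
  have hn : 1 ≤ n := by omega
  have hq0 : 0 < q := by rcases hq with h | h <;> linarith [h.2]
  exact ⟨fun α h1 h2 => exists_mixedLp_density_le hq hs (by linarith) h2,
    fun α hα => not_exists_mixedLp_density_le hn hq0 hs hα⟩
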